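/- Let (X,d) be a metric space with marked point p, and suppose every pretangent space Ω_{p,r̃}^X is separable and tangent. If liminf_{w,x,y,z→p} A₃(w,x,y,z) ≥ 0 and X is Busemann convex at p, then every pretangent space Ω_{p,r̃}^X is a Ptolemaic, Busemann convex geodesic metric space (i.e., a CAT(0) space by the Foertsch–Lytchak–Schroeder characterization). -/

import Mathlib

open Filter Topology

universe u

section Defs

variable {X : Type u} [MetricSpace X]

/-- A normalizing sequence is a sequence of positive reals tending to zero. -/
def IsNormalizingSeq (r : ℕ → ℝ) : Prop :=
  (∀ n, 0 < r n) ∧ Tendsto r atTop (𝓝 0)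

/-- Two sequences of points of `X` are mutually stable w.r.t. `r` if
`d(x_n, y_n)/r_n` converges to a finite limit. -/
def MutuallyStable (r : ℕ → ℝ) (x y : ℕ → X) : Prop :=
  ∃ L : ℝ, Tendsto (fun n => dist (x n) (y n) / r n) atTop (𝓝 L)

/-- A family of sequences is self-stable if any two members are mutually stable. -/
def SelfStable (r : ℕ → ℝ) (F : Set (ℕ → X)) : Prop :=
  ∀ x ∈ F, ∀ y ∈ F, MutuallyStable r x y

/-- A maximal self-stable family containing the constant sequence `p`. -/
def MaximalSelfStable (p : X) (r : ℕ → ℝ) (F : Set (ℕ → X)) : Prop :=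
  SelfStable r F ∧ (fun _ => p) ∈ F ∧
    ∀ G : Set (ℕ → X), SelfStable r G → F ⊆ G → G = F

/-- `(Ω, π)` is (a realization of) the pretangent space of `X` at `p`
with respect to the normalizing sequence `r` and the maximal self-stable family
`F`; the map `π` is the metric identification projection, so that the distance
in `Ω` between `π x` and `π y` is `lim_n d(x_n,y_n)/r_n`. -/
def IsPretangentSpace (p : X) (r : ℕ → ℝ) (F : Set (ℕ → X))
    {Ω : Type u} [MetricSpace Ω] (π : (ℕ → X) → Ω) : Prop :=
  IsNormalizingSeq r ∧ MaximalSelfStable p r F ∧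
    (∀ ω : Ω, ∃ x ∈ F, π x = ω) ∧
    ∀ x ∈ F, ∀ y ∈ F,
      Tendsto (fun n => dist (x n) (y n) / r n) atTop (𝓝 (dist (π x) (π y)))

/-- The pretangent space determined by the maximal self-stable family `F` is
tangent: for every strictly increasing sequence `φ` of naturals and every
maximal self-stable family `F'` w.r.t. `r ∘ φ` containing all `x ∘ φ` with
`x ∈ F`, the canonical isometric embedding `em'` is bijective (being always an
isometric embedding it suffices that it be surjective, as stated here). -/
def IsTangentFamily (p : X) (r : ℕ → ℝ) (F : Set (ℕ → X)) : Prop :=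
  ∀ φ : ℕ → ℕ, StrictMono φ →
    ∀ F' : Set (ℕ → X), MaximalSelfStable p (r ∘ φ) F' →
      (∀ x ∈ F, x ∘ φ ∈ F') →
      ∀ y ∈ F', ∃ x ∈ F,
        Tendsto (fun k => dist (x (φ k)) (y k) / r (φ k)) atTop (𝓝 0)

/-- `δ_p(w,x,y,z) = max_i d(x_i, p)`. -/
noncomputable def delta4 (p w x y z : X) : ℝ :=
  max (dist w p) (max (dist x p) (max (dist y p) (dist z p)))

/-- `δ_p(x,y,z) = max_i d(x_i, p)`. -/
noncomputable def delta3 (p x y z : X) : ℝ :=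
  max (dist x p) (max (dist y p) (dist z p))

open Classical in
/-- The function `A₁` of Berg–Nikolaev type. -/
noncomputable def A1 (p w x y z : X) : ℝ :=
  if w = p ∧ x = p ∧ y = p ∧ z = p then 0
  else (dist w x ^ 2 + dist x y ^ 2 + dist y z ^ 2 + dist z w ^ 2
          - dist w y ^ 2 - dist x z ^ 2) / delta4 p w x y z ^ 2

open Classical in
/-- The function `A₂` of Lebedeva–Petrunin type. -/
noncomputable def A2 (p w x y z : X) : ℝ :=
  if w = p ∧ x = p ∧ y = p ∧ z = p then 0
  else (dist w x ^ 2 + dist w y ^ 2 + dist w z ^ 2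
          - (dist x y ^ 2 + dist y z ^ 2 + dist z x ^ 2) / 3) / delta4 p w x y z ^ 2

open Classical in
/-- The function `A₃` of Ptolemy type. -/
noncomputable def A3 (p w x y z : X) : ℝ :=
  if w = p ∧ x = p ∧ y = p ∧ z = p then 0
  else (dist x w * dist y z + dist x z * dist y w - dist x y * dist w z)
          / delta4 p w x y z ^ 2

open Classical in
/-- The quotient `|d(w,z) - d(x,y)/2| / δ_p(x,y)`, valued in `EReal`, with the
conventions: `0` if `x = y = p` and `z = p`, and `+∞` if `x = y = p` but `z ≠ p`. -/
noncomputable def midQuot (p w x y z : X) : EReal :=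
  if x = p ∧ y = p then (if z = p then (0 : EReal) else ⊤)
  else ((|dist w z - dist x y / 2| / max (dist x p) (dist y p) : ℝ) : EReal)

/-- `z` is an infinitesimal midpoint of the sequences `x` and `y`. -/
def IsInfinitesimalMidpoint (p : X) (x y z : ℕ → X) : Prop :=
  Tendsto (fun n => midQuot p (x n) (x n) (y n) (z n)) atTop (𝓝 (0 : EReal)) ∧
    Tendsto (fun n => midQuot p (y n) (x n) (y n) (z n)) atTop (𝓝 (0 : EReal))

/-- `X` is midpoint convex at the marked point `p`. -/
def MidpointConvexAt (p : X) : Prop :=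
  ∀ x y : ℕ → X, Tendsto x atTop (𝓝 p) → Tendsto y atTop (𝓝 p) →
    ∃ z : ℕ → X, IsInfinitesimalMidpoint p x y z

/-- `X` is Busemann convex at the marked point `p`. -/
def BusemannConvexAt (p : X) : Prop :=
  MidpointConvexAt p ∧
    ∀ x0 x1 y m : ℕ → X, Tendsto x0 atTop (𝓝 p) → Tendsto x1 atTop (𝓝 p) →
      Tendsto y atTop (𝓝 p) → IsInfinitesimalMidpoint p x0 x1 m →
      Tendsto (fun n =>
          max (dist (m n) (y n) - (dist (x0 n) (y n) + dist (x1 n) (y n)) / 2) 0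
            / delta3 p (x0 n) (y n) (x1 n)) atTop (𝓝 (0 : ℝ))

end Defs

section MetricDefs

/-- `s` is a geodesic segment with endpoints `x` and `y`: a subset isometric to
the closed interval `[0, d(x,y)]`, the endpoints of the interval corresponding
to `x` and `y`. -/
def IsGeodesicSegment {Z : Type u} [MetricSpace Z] (s : Set Z) (x y : Z) : Prop :=
  ∃ f : ℝ → Z,
    (∀ a ∈ Set.Icc 0 (dist x y), ∀ b ∈ Set.Icc 0 (dist x y),
      dist (f a) (f b) = |a - b|) ∧
    f '' Set.Icc 0 (dist x y) = s ∧ f 0 = x ∧ f (dist x y) = y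

/-- A metric space is geodesic if any two points are the endpoints of some
geodesic segment. -/
def IsGeodesicSpace (Y : Type u) [MetricSpace Y] : Prop :=
  ∀ x y : Y, ∃ s : Set Y, IsGeodesicSegment s x y

/-- `m` is a midpoint of `x` and `y`. -/
def IsMidpointOf {Z : Type u} [MetricSpace Z] (m x y : Z) : Prop :=
  dist m x = dist x y / 2 ∧ dist m y = dist x y / 2

/-- An affinely parametrized geodesic `γ : [a,b] → Z`:
`d(γ s, γ t) = λ |s - t|` for some constant `λ ≥ 0`. -/
def IsAffineGeodesic {Z : Type u} [MetricSpace Z] (γ : ℝ → Z) (a b : ℝ) : Prop :=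
  ∃ lam : ℝ, 0 ≤ lam ∧ ∀ s ∈ Set.Icc a b, ∀ t ∈ Set.Icc a b,
    dist (γ s) (γ t) = lam * |s - t|

/-- Busemann convexity of a (geodesic) metric space: for any two affinely
parametrized geodesics the joint distance function is convex. -/
def BusemannConvex (Y : Type u) [MetricSpace Y] : Prop :=
  ∀ (a b a' b' : ℝ) (γ γ' : ℝ → Y), IsAffineGeodesic γ a b →
    IsAffineGeodesic γ' a' b' →
    ConvexOn ℝ (Set.Icc a b ×ˢ Set.Icc a' b')
      (fun q : ℝ × ℝ => dist (γ q.1) (γ' q.2))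

/-- A metric space is Ptolemaic if the Ptolemy inequality holds. -/
def Ptolemaic (Y : Type u) [MetricSpace Y] : Prop :=
  ∀ x y u v : Y, dist x y * dist u v ≤ dist x u * dist y v + dist x v * dist y u

end MetricDefs


/-- Metric spaces with the properties of pretangent spaces that the argument needs. -/
structure Good (Y : Type u) [MetricSpace Y] (p : Y) : Prop where
  proper : ProperSpace Y
  mid : ∀ x y : Y, ∃ m, dist x m = dist x y / 2 ∧ dist m y = dist x y / 2
  ptol : ∀ x y u v : Y, dist x y * dist u v ≤ dist x u * dist y v + dist x v * dist y u
  uh : ∀ (R : Set (Y × Y)) (lam : ℝ), 0 < lam → (p, p) ∈ R →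
    (∀ z ∈ R, ∀ z' ∈ R, dist z.2 z'.2 = lam * dist z.1 z'.1) →
    ∃ g : Y → Y, Function.Surjective g ∧ (∀ a b, dist (g a) (g b) = lam * dist a b) ∧
      ∀ z ∈ R, g z.1 = z.2

namespace Good

variable {Y : Type u} [MetricSpace Y] {p : Y}

theorem no_sep (G : Good Y p) (w : ℕ → Y) (c : Y) (B : ℝ) (hB : ∀ n, dist (w n) c ≤ B)
    (ε : ℝ) (hε : 0 < ε) (h : ∀ i j, i < j → ε ≤ dist (w i) (w j)) : False := by
  have := G.proper
  obtain ⟨a, -, φ, hφ, ha⟩ := tendsto_subseq_of_bounded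
    (Metric.isBounded_closedBall (x := c) (r := B)) (x := w) (fun n => by simpa using hB n)
  have hc := ha.cauchySeq
  obtain ⟨N, hN⟩ := Metric.cauchySeq_iff.1 hc ε hε
  have := hN N le_rfl (N+1) (by omega)
  have h2 := h (φ N) (φ (N+1)) (hφ (by omega))
  simp only [Function.comp] at this
  linarith

theorem cv (G : Good Y p) {x y q : Y} {t : ℝ} (z : Y) (h0 : dist x q = t * dist x y)
    (h1 : dist q y = (1 - t) * dist x y) :
    dist z q ≤ (1 - t) * dist z x + t * dist z y := by
  rcases eq_or_ne x y with rfl | hxy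
  · have : x = q := by
      rw [← dist_eq_zero, h0]; simp
    subst this
    linarith
  · have hD : 0 < dist x y := dist_pos.2 hxy
    have := G.ptol z q x y
    rw [dist_comm q x, h0, h1] at this
    have h3 : dist z q * dist x y ≤ ((1 - t) * dist z x + t * dist z y) * dist x y := by
      linarith
    exact le_of_mul_le_mul_right h3 hD

theorem cvm (G : Good Y p) {x y m : Y} (z : Y) (h0 : dist x m = dist x y / 2)
    (h1 : dist m y = dist x y / 2) : dist z m ≤ (dist z x + dist z y) / 2 := by
  have := G.cv (t := 1/2) z (by linarith : dist x m = 1/2 * dist x y) (by linarith)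
  linarith

/-- closed midpoint-convex sets of reals are intervals -/
theorem mid_closed (I : Set ℝ) (hc : IsClosed I) (hm : ∀ a ∈ I, ∀ b ∈ I, (a + b) / 2 ∈ I)
    (a b : ℝ) (ha : a ∈ I) (hb : b ∈ I) (t : ℝ) (h1 : a ≤ t) (h2 : t ≤ b) : t ∈ I := by
  set L := I ∩ Set.Icc a t
  set U := I ∩ Set.Icc t b
  have hLc : IsCompact L := (isCompact_Icc).inter_left hc
  have hUc : IsCompact U := (isCompact_Icc).inter_left hc
  have hLn : L.Nonempty := ⟨a, ha, le_rfl, h1⟩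
  have hUn : U.Nonempty := ⟨b, hb, h2, le_rfl⟩
  have hl := hLc.sSup_mem hLn
  have hu := hUc.sInf_mem hUn
  have hmid := hm _ hl.1 _ hu.1
  have hl1 := hl.2.1
  have hl2 := hl.2.2
  have hu1 := hu.2.1
  have hu2 := hu.2.2
  rcases le_total ((sSup L + sInf U) / 2) t with h | h
  · have : (sSup L + sInf U) / 2 ≤ sSup L :=
      le_csSup hLc.bddAbove ⟨hmid, by linarith, h⟩
    have : t = sSup L := by linarith
    rw [this]; exact hl.1
  · have : sInf U ≤ (sSup L + sInf U) / 2 :=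
      csInf_le hUc.bddBelow ⟨hmid, h, by linarith⟩
    have : t = sInf U := by linarith
    rw [this]; exact hu.1

theorem exists_between (G : Good Y p) (x y : Y) (t : ℝ) (h0 : 0 ≤ t) (h1 : t ≤ 1) :
    ∃ q, dist x q = t * dist x y ∧ dist q y = (1 - t) * dist x y := by
  have := G.proper
  set D := dist x y with hD
  set K : Set Y := {q | dist x q + dist q y = D}
  have hKc : IsCompact K := by
    apply Metric.isCompact_of_isClosed_isBounded
    · exact isClosed_eq (by fun_prop) (by fun_prop)
    · refine (Metric.isBounded_closedBall (x := x) (r := D)).subset ?_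
      intro q hq
      have : dist x q + dist q y = D := hq
      have := dist_nonneg (x := q) (y := y)
      rw [Metric.mem_closedBall, dist_comm]; linarith
  set I := (fun q => dist x q) '' K
  have hI : IsClosed I := (hKc.image (by fun_prop)).isClosed
  have hm : ∀ a ∈ I, ∀ b ∈ I, (a + b) / 2 ∈ I := by
    rintro _ ⟨q, hq, rfl⟩ _ ⟨q', hq', rfl⟩
    obtain ⟨m, hm1, hm2⟩ := G.mid q q'
    have e1 := G.cvm x hm1 hm2
    have e2 := G.cvm y hm1 hm2
    have hq : dist x q + dist q y = D := hq
    have hq' : dist x q' + dist q' y = D := hq'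
    rw [dist_comm y m, dist_comm y q, dist_comm y q'] at e2
    have e3 := dist_triangle x m y
    refine ⟨m, ?_, ?_⟩
    · show dist x m + dist m y = D
      linarith
    · show dist x m = _
      linarith
  have := mid_closed I hI hm 0 D ⟨x, by simp [K, hD], by simp⟩ ⟨y, by simp [K, hD], rfl⟩ (t * D)
    (by positivity) (by nlinarith [dist_nonneg (x := x) (y := y)])
  obtain ⟨q, hq, hq1⟩ := this
  refine ⟨q, hq1, ?_⟩
  have hq : dist x q + dist q y = D := hq
  simp only at hq1
  linarith

/-- isometries extending a finite configuration -/
theorem iso (G : Good Y p) (R : Set (Y × Y)) (hp : (p, p) ∈ R)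
    (h : ∀ z ∈ R, ∀ z' ∈ R, dist z.2 z'.2 = dist z.1 z'.1) :
    ∃ g : Y ≃ᵢ Y, ∀ z ∈ R, g z.1 = z.2 := by
  obtain ⟨g, g1, g2, g3⟩ := G.uh R 1 one_pos hp (by simpa using h)
  have gi : Isometry g := Isometry.of_dist_eq (by simpa using g2)
  exact ⟨IsometryEquiv.mk (Equiv.ofBijective g ⟨gi.injective, g1⟩) gi, g3⟩

/-- isometry moving one pair -/
theorem iso1 (G : Good Y p) (a a' : Y) (h : dist p a = dist p a') :
    ∃ g : Y ≃ᵢ Y, g p = p ∧ g a = a' := by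
  obtain ⟨g, hg⟩ := G.iso {(p, p), (a, a')} (by simp) (by
    simp [h, dist_comm a p, dist_comm a' p])
  exact ⟨g, hg (p, p) (by simp), hg (a, a') (by simp)⟩

theorem iso2 (G : Good Y p) (a a' b b' : Y) (h : dist p a = dist p a')
    (h2 : dist p b = dist p b') (h3 : dist a b = dist a' b') :
    ∃ g : Y ≃ᵢ Y, g p = p ∧ g a = a' ∧ g b = b' := by
  obtain ⟨g, hg⟩ := G.iso {(p, p), (a, a'), (b, b')} (by simp) (by
    simp [h, h2, h3, dist_comm a p, dist_comm a' p, dist_comm b p, dist_comm b' p,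
      dist_comm b a, dist_comm b' a'])
  exact ⟨g, hg (p, p) (by simp), hg (a, a') (by simp), hg (b, b') (by simp)⟩

theorem iso3 (G : Good Y p) (a a' b b' c c' : Y) (h : dist p a = dist p a')
    (h2 : dist p b = dist p b') (h4 : dist p c = dist p c') (h3 : dist a b = dist a' b')
    (h5 : dist a c = dist a' c') (h6 : dist b c = dist b' c') :
    ∃ g : Y ≃ᵢ Y, g p = p ∧ g a = a' ∧ g b = b' ∧ g c = c' := by
  obtain ⟨g, hg⟩ := G.iso {(p, p), (a, a'), (b, b'), (c, c')} (by simp) (by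
    simp [h, h2, h3, h4, h5, h6, dist_comm a p, dist_comm a' p, dist_comm b p, dist_comm b' p,
      dist_comm b a, dist_comm b' a', dist_comm c p, dist_comm c' p, dist_comm c a,
      dist_comm c b, dist_comm c' a', dist_comm c' b'])
  exact ⟨g, hg (p, p) (by simp), hg (a, a') (by simp), hg (b, b') (by simp), hg (c, c') (by simp)⟩

/-- similarity moving one pair -/
theorem sim1 (G : Good Y p) (a a' : Y) (lam : ℝ) (hl : 0 < lam)
    (h : dist p a' = lam * dist p a) :
    ∃ g : Y → Y, Function.Surjective g ∧ (∀ a b, dist (g a) (g b) = lam * dist a b) ∧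
      g p = p ∧ g a = a' := by
  obtain ⟨g, g1, g2, hg⟩ := G.uh {(p, p), (a, a')} lam hl (by simp) (by
    simp [h, dist_comm a p, dist_comm a' p])
  exact ⟨g, g1, g2, hg (p, p) (by simp), hg (a, a') (by simp)⟩

theorem rad_unique (G : Good Y p) (x : Y) (t : ℝ) (q q' : Y)
    (h1 : dist p q = t * dist p x) (h2 : dist q x = (1 - t) * dist p x)
    (h1' : dist p q' = t * dist p x) (h2' : dist q' x = (1 - t) * dist p x) : q = q' := by
  have := G.proper
  by_contra hne
  set C : Set Y := {q | dist p q = t * dist p x ∧ dist q x = (1 - t) * dist p x} with hC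
  have hCc : IsCompact C := by
    apply Metric.isCompact_of_isClosed_isBounded
    · exact (isClosed_eq (by fun_prop) (by fun_prop)).inter (isClosed_eq (by fun_prop) (by fun_prop))
    · refine (Metric.isBounded_closedBall (x := p) (r := t * dist p x)).subset ?_
      intro q hq
      rw [Metric.mem_closedBall, dist_comm]; exact hq.1.le
  have hmid : ∀ a ∈ C, ∀ b ∈ C, ∃ m ∈ C, dist a m = dist a b / 2 ∧ dist m b = dist a b / 2 := by
    intro a ha b hb
    obtain ⟨m, hm1, hm2⟩ := G.mid a b
    refine ⟨m, ?_, hm1, hm2⟩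
    have e1 := G.cvm p hm1 hm2
    have e2 := G.cvm x hm1 hm2
    rw [dist_comm x m, dist_comm x a, dist_comm x b] at e2
    have e3 := dist_triangle p m x
    rw [ha.1, hb.1] at e1
    rw [ha.2, hb.2] at e2
    constructor <;> linarith
  obtain ⟨⟨a, b⟩, hab, hmax⟩ := (hCc.prod hCc).exists_isMaxOn ⟨(q, q'), ⟨h1, h2⟩, ⟨h1', h2'⟩⟩
    (f := fun z : Y × Y => dist z.1 z.2) (by fun_prop)
  set D := dist a b with hD
  have hmax' : ∀ u ∈ C, ∀ v ∈ C, dist u v ≤ D := fun u hu v hv => hmax (a := (u, v)) ⟨hu, hv⟩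
  have hDpos : 0 < D := lt_of_lt_of_le (dist_pos.2 hne) (hmax' q ⟨h1, h2⟩ q' ⟨h1', h2'⟩)
  have hpart : ∀ u : C, ∃ v : C, dist (u : Y) v = D := by
    rintro ⟨u, hu⟩
    obtain ⟨g, gp, ga, gx⟩ := G.iso2 a u x x (by rw [hab.1.1, hu.1]) rfl (by rw [hab.1.2, hu.2])
    refine ⟨⟨g b, ?_, ?_⟩, ?_⟩
    · rw [← hab.2.1]; nth_rewrite 1 [← gp]; exact g.dist_eq _ _
    · rw [← hab.2.2]; nth_rewrite 1 [← gx]; exact g.dist_eq _ _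
    · show dist u (g b) = D
      rw [← ga, g.dist_eq]
  choose P hP using hpart
  have hmid' : ∀ u v : C, ∃ m : C, dist (u : Y) m = dist (u : Y) v / 2 ∧
      dist (m : Y) v = dist (u : Y) v / 2 := by
    rintro ⟨u, hu⟩ ⟨v, hv⟩
    obtain ⟨m, hm, h⟩ := hmid u hu v hv
    exact ⟨⟨m, hm⟩, h⟩
  choose M hM1 hM2 using hmid'
  let n : ℕ → C := fun k => Nat.rec ⟨a, hab.1⟩ (fun _ c => M c (P c)) k
  have hn : ∀ k, n (k+1) = M (n k) (P (n k)) := fun k => rfl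
  have key : ∀ k, ∀ z ∈ C, dist z (n k).1 = D → ∀ j < k, dist z (P (n j)).1 = D := by
    intro k
    induction k with
    | zero => intro z _ _ j hj; omega
    | succ k ih =>
      intro z hz h j hj
      have e := G.cvm z (hM1 (n k) (P (n k))) (hM2 (n k) (P (n k)))
      rw [← hn, h] at e
      have e1 := hmax' z hz _ (n k).2
      have e2 := hmax' z hz _ (P (n k)).2
      rcases Nat.lt_succ_iff_lt_or_eq.1 hj with hj | rfl
      · exact ih z hz (by linarith) j hj
      · linarith
  refine G.no_sep (fun k => (P (n k) : Y)) p (t * dist p x) (fun k => ?_) D hDpos ?_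
  · rw [dist_comm]; exact (P (n k)).2.1.le
  · intro i j hij
    have := key j (P (n j)) (P (n j)).2 (by rw [dist_comm]; exact hP _) i hij
    rw [dist_comm]; exact this.ge

end Good


/-- the point at fraction `t` of the segment from `p` to `x`. -/
noncomputable def rad {Y : Type u} [MetricSpace Y] (p : Y) (t : ℝ) (x : Y) : Y :=
  open Classical in
  if h : ∃ q, dist p q = t * dist p x ∧ dist q x = (1 - t) * dist p x then h.choose else p

namespace Good

variable {Y : Type u} [MetricSpace Y] {p : Y}

theorem rad_spec (G : Good Y p) {t : ℝ} (h0 : 0 ≤ t) (h1 : t ≤ 1) (x : Y) :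
    dist p (rad p t x) = t * dist p x ∧ dist (rad p t x) x = (1 - t) * dist p x := by
  have h := G.exists_between p x t h0 h1
  rw [rad, dif_pos h]
  exact h.choose_spec

theorem rad_eq (G : Good Y p) {t : ℝ} (h0 : 0 ≤ t) (h1 : t ≤ 1) (x q : Y)
    (e1 : dist p q = t * dist p x) (e2 : dist q x = (1 - t) * dist p x) : q = rad p t x :=
  G.rad_unique x t _ _ e1 e2 (G.rad_spec h0 h1 x).1 (G.rad_spec h0 h1 x).2

theorem rad_one (G : Good Y p) (x : Y) : rad p 1 x = x :=
  (G.rad_eq zero_le_one le_rfl x x (by simp) (by simp)).symm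

theorem rad_zero (G : Good Y p) (x : Y) : rad p 0 x = p :=
  (G.rad_eq le_rfl zero_le_one x p (by simp) (by simp)).symm

theorem rad_rad (G : Good Y p) {s t : ℝ} (s0 : 0 ≤ s) (s1 : s ≤ 1) (h0 : 0 ≤ t) (h1 : t ≤ 1)
    (x : Y) : rad p s (rad p t x) = rad p (s * t) x := by
  obtain ⟨a1, a2⟩ := G.rad_spec h0 h1 x
  obtain ⟨b1, b2⟩ := G.rad_spec s0 s1 (rad p t x)
  rw [a1] at b1 b2
  apply G.rad_eq (by positivity) (by nlinarith)
  · rw [b1]; ring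
  · have e1 := dist_triangle (rad p s (rad p t x)) (rad p t x) x
    have e2 := dist_triangle p (rad p s (rad p t x)) x
    rw [a2, b2] at e1
    rw [b1] at e2
    apply le_antisymm <;> linarith

theorem rad_sim (G : Good Y p) {t : ℝ} (h0 : 0 ≤ t) (h1 : t ≤ 1) (g : Y → Y) (lam : ℝ)
    (hg : ∀ a b, dist (g a) (g b) = lam * dist a b) (gp : g p = p) (x : Y) :
    g (rad p t x) = rad p t (g x) := by
  obtain ⟨a1, a2⟩ := G.rad_spec h0 h1 x
  apply G.rad_eq h0 h1
  · calc dist p (g (rad p t x)) = dist (g p) (g (rad p t x)) := by rw [gp]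
      _ = t * dist (g p) (g x) := by rw [hg, hg, a1]; ring
      _ = _ := by rw [gp]
  · calc dist (g (rad p t x)) (g x) = (1 - t) * dist (g p) (g x) := by rw [hg, hg, a2]; ring
      _ = _ := by rw [gp]

theorem rad_dist_le (G : Good Y p) {s t : ℝ} (s0 : 0 ≤ s) (hst : s ≤ t) (h1 : t ≤ 1)
    (x : Y) : dist (rad p s x) (rad p t x) = (t - s) * dist p x := by
  rcases (s0.trans hst).eq_or_lt with h | h
  · have : s = 0 := by linarith
    subst this; subst h; simp
  · have e : rad p s x = rad p (s / t) (rad p t x) := by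
      rw [G.rad_rad (by positivity) (by rw [div_le_one h]; exact hst) h.le h1]
      rw [div_mul_cancel₀ _ h.ne']
    rw [e, (G.rad_spec (by positivity) (by rw [div_le_one h]; exact hst) _).2,
      (G.rad_spec h.le h1 _).1]
    field_simp

theorem rad_dist (G : Good Y p) {s t : ℝ} (s0 : 0 ≤ s) (s1 : s ≤ 1) (h0 : 0 ≤ t) (h1 : t ≤ 1)
    (x : Y) : dist (rad p s x) (rad p t x) = |s - t| * dist p x := by
  rcases le_total s t with h | h
  · rw [G.rad_dist_le s0 h h1, abs_sub_comm, abs_of_nonneg (by linarith)]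
  · rw [dist_comm, G.rad_dist_le h0 h s1, abs_of_nonneg (by linarith)]

theorem rad_cont (G : Good Y p) (x : Y) : ContinuousOn (fun t => rad p t x) (Set.Icc 0 1) := by
  have : LipschitzOnWith (Real.toNNReal (dist p x)) (fun t => rad p t x) (Set.Icc 0 1) := by
    apply LipschitzOnWith.of_dist_le_mul
    intro s hs t ht
    rw [G.rad_dist hs.1 hs.2 ht.1 ht.2, Real.coe_toNNReal _ dist_nonneg, Real.dist_eq, mul_comm]
  exact this.continuousOn

theorem no_branch (G : Good Y p) {x y : Y} (hn : dist p x = dist p y) {t : ℝ} (t0 : 0 < t)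
    (t1 : t ≤ 1) (h : rad p t x = rad p t y) : x = y := by
  by_contra hxy
  set l := dist p x with hl
  set T : Set ℝ := {s | s ∈ Set.Icc (0:ℝ) 1 ∧ dist (rad p s x) (rad p s y) = 0}
  have hGc : ContinuousOn (fun s => dist (rad p s x) (rad p s y)) (Set.Icc 0 1) :=
    continuous_dist.comp_continuousOn ((G.rad_cont x).prodMk (G.rad_cont y))
  have hTc : IsCompact T := by
    have : IsClosed T := hGc.preimage_isClosed_of_isClosed isClosed_Icc (isClosed_singleton (x := (0:ℝ)))
    exact isCompact_Icc.of_isClosed_subset this (fun s hs => hs.1)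
  have hTt : t ∈ T := ⟨⟨t0.le, t1⟩, by rw [h]; simp⟩
  set b := sSup T with hb
  have hbT : b ∈ T := hTc.sSup_mem ⟨t, hTt⟩
  have hbt : t ≤ b := le_csSup hTc.bddAbove hTt
  have hb0 : 0 < b := by linarith
  have hb1 : b < 1 := by
    rcases hbT.1.2.lt_or_eq with h | h
    · exact h
    · exfalso
      have := hbT.2
      rw [h, G.rad_one, G.rad_one, dist_eq_zero] at this
      exact hxy this
  have hTiff : ∀ s, 0 ≤ s → s ≤ 1 → (rad p s x = rad p s y ↔ s ≤ b) := by
    intro s s0 s1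
    constructor
    · intro e
      exact le_csSup hTc.bddAbove ⟨⟨s0, s1⟩, by rw [e]; simp⟩
    · intro e
      have e2 : rad p b x = rad p b y := dist_eq_zero.1 hbT.2
      have : s = s / b * b := by field_simp
      have h1 : s / b ≤ 1 := by rw [div_le_one hb0]; exact e
      rw [this, ← G.rad_rad (by positivity) h1 hb0.le hb1.le, e2,
        G.rad_rad (by positivity) h1 hb0.le hb1.le]
  set e : ℝ → ℝ := fun s => dist (rad p s x) (rad p s y) / s with he
  have hec : ContinuousOn e (Set.Icc b 1) := by
    apply ContinuousOn.div
    · exact hGc.mono (Set.Icc_subset_Icc hb0.le le_rfl)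
    · exact continuousOn_id
    · intro s hs; have := hs.1; show s ≠ 0; linarith
  have heb : e b = 0 := by simp only [he]; rw [hbT.2]; simp
  have hepos : ∀ s, b < s → s ≤ 1 → 0 < e s := by
    intro s h1 h2
    have : rad p s x ≠ rad p s y := fun h => by
      have := (hTiff s (by linarith) h2).1 h
      linarith
    exact div_pos (dist_pos.2 this) (by linarith)
  -- branching time determined by distance
  have F : ∀ s, b < s → s ≤ 1 → ∀ z z', dist p z = l → dist p z' = l → dist z z' = e s →
      ∀ τ, 0 ≤ τ → τ ≤ 1 → (rad p τ z = rad p τ z' ↔ τ * s ≤ b) := by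
    intro s h1 h2 z z' hz hz' hd τ τ0 τ1
    have s0 : 0 < s := by linarith
    have sx := (G.rad_spec s0.le h2 x).1
    have sy := (G.rad_spec s0.le h2 y).1
    have k1 : dist p z = s⁻¹ * dist p (rad p s x) := by rw [sx, hz, ← hl]; field_simp
    have k2 : dist p z' = s⁻¹ * dist p (rad p s y) := by rw [sy, hz', ← hn]; field_simp
    have k3 : dist z z' = s⁻¹ * dist (rad p s x) (rad p s y) := by rw [hd]; simp only [he]; field_simp
    obtain ⟨g, g1, g2, g3⟩ := G.uh {(p, p), (rad p s x, z), (rad p s y, z')} s⁻¹ (by positivity)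
      (by simp) (by
        simp [k1, k2, k3, dist_comm _ p, dist_comm z' z, dist_comm (rad p s y) (rad p s x)])
    have gp : g p = p := g3 (p, p) (by simp)
    have gx : g (rad p s x) = z := g3 (rad p s x, z) (by simp)
    have gy : g (rad p s y) = z' := g3 (rad p s y, z') (by simp)
    have gi : Function.Injective g := by
      intro a b hab
      have := g2 a b
      rw [hab, dist_self] at this
      have h3 : 0 < s⁻¹ := by positivity
      have : dist a b = 0 := by
        rcases mul_eq_zero.1 this.symm with h | h
        · linarith
        · exact h
      exact dist_eq_zero.1 this
    rw [← gx, ← gy, ← G.rad_sim τ0 τ1 g _ g2 gp, ← G.rad_sim τ0 τ1 g _ g2 gp, gi.eq_iff,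
      G.rad_rad τ0 τ1 s0.le h2, G.rad_rad τ0 τ1 s0.le h2]
    exact hTiff _ (by positivity) (by nlinarith)
  have E : ∀ s, b < s → s ≤ 1 → ∃ z, dist p z = l ∧ dist x z = e s := by
    intro s h1 h2
    have s0 : 0 < s := by linarith
    obtain ⟨g, g1, g2, gp, gx⟩ := G.sim1 (rad p s x) x s⁻¹ (by positivity)
      (by rw [(G.rad_spec s0.le h2 x).1]; field_simp)
    refine ⟨g (rad p s y), ?_, ?_⟩
    · calc dist p (g (rad p s y)) = dist (g p) (g (rad p s y)) := by rw [gp]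
        _ = l := by rw [g2, (G.rad_spec s0.le h2 y).1, ← hn]; field_simp
    · calc dist x (g (rad p s y)) = dist (g (rad p s x)) (g (rad p s y)) := by rw [gx]
        _ = e s := by rw [g2]; simp only [he]; field_simp
  set c := (b + 1) / 2 with hc
  have hbc : b < c := by rw [hc]; linarith
  have hc1 : c < 1 := by rw [hc]; linarith
  have c0 : 0 < c := by linarith
  have hε : 0 < e c := hepos c hbc hc1.le
  have tc0 : 0 ≤ b / c := by positivity
  have tc1 : b / c ≤ 1 := by rw [div_le_one c0]; exact hbc.le
  have near : ∀ z z', dist p z = l → dist p z' = l → dist z z' ≤ e c →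
      rad p (b / c) z = rad p (b / c) z' := by
    intro z z' hz hz' hd
    rcases eq_or_ne z z' with rfl | hne
    · rfl
    have hiv := intermediate_value_Icc hbc.le (hec.mono (Set.Icc_subset_Icc le_rfl hc1.le))
    obtain ⟨s, hs, hs2⟩ := hiv (show dist z z' ∈ _ from ⟨by rw [heb]; exact dist_nonneg, hd⟩)
    have hbs : b < s := by
      rcases hs.1.lt_or_eq with h | h
      · exact h
      · exfalso
        rw [← h, heb] at hs2
        exact hne (dist_eq_zero.1 hs2.symm)
    rw [F s hbs (by linarith [hs.2]) z z' hz hz' hs2.symm _ tc0 tc1]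
    rw [div_mul_eq_mul_div, div_le_iff₀ c0]
    exact mul_le_mul_of_nonneg_left hs.2 hb0.le
  have hsk : ∀ k : ℕ, c < c + (1 - c) / (k + 2) ∧ c + (1 - c) / (k + 2) ≤ 1 := by
    intro k
    have h3 : (0:ℝ) < k + 2 := by positivity
    have h4 : 0 < (1 - c) / (k + 2) := div_pos (by linarith) h3
    have h5 : (1 - c) / (k + 2) ≤ 1 - c := div_le_self (by linarith) (by linarith [Nat.cast_nonneg (α := ℝ) k])
    constructor <;> linarith
  choose z hz1 hz2 using fun k : ℕ => E (c + (1 - c) / (k + 2)) (by linarith [(hsk k).1]) (hsk k).2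
  refine G.no_sep z p l (fun n => by rw [dist_comm, hz1]) (e c) hε ?_
  intro i j hij
  by_contra hlt
  push Not at hlt
  have hne := near _ _ (hz1 i) (hz1 j) hlt.le
  set si := c + (1 - c) / ((i:ℝ) + 2) with hsi
  set sj := c + (1 - c) / ((j:ℝ) + 2) with hsj
  have hji : sj < si := by
    have : (i:ℝ) < j := by exact_mod_cast hij
    have : (1 - c) / ((j:ℝ) + 2) < (1 - c) / ((i:ℝ) + 2) :=
      div_lt_div_of_pos_left (by linarith) (by positivity) (by linarith)
    linarith
  have hcj : c < sj := (hsk j).1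
  have hsj0 : 0 < sj := by linarith
  have hτ1 : b / sj ≤ 1 := by rw [div_le_one hsj0]; linarith
  have hτ0 : 0 ≤ b / sj := by positivity
  have r1 : rad p (b / sj) x = rad p (b / sj) (z j) :=
    (F sj (by linarith) (hsk j).2 x (z j) rfl (hz1 j) (hz2 j) _ hτ0 hτ1).2 (by
      rw [div_mul_cancel₀ _ hsj0.ne'])
  have r2 : rad p (b / sj) (z i) = rad p (b / sj) (z j) := by
    have q1 : c / sj ≤ 1 := by rw [div_le_one hsj0]; exact hcj.le
    have : b / sj = (c / sj) * (b / c) := by field_simp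
    rw [this, ← G.rad_rad (by positivity) q1 tc0 tc1, hne, G.rad_rad (by positivity) q1 tc0 tc1]
  have := (F si (by linarith) (hsk i).2 x (z i) rfl (hz1 i) (hz2 i) _ hτ0 hτ1).1 (by rw [r1, r2])
  rw [div_mul_eq_mul_div, div_le_iff₀ hsj0] at this
  nlinarith

theorem rad_surj (G : Good Y p) (q : Y) {t : ℝ} (t0 : 0 < t) (t1 : t ≤ 1) : ∃ x, rad p t x = q := by
  obtain ⟨g, g1, g2, gp, gx⟩ := G.sim1 (rad p t q) q t⁻¹ (by positivity)
      (by rw [(G.rad_spec t0.le t1 q).1]; field_simp)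
  exact ⟨g q, by rw [← G.rad_sim t0.le t1 g _ g2 gp, gx]⟩

end Good

/-- scaling by `t ≥ 0` along rays from `p`. -/
noncomputable def Phi {Y : Type u} [MetricSpace Y] (p : Y) (t : ℝ) (x : Y) : Y :=
  open Classical in
  if t ≤ 1 then rad p t x else if h : ∃ z, rad p t⁻¹ z = x then h.choose else p

namespace Good

variable {Y : Type u} [MetricSpace Y] {p : Y}

theorem Phi_le (t : ℝ) (h : t ≤ 1) (x : Y) : Phi p t x = rad p t x := by
  rw [Phi, if_pos h]

theorem Phi_rad (G : Good Y p) {t ε : ℝ} (t0 : 0 ≤ t) (ε0 : 0 < ε) (ε1 : ε ≤ 1)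
    (h : t * ε ≤ 1) (z : Y) : Phi p t (rad p ε z) = rad p (t * ε) z := by
  by_cases h1 : t ≤ 1
  · rw [Phi_le t h1, G.rad_rad t0 h1 ε0.le ε1]
  · push Not at h1
    have i0 : 0 < t⁻¹ := by positivity
    have i1 : t⁻¹ ≤ 1 := inv_le_one_of_one_le₀ h1.le
    have hex : ∃ w, rad p t⁻¹ w = rad p ε z := G.rad_surj _ i0 i1
    rw [Phi, if_neg (not_le.2 h1), dif_pos hex]
    have hs := hex.choose_spec
    set w := hex.choose
    have n1 : dist p w = t * (ε * dist p z) := by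
      have := (G.rad_spec i0.le i1 w).1
      rw [hs, (G.rad_spec ε0.le ε1 z).1] at this
      rw [this]; field_simp
    refine G.no_branch ?_ i0 i1 ?_
    · rw [n1, (G.rad_spec (by positivity) h z).1]; ring
    · rw [hs, G.rad_rad i0.le i1 (by positivity) h]
      congr 1; field_simp

theorem exists_big (G : Good Y p) (x : Y) (M : ℝ) : ∃ ε z, 0 < ε ∧ ε ≤ 1 ∧ M * ε ≤ 1 ∧
    rad p ε z = x := by
  have h : 0 < (|M| + 1)⁻¹ := by positivity
  have h1 : (|M| + 1)⁻¹ ≤ 1 := inv_le_one_of_one_le₀ (by linarith [abs_nonneg M])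
  obtain ⟨z, hz⟩ := G.rad_surj x h h1
  refine ⟨_, z, h, h1, ?_, hz⟩
  rw [← div_eq_mul_inv, div_le_one (by positivity)]
  linarith [le_abs_self M]

theorem Phi_one (G : Good Y p) (x : Y) : Phi p 1 x = x := by rw [Phi_le 1 le_rfl, G.rad_one]

theorem Phi_zero (G : Good Y p) (x : Y) : Phi p 0 x = p := by rw [Phi_le 0 zero_le_one, G.rad_zero]

theorem Phi_norm (G : Good Y p) {t : ℝ} (t0 : 0 ≤ t) (x : Y) : dist p (Phi p t x) = t * dist p x := by
  obtain ⟨ε, z, h1, h2, h3, rfl⟩ := G.exists_big x t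
  rw [G.Phi_rad t0 h1 h2 h3, (G.rad_spec (by positivity) h3 z).1, (G.rad_spec h1.le h2 z).1]
  ring

theorem Phi_p (G : Good Y p) {t : ℝ} (t0 : 0 ≤ t) : Phi p t p = p := by
  have := G.Phi_norm t0 p
  rw [dist_self, mul_zero, dist_eq_zero] at this
  exact this.symm

theorem Phi_Phi (G : Good Y p) {s t : ℝ} (s0 : 0 ≤ s) (t0 : 0 ≤ t) (x : Y) :
    Phi p s (Phi p t x) = Phi p (s * t) x := by
  rcases t0.eq_or_lt with rfl | t0
  · rw [mul_zero, G.Phi_zero, G.Phi_p s0]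
  obtain ⟨ε, z, h1, h2, h3, rfl⟩ := G.exists_big x (max t (s * t))
  have h4 : t * ε ≤ 1 := le_trans (mul_le_mul_of_nonneg_right (le_max_left _ _) h1.le) h3
  have h5 : s * t * ε ≤ 1 := le_trans (mul_le_mul_of_nonneg_right (le_max_right _ _) h1.le) h3
  rw [G.Phi_rad t0.le h1 h2 h4, G.Phi_rad s0 (by positivity) h4 (by linarith),
    G.Phi_rad (by positivity) h1 h2 h5, mul_assoc]

theorem Phi_dist (G : Good Y p) {s t : ℝ} (s0 : 0 ≤ s) (t0 : 0 ≤ t) (x : Y) :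
    dist (Phi p s x) (Phi p t x) = |s - t| * dist p x := by
  obtain ⟨ε, z, h1, h2, h3, rfl⟩ := G.exists_big x (max t s)
  have h4 : t * ε ≤ 1 := le_trans (mul_le_mul_of_nonneg_right (le_max_left _ _) h1.le) h3
  have h5 : s * ε ≤ 1 := le_trans (mul_le_mul_of_nonneg_right (le_max_right _ _) h1.le) h3
  rw [G.Phi_rad t0 h1 h2 h4, G.Phi_rad s0 h1 h2 h5,
    G.rad_dist (by positivity) h5 (by positivity) h4, (G.rad_spec h1.le h2 z).1, ← sub_mul,
    abs_mul, abs_of_pos h1]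
  ring

theorem Phi_sim (G : Good Y p) {t : ℝ} (t0 : 0 ≤ t) (g : Y → Y) (lam : ℝ)
    (hg : ∀ a b, dist (g a) (g b) = lam * dist a b) (gp : g p = p) (x : Y) :
    g (Phi p t x) = Phi p t (g x) := by
  obtain ⟨ε, z, h1, h2, h3, rfl⟩ := G.exists_big x t
  rw [G.Phi_rad t0 h1 h2 h3, G.rad_sim h1.le h2 g lam hg gp, G.rad_sim (by positivity) h3 g lam hg gp,
    G.Phi_rad t0 h1 h2 h3]

theorem Phi_iso (G : Good Y p) {t : ℝ} (t0 : 0 ≤ t) (g : Y ≃ᵢ Y) (gp : g p = p) (x : Y) :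
    g (Phi p t x) = Phi p t (g x) :=
  G.Phi_sim t0 g 1 (fun a b => by rw [g.dist_eq, one_mul]) gp x

theorem Phi_inv (G : Good Y p) {t : ℝ} (t0 : 0 < t) (x : Y) : Phi p t (Phi p t⁻¹ x) = x := by
  rw [G.Phi_Phi t0.le (by positivity), mul_inv_cancel₀ t0.ne', G.Phi_one]

theorem Phi_inv2 (G : Good Y p) {t : ℝ} (t0 : 0 < t) (x : Y) : Phi p t⁻¹ (Phi p t x) = x := by
  rw [G.Phi_Phi (by positivity) t0.le, inv_mul_cancel₀ t0.ne', G.Phi_one]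

theorem Phi_inj (G : Good Y p) {t : ℝ} (t0 : 0 < t) {x y : Y} (h : Phi p t x = Phi p t y) : x = y := by
  rw [← G.Phi_inv2 t0 x, h, G.Phi_inv2 t0]

/-- if `d(p,q)+d(q,y)=d(p,y)` then `q` is on the ray. -/
theorem eq_Phi (G : Good Y p) {y q : Y} (hy : y ≠ p) (h : dist p q + dist q y = dist p y) :
    q = Phi p (dist p q / dist p y) y := by
  have h0 : 0 < dist p y := dist_pos.2 hy.symm
  have h1 : dist p q / dist p y ≤ 1 := by
    rw [div_le_one h0]; linarith [dist_nonneg (x := q) (y := y)]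
  rw [Phi_le _ h1]
  apply G.rad_eq (by positivity) h1
  · field_simp
  · field_simp; linarith

/-- unit direction -/
theorem exists_dir (G : Good Y p) {y : Y} (hy : y ≠ p) : ∃ v, dist p v = 1 ∧ y = Phi p (dist p y) v := by
  have h0 : 0 < dist p y := dist_pos.2 hy.symm
  refine ⟨Phi p (dist p y)⁻¹ y, ?_, (G.Phi_inv h0 y).symm⟩
  rw [G.Phi_norm (by positivity), inv_mul_cancel₀ h0.ne']

end Good


section OrderIso

variable {T : Type u} [MetricSpace T]

/-- chains of length `k` -/
def ChainRel (P : T → T → Prop) : ℕ → T → T → Prop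
  | 0, a, b => a = b
  | k + 1, a, b => ∃ c, ChainRel P k a c ∧ P c b

theorem chainRel_of_rtg {P : T → T → Prop} {a b : T} (h : Relation.ReflTransGen P a b) :
    ∃ k, ChainRel P k a b := by
  induction h with
  | refl => exact ⟨0, rfl⟩
  | tail _ h ih =>
    obtain ⟨k, hk⟩ := ih
    exact ⟨k + 1, _, hk, h⟩

theorem chainRel_map {P : T → T → Prop} (f : T → T) (h : ∀ a b, P a b → P (f a) (f b)) :
    ∀ k a b, ChainRel P k a b → ChainRel P k (f a) (f b)
  | 0, a, b, hab => congrArg f hab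
  | k + 1, a, b, ⟨c, h1, h2⟩ => ⟨f c, chainRel_map f h k a c h1, h c b h2⟩

theorem order_iso [CompactSpace T] (φ : T ≃ T)
    (ho : ∀ a b c d : T, dist a b ≤ dist c d ↔ dist (φ a) (φ b) ≤ dist (φ c) (φ d))
    (x y : T) (hch : ∀ ε > 0, Relation.ReflTransGen (fun a b : T => dist a b < ε) x y) :
    dist (φ x) (φ y) = dist x y := by
  by_cases hxy : x = y
  · subst hxy; simp
  have hinf : Infinite T := by
    by_contra hfin
    rw [not_infinite_iff_finite] at hfin
    -- minimal distance
    have : ∃ δ > 0, ∀ a b : T, dist a b < δ → a = b := by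
      have hs : (Set.univ : Set T).Finite := Set.finite_univ
      have hd : (Set.univ : Set T).Pairwise fun a b => a ≠ b := fun a _ b _ h => h
      have hp : 0 < Set.infsep (Set.univ : Set T) := by
        rw [hs.infsep_pos_iff_nontrivial]
        exact ⟨x, trivial, y, trivial, hxy⟩
      refine ⟨_, hp, fun a b hab => ?_⟩
      by_contra hne
      have := Set.infsep_le_dist_of_mem (Set.mem_univ a) (Set.mem_univ b) hne
      linarith
    obtain ⟨δ, hδ, h⟩ := this
    have h2 := hch δ hδ
    have : Relation.ReflTransGen (fun a b : T => a = b) x y := Relation.ReflTransGen.mono (fun a b => h a b) _ _ h2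
    apply hxy
    clear h2 hch hxy
    induction this with
    | refl => rfl
    | tail _ h ih => exact ih.trans h
  -- main
  have main : ∀ ε > 0, dist (φ x) (φ y) ≤ dist x y + ε ∧ dist x y ≤ dist (φ x) (φ y) + ε := by
    intro ε hε
    have htb : TotallyBounded (Set.univ : Set T) := isCompact_univ.totallyBounded
    obtain ⟨t, htf, ht⟩ := Metric.totallyBounded_iff.1 htb (ε / 2) (by positivity)
    set n := htf.toFinset.card + 1 with hn
    set P : T → T → Prop := fun a b => ∃ f : Fin n → T, ∀ i j, i ≠ j → dist a b ≤ dist (f i) (f j)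
      with hP
    have hP1 : ∀ a b, P a b → dist a b < ε := by
      rintro a b ⟨f, hf⟩
      have : ∀ z : T, ∃ c ∈ htf.toFinset, dist z c < ε / 2 := by
        intro z
        have := ht (Set.mem_univ z)
        simp only [Set.mem_iUnion, Metric.mem_ball] at this
        obtain ⟨c, hc, h⟩ := this
        exact ⟨c, by simpa using hc, h⟩
      choose c hc1 hc2 using this
      obtain ⟨i, -, j, -, hij, he⟩ := Finset.exists_ne_map_eq_of_card_lt_of_maps_to
        (s := (Finset.univ : Finset (Fin n))) (t := htf.toFinset) (by simp [hn])
        (f := fun i => c (f i)) (fun i _ => hc1 _)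
      have h1 := hc2 (f i)
      have h2 := hc2 (f j)
      rw [← he] at h2
      have := dist_triangle_right (f i) (f j) (c (f i))
      linarith [hf i j hij]
    have hP2 : ∃ δ > 0, ∀ a b, dist a b < δ → P a b := by
      have f : Fin n ↪ T := Fin.valEmbedding.trans (Infinite.natEmbedding T)
      have hs : (Set.range f).Finite := Set.finite_range f
      have hpos : ∃ δ > 0, ∀ i j, i ≠ j → δ ≤ dist (f i) (f j) := by
        by_cases hnt : (Set.range f).Nontrivial
        · exact ⟨_, hs.infsep_pos_iff_nontrivial.2 hnt, fun i j hij =>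
            Set.infsep_le_dist_of_mem ⟨i, rfl⟩ ⟨j, rfl⟩ (fun h => hij (f.injective h))⟩
        · refine ⟨1, one_pos, fun i j hij => ?_⟩
          exfalso; apply hnt
          exact ⟨f i, ⟨i, rfl⟩, f j, ⟨j, rfl⟩, fun h => hij (f.injective h)⟩
      obtain ⟨δ, h0, h⟩ := hpos
      exact ⟨δ, h0, fun a b hab => ⟨f, fun i j hij => hab.le.trans (h i j hij)⟩⟩
    have hPφ : ∀ a b, P a b → P (φ a) (φ b) := by
      rintro a b ⟨f, hf⟩
      exact ⟨fun i => φ (f i), fun i j hij => (ho _ _ _ _).1 (hf i j hij)⟩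
    have hPφ' : ∀ a b, P a b → P (φ.symm a) (φ.symm b) := by
      rintro a b ⟨f, hf⟩
      refine ⟨fun i => φ.symm (f i), fun i j hij => (ho _ _ _ _).2 ?_⟩
      simpa using hf i j hij
    set Q : ℕ → T → T → Prop := fun k a b => ∃ c d, ChainRel P k c d ∧ dist a b ≤ dist c d
    have hQ : ∀ k a b, Q k a b ↔ Q k (φ a) (φ b) := by
      intro k a b
      constructor
      · rintro ⟨c, d, h1, h2⟩
        exact ⟨φ c, φ d, chainRel_map φ hPφ k c d h1, (ho _ _ _ _).1 h2⟩
      · rintro ⟨c, d, h1, h2⟩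
        refine ⟨φ.symm c, φ.symm d, chainRel_map φ.symm hPφ' k c d h1, (ho _ _ _ _).2 ?_⟩
        simpa using h2
    have hQbound : ∀ k a b a' b', ¬ Q k a b → Q (k + 1) a' b' → dist a' b' ≤ dist a b + ε := by
      rintro k a b a' b' h1 ⟨c, d, ⟨e, h2, h3⟩, h4⟩
      have h5 : dist c e < dist a b := by
        by_contra h
        exact h1 ⟨c, e, h2, not_lt.1 h⟩
      have := dist_triangle c e d
      have := hP1 e d h3
      linarith
    obtain ⟨δ, h0, hδ⟩ := hP2
    have hex : ∃ k, Q k x y := by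
      obtain ⟨k, hk⟩ := chainRel_of_rtg (Relation.ReflTransGen.mono (fun a b h => hδ a b h) _ _ (hch δ h0))
      exact ⟨k, x, y, hk, le_rfl⟩
    classical
    have hk := Nat.find_spec hex
    have hmin := fun m => Nat.find_min hex (m := m)
    set k := Nat.find hex
    rcases k with _ | k
    · obtain ⟨c, d, h1, h2⟩ := hk
      have h1 : c = d := h1
      subst h1
      simp only [dist_self] at h2
      exact absurd (dist_le_zero.1 h2) hxy
    · have hm := hmin k (Nat.lt_succ_self k)
      exact ⟨hQbound k _ _ _ _ hm ((hQ _ _ _).1 hk),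
        hQbound k _ _ _ _ (fun h => hm ((hQ _ _ _).2 h)) hk⟩
  apply le_antisymm
  · exact le_of_forall_pos_le_add (fun ε hε => (main ε hε).1)
  · exact le_of_forall_pos_le_add (fun ε hε => (main ε hε).2)

end OrderIso

namespace Good

variable {Y : Type u} [MetricSpace Y] {p : Y}

theorem dir_unique (G : Good Y p) {q v : Y} (hq : q ≠ p) (hv : dist p v = 1)
    (h : dist v q = |dist p q - 1|) : q = Phi p (dist p q) v := by
  have hq0 : 0 < dist p q := dist_pos.2 hq.symm
  rcases le_total (dist p q) 1 with h1 | h1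
  · rw [abs_of_nonpos (by linarith)] at h
    have hvp : v ≠ p := by rintro rfl; simp at hv
    have := G.eq_Phi (q := q) hvp (by rw [dist_comm q v, h, hv]; ring)
    rwa [hv, div_one] at this
  · rw [abs_of_nonneg (by linarith)] at h
    have := G.eq_Phi (q := v) hq (by rw [h, hv]; ring)
    rw [hv, one_div] at this
    rw [this, G.Phi_inv hq0]

theorem dir_ex (G : Good Y p) {q : Y} (hq : q ≠ p) :
    ∃ v, dist p v = 1 ∧ dist v q = |dist p q - 1| := by
  obtain ⟨v, h1, h2⟩ := G.exists_dir hq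
  refine ⟨v, h1, ?_⟩
  nth_rewrite 1 [h2]
  nth_rewrite 1 [← G.Phi_one v]
  rw [G.Phi_dist zero_le_one dist_nonneg, h1, abs_sub_comm, mul_one]

theorem chain (G : Good Y p) (x y : {v : Y // dist p v = 1}) (hxy : dist x y < 2) (ε : ℝ) (hε : 0 < ε) :
    Relation.ReflTransGen (fun a b : {v : Y // dist p v = 1} => dist a b < ε) x y := by
  have := G.proper
  obtain ⟨x, hx⟩ := x
  obtain ⟨y, hy⟩ := y
  have hxy : dist x y < 2 := hxy
  set D := dist x y with hD
  set K : Set Y := {q | dist x q + dist q y = D} with hK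
  have hKcl : IsClosed K := isClosed_eq (by fun_prop) (by fun_prop)
  have hKc : IsCompact K := by
    apply Metric.isCompact_of_isClosed_isBounded hKcl
    refine (Metric.isBounded_closedBall (x := x) (r := D)).subset ?_
    intro q hq
    have : dist x q + dist q y = D := hq
    have := dist_nonneg (x := q) (y := y)
    rw [Metric.mem_closedBall, dist_comm]; linarith
  have hKp : ∀ q ∈ K, q ≠ p := by
    rintro q hq rfl
    have : dist x q + dist q y = D := hq
    rw [dist_comm x q, hx, hy] at this
    linarith
  have hKm : ∀ q ∈ K, ∀ q' ∈ K, ∃ m ∈ K, dist q m = dist q q' / 2 ∧ dist m q' = dist q q' / 2 := by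
    intro q hq q' hq'
    obtain ⟨m, hm1, hm2⟩ := G.mid q q'
    have e1 := G.cvm x hm1 hm2
    have e2 := G.cvm y hm1 hm2
    have hq : dist x q + dist q y = D := hq
    have hq' : dist x q' + dist q' y = D := hq'
    rw [dist_comm y m, dist_comm y q, dist_comm y q'] at e2
    have e3 := dist_triangle x m y
    refine ⟨m, ?_, hm1, hm2⟩
    show dist x m + dist m y = D
    linarith
  set Γ : Set (Y × Y) := {z | z.1 ∈ K ∧ dist p z.2 = 1 ∧ dist z.2 z.1 = |dist p z.1 - 1|} with hΓ
  have hΓc : IsCompact Γ := by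
    have hsub : Γ ⊆ K ×ˢ Metric.closedBall p 1 := by
      rintro ⟨q, v⟩ ⟨h1, h2, h3⟩
      exact ⟨h1, by rw [Metric.mem_closedBall, dist_comm]; exact h2.le⟩
    refine (hKc.prod (isCompact_closedBall p 1)).of_isClosed_subset ?_ hsub
    refine (hKcl.preimage continuous_fst).inter ((isClosed_eq (by fun_prop) (by fun_prop)).inter
      (isClosed_eq (by fun_prop) (by fun_prop)))
  have hunif : ∃ δ > 0, ∀ z ∈ Γ, ∀ z' ∈ Γ, dist z.1 z'.1 < δ → dist z.2 z'.2 < ε := by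
    set W : Set ((Y × Y) × (Y × Y)) := (Γ ×ˢ Γ) ∩ {z | ε ≤ dist z.1.2 z.2.2}
    have hWc : IsCompact W := (hΓc.prod hΓc).inter_right (isClosed_le (by fun_prop) (by fun_prop))
    rcases W.eq_empty_or_nonempty with hW | hW
    · refine ⟨1, one_pos, fun z hz z' hz' _ => ?_⟩
      by_contra h
      have : ((z, z') : (Y × Y) × (Y × Y)) ∈ W := ⟨⟨hz, hz'⟩, not_lt.1 h⟩
      rw [hW] at this
      exact this
    · obtain ⟨⟨z, z'⟩, hz, hmin⟩ := hWc.exists_isMinOn hW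
        (f := fun z : (Y × Y) × (Y × Y) => dist z.1.1 z.2.1) (by fun_prop)
      refine ⟨dist z.1 z'.1, ?_, fun w hw w' hw' h => ?_⟩
      · by_contra h
        have e : z.1 = z'.1 := dist_le_zero.1 (not_lt.1 h)
        have a1 := G.dir_unique (hKp _ hz.1.1.1) hz.1.1.2.1 hz.1.1.2.2
        have a2 := G.dir_unique (hKp _ hz.1.2.1) hz.1.2.2.1 hz.1.2.2.2
        simp only at a1 a2
        rw [← e] at a2
        have a3 := G.Phi_inj (dist_pos.2 (hKp _ hz.1.1.1).symm) (a1.symm.trans a2)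
        have : ε ≤ dist z.2 z'.2 := hz.2
        rw [a3, dist_self] at this
        linarith
      · by_contra h2
        have := hmin (a := (w, w')) ⟨⟨hw, hw'⟩, not_lt.1 h2⟩
        simp only [Set.mem_ofPred_eq] at this
        linarith
  obtain ⟨δ, hδ, hu⟩ := hunif
  have main : ∀ n : ℕ, ∀ q ∈ K, ∀ q' ∈ K, dist q q' < 2 ^ n * δ → ∀ v v' : {v : Y // dist p v = 1},
      (q, v.1) ∈ Γ → (q', v'.1) ∈ Γ →
      Relation.ReflTransGen (fun a b : {v : Y // dist p v = 1} => dist a b < ε) v v' := by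
    intro n
    induction n with
    | zero =>
      intro q hq q' hq' hd v v' hv hv'
      exact Relation.ReflTransGen.single (hu _ hv _ hv' (by simpa using hd))
    | succ n ih =>
      intro q hq q' hq' hd v v' hv hv'
      obtain ⟨m, hm, h1, h2⟩ := hKm q hq q' hq'
      obtain ⟨w, hw1, hw2⟩ := G.dir_ex (hKp m hm)
      rw [pow_succ] at hd
      exact (ih q hq m hm (by rw [h1]; linarith) v ⟨w, hw1⟩ hv ⟨hm, hw1, hw2⟩).trans
        (ih m hm q' hq' (by rw [h2]; linarith) ⟨w, hw1⟩ v' ⟨hm, hw1, hw2⟩ hv')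
  have hxK : x ∈ K := by simp [hK, hD]
  have hyK : y ∈ K := by simp [hK, hD]
  obtain ⟨n, hn⟩ := pow_unbounded_of_one_lt (D / δ) (one_lt_two)
  refine main n x hxK y hyK ?_ ⟨x, hx⟩ ⟨y, hy⟩ ⟨hxK, hx, by simp [hx]⟩ ⟨hyK, hy, by simp [hy]⟩
  rw [div_lt_iff₀ hδ] at hn
  exact hn

theorem rad_lt (G : Good Y p) {x y x' y' : Y} (hx : dist p x = 1) (hy : dist p y = 1)
    (hx' : dist p x' = 1) (hy' : dist p y' = 1) (h : dist x y < dist x' y') {s : ℝ} (s0 : 0 < s)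
    (s1 : s ≤ 1) : dist (rad p s x) (rad p s y) < dist (rad p s x') (rad p s y') := by
  by_contra hlt
  push Not at hlt
  have hc : ContinuousOn (fun s => dist (rad p s x) (rad p s y) - dist (rad p s x') (rad p s y'))
      (Set.Icc s 1) := by
    have h1 := continuous_dist.comp_continuousOn ((G.rad_cont x).prodMk (G.rad_cont y))
    have h2 := continuous_dist.comp_continuousOn ((G.rad_cont x').prodMk (G.rad_cont y'))
    exact (h1.sub h2).mono (Set.Icc_subset_Icc s0.le le_rfl)
  obtain ⟨t, ht, ht2⟩ := intermediate_value_Icc' s1 hc (show (0:ℝ) ∈ _ from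
    ⟨by simp only [G.rad_one]; linarith, by linarith⟩)
  have t0 : 0 < t := by linarith [ht.1]
  have ht2 : dist (rad p t x) (rad p t y) = dist (rad p t x') (rad p t y') := by
    simp only at ht2; linarith
  obtain ⟨g, gp, gx, gy⟩ := G.iso2 (rad p t x) (rad p t x') (rad p t y) (rad p t y')
    (by rw [(G.rad_spec t0.le ht.2 x).1, (G.rad_spec t0.le ht.2 x').1, hx, hx'])
    (by rw [(G.rad_spec t0.le ht.2 y).1, (G.rad_spec t0.le ht.2 y').1, hy, hy']) ht2
  have hg : ∀ a b, dist (g a) (g b) = 1 * dist a b := fun a b => by rw [g.dist_eq, one_mul]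
  rw [G.rad_sim t0.le ht.2 g 1 hg gp] at gx gy
  have n : ∀ a, dist p (g a) = dist p a := fun a => by
    calc dist p (g a) = dist (g p) (g a) := by rw [gp]
      _ = _ := g.dist_eq _ _
  have e1 := G.no_branch (by rw [n, hx, hx']) t0 ht.2 gx
  have e2 := G.no_branch (by rw [n, hy, hy']) t0 ht.2 gy
  rw [← e1, ← e2, g.dist_eq] at h
  exact lt_irrefl _ h

theorem rad_dil1 (G : Good Y p) {x y : Y} (hx : dist p x = 1) (hy : dist p y = 1)
    {s : ℝ} (s0 : 0 < s) (s1 : s ≤ 1) : dist (rad p s x) (rad p s y) = s * dist x y := by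
  have hle : dist x y ≤ 2 := by
    have := dist_triangle_left x y p
    linarith
  rcases hle.lt_or_eq with h2 | h2
  swap
  · apply le_antisymm
    · have := dist_triangle_left (rad p s x) (rad p s y) p
      rw [(G.rad_spec s0.le s1 x).1, (G.rad_spec s0.le s1 y).1, hx, hy] at this
      rw [h2]; linarith
    · have := dist_triangle4 x (rad p s x) (rad p s y) y
      rw [dist_comm x (rad p s x), (G.rad_spec s0.le s1 x).2, (G.rad_spec s0.le s1 y).2, hx, hy] at this
      rw [h2] at this ⊢
      linarith
  have := G.proper
  have hcs : CompactSpace {v : Y // dist p v = 1} := by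
    have : IsCompact {v : Y | dist p v = 1} := by
      have := isCompact_sphere p (1:ℝ)
      convert this using 1
      ext v; simp [dist_comm]
    exact isCompact_iff_compactSpace.1 this
  obtain ⟨g, g1, g2, g3⟩ := G.uh {(p, p)} s⁻¹ (by positivity) (by simp) (by simp)
  have gp : g p = p := g3 (p, p) (by simp)
  have gn : ∀ a, dist p (g a) = s⁻¹ * dist p a := fun a => by
    calc dist p (g a) = dist (g p) (g a) := by rw [gp]
      _ = _ := g2 _ _
  let f : {v : Y // dist p v = 1} → {v : Y // dist p v = 1} := fun v => ⟨g (rad p s v.1), by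
    rw [gn, (G.rad_spec s0.le s1 _).1, v.2]; field_simp⟩
  have hf : ∀ a b, dist (f a) (f b) = s⁻¹ * dist (rad p s a.1) (rad p s b.1) := fun a b => g2 _ _
  have hmono : ∀ a b c d, dist a b < dist c d → dist (f a) (f b) < dist (f c) (f d) := by
    intro a b c d h
    rw [hf, hf]
    exact mul_lt_mul_of_pos_left (G.rad_lt a.2 b.2 c.2 d.2 h s0 s1) (by positivity)
  have finj : Function.Injective f := by
    intro a b hab
    by_contra hne
    have := hmono a a a b (by rw [dist_self]; exact dist_pos.2 hne)
    rw [hab, dist_self] at this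
    exact lt_irrefl _ this
  have fsurj : Function.Surjective f := by
    rintro ⟨v, hv⟩
    obtain ⟨w, rfl⟩ := g1 v
    obtain ⟨z, rfl⟩ := G.rad_surj w s0 s1
    refine ⟨⟨z, ?_⟩, rfl⟩
    rw [gn, (G.rad_spec s0.le s1 _).1] at hv
    field_simp at hv
    exact hv
  obtain ⟨fe, hfe⟩ : ∃ fe : {v : Y // dist p v = 1} ≃ {v : Y // dist p v = 1}, ∀ a, fe a = f a :=
    ⟨Equiv.ofBijective f (And.intro finj fsurj), fun a => rfl⟩
  have key := order_iso fe (by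
    intro a b c d
    rw [hfe, hfe, hfe, hfe]
    constructor
    · intro h
      rcases h.lt_or_eq with h | h
      · exact (hmono _ _ _ _ h).le
      · have h : dist a.1 b.1 = dist c.1 d.1 := h
        obtain ⟨k, kp, ka, kb⟩ := G.iso2 a.1 c.1 b.1 d.1 (by rw [a.2, c.2]) (by rw [b.2, d.2]) h
        have hk : ∀ a b, dist (k a) (k b) = 1 * dist a b := fun a b => by rw [k.dist_eq, one_mul]
        rw [hf, hf, ← ka, ← kb, ← G.rad_sim s0.le s1 k 1 hk kp, ← G.rad_sim s0.le s1 k 1 hk kp,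
          k.dist_eq]
    · intro h
      by_contra h2
      have := hmono _ _ _ _ (not_le.1 h2)
      linarith) ⟨x, hx⟩ ⟨y, hy⟩ (fun ε hε => G.chain ⟨x, hx⟩ ⟨y, hy⟩ h2 ε hε)
  rw [hfe, hfe, hf] at key
  have key : s⁻¹ * dist (rad p s x) (rad p s y) = dist x y := key
  rw [← key]; field_simp

/-- dilations are similarities -/
theorem Phi_dil (G : Good Y p) {s : ℝ} (s0 : 0 ≤ s) (a b : Y) :
    dist (Phi p s a) (Phi p s b) = s * dist a b := by
  have h1 : ∀ s : ℝ, 0 < s → s ≤ 1 → ∀ a b : Y, dist p a = dist p b →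
      dist (Phi p s a) (Phi p s b) = s * dist a b := by
    intro s s0 s1 a b hab
    rcases eq_or_ne a p with rfl | ha
    · rw [dist_self] at hab
      have : a = b := dist_eq_zero.1 hab.symm
      subst this; simp
    obtain ⟨x, hx, ex⟩ := G.exists_dir ha
    have hl : 0 < dist p a := dist_pos.2 ha.symm
    have hb : b ≠ p := by rintro rfl; rw [dist_self] at hab; linarith
    obtain ⟨y, hy, ey⟩ := G.exists_dir hb
    rw [← hab] at ey
    set l := dist p a
    obtain ⟨g, g1, g2, gp, gx⟩ := G.sim1 x a l hl (by rw [hx, mul_one])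
    obtain ⟨v, hv⟩ := g1 b
    have hv1 : dist p v = 1 := by
      have := g2 p v
      rw [gp, hv, ← hab] at this
      have : l * (dist p v - 1) = 0 := by linarith
      rcases mul_eq_zero.1 this with h | h <;> linarith
    have := G.rad_dil1 hx hv1 s0 s1
    rw [← gx, ← hv, ← G.Phi_sim s0.le g l g2 gp, ← G.Phi_sim s0.le g l g2 gp, g2, g2, Phi_le _ s1,
      Phi_le _ s1, this]
    ring
  have h2 : ∀ s : ℝ, 0 < s → s ≤ 1 → ∀ a b : Y, dist p b ≤ dist p a →
      dist (Phi p s a) (Phi p s b) = s * dist a b := by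
    intro s s0 s1 a b hab
    rcases eq_or_ne b p with rfl | hb
    · rw [G.Phi_p s0.le, dist_comm, G.Phi_norm s0.le, dist_comm]
    have hb0 : 0 < dist p b := dist_pos.2 hb.symm
    have ha0 : 0 < dist p a := by linarith
    set t := dist p b / dist p a with ht
    have t0 : 0 < t := by positivity
    set b' := Phi p t⁻¹ b
    have hb' : Phi p t b' = b := G.Phi_inv t0 b
    have hn : dist p b' = dist p a := by
      rw [G.Phi_norm (by positivity), ht]; field_simp
    have hd := h1 s s0 s1 a b' hn.symm
    obtain ⟨g, g1, g2, g3⟩ := G.uh {(p, p), (a, Phi p s a), (b', Phi p s b')} s s0 (by simp) (by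
        simp [hd, dist_comm _ p, dist_comm b' a, dist_comm (Phi p s b') (Phi p s a),
          G.Phi_norm s0.le])
    have gp : g p = p := g3 (p, p) (by simp)
    have ga : g a = Phi p s a := g3 (a, Phi p s a) (by simp)
    have gb' : g b' = Phi p s b' := g3 (b', Phi p s b') (by simp)
    have gb : g b = Phi p s b := by
      rw [← hb', G.Phi_sim t0.le g s g2 gp, gb', G.Phi_Phi t0.le s0.le, G.Phi_Phi s0.le t0.le, mul_comm]
    rw [← ga, ← gb, g2]
  have h3 : ∀ s : ℝ, 0 < s → s ≤ 1 → ∀ a b : Y,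
      dist (Phi p s a) (Phi p s b) = s * dist a b := by
    intro s s0 s1 a b
    rcases le_total (dist p b) (dist p a) with h | h
    · exact h2 s s0 s1 a b h
    · rw [dist_comm, h2 s s0 s1 b a h, dist_comm]
  rcases s0.eq_or_lt with rfl | s0
  · simp [G.Phi_zero]
  rcases le_total s 1 with s1 | s1
  · exact h3 s s0 s1 a b
  · have := h3 s⁻¹ (by positivity) (inv_le_one_of_one_le₀ s1) (Phi p s a) (Phi p s b)
    rw [G.Phi_inv2 s0, G.Phi_inv2 s0] at this
    rw [this]; field_simp

end Good


/-- Busemann function of the ray through the unit vector `x`. -/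
noncomputable def hb {Y : Type u} [MetricSpace Y] (p x y : Y) : ℝ :=
  ⨅ T : NNReal, (dist (Phi p (T : ℝ) x) y - T)

namespace Good

variable {Y : Type u} [MetricSpace Y] {p : Y}

theorem hb_anti (G : Good Y p) {x : Y} (hx : dist p x = 1) (y : Y) {s t : ℝ} (s0 : 0 ≤ s)
    (hst : s ≤ t) : dist (Phi p t x) y - t ≤ dist (Phi p s x) y - s := by
  have := dist_triangle (Phi p t x) (Phi p s x) y
  rw [G.Phi_dist (s0.trans hst) s0, hx, abs_of_nonneg (by linarith)] at this
  linarith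

theorem hb_lower (G : Good Y p) {x : Y} (hx : dist p x = 1) (y : Y) {s : ℝ} (s0 : 0 ≤ s) :
    -dist p y ≤ dist (Phi p s x) y - s := by
  have := dist_triangle_right p (Phi p s x) y
  rw [G.Phi_norm s0, hx] at this
  linarith

theorem hb_le (G : Good Y p) {x : Y} (hx : dist p x = 1) (y : Y) {s : ℝ} (s0 : 0 ≤ s) :
    hb p x y ≤ dist (Phi p s x) y - s := by
  have hb : BddBelow (Set.range fun T : NNReal => (dist (Phi p (T : ℝ) x) y - T)) :=
    ⟨-dist p y, by rintro _ ⟨T, rfl⟩; exact G.hb_lower hx y T.2⟩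
  exact ciInf_le hb ⟨s, s0⟩

theorem hb_tendsto (G : Good Y p) {x : Y} (hx : dist p x = 1) (y : Y) :
    Tendsto (fun T : ℝ => dist (Phi p T x) y - T) atTop (𝓝 (hb p x y)) := by
  rw [Metric.tendsto_atTop]
  intro ε hε
  obtain ⟨T, hT⟩ := exists_lt_of_ciInf_lt
    (show (⨅ T : NNReal, (dist (Phi p (T : ℝ) x) y - T)) < hb p x y + ε by
      change hb p x y < _; linarith)
  refine ⟨T, fun s hs => ?_⟩
  have h1 := G.hb_anti hx y T.2 hs
  have h2 := G.hb_le hx y (T.2.trans hs)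
  change dist (Phi p T x) y - T < _ at hT
  rw [Real.dist_eq, abs_lt]
  constructor
  · linarith
  · change dist (Phi p s x) y - s ≤ dist (Phi p T x) y - T at h1
    linarith

theorem hb_ge_norm (G : Good Y p) {x : Y} (hx : dist p x = 1) (y : Y) : -dist p y ≤ hb p x y :=
  le_ciInf fun T => G.hb_lower hx y T.2

theorem hb_le_norm (G : Good Y p) {x : Y} (hx : dist p x = 1) (y : Y) : hb p x y ≤ dist p y := by
  have := G.hb_le hx y le_rfl
  rw [G.Phi_zero] at this
  linarith

theorem hb_le_dist (G : Good Y p) {x : Y} (hx : dist p x = 1) (y : Y) : hb p x y ≤ dist x y - 1 := by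
  have := G.hb_le hx y zero_le_one
  rwa [G.Phi_one] at this

theorem hb_conv (G : Good Y p) {x a b q : Y} {t : ℝ} (hx : dist p x = 1)
    (h0 : dist a q = t * dist a b) (h1 : dist q b = (1 - t) * dist a b) :
    hb p x q ≤ (1 - t) * hb p x a + t * hb p x b := by
  refine le_of_tendsto_of_tendsto' (G.hb_tendsto hx q)
    (((G.hb_tendsto hx a).const_mul (1 - t)).add ((G.hb_tendsto hx b).const_mul t)) fun T => ?_
  have := G.cv (Phi p T x) h0 h1
  linarith

theorem hb_mid (G : Good Y p) {x a b q : Y} (hx : dist p x = 1)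
    (h0 : dist a q = dist a b / 2) (h1 : dist q b = dist a b / 2) :
    hb p x q ≤ (hb p x a + hb p x b) / 2 := by
  have := G.hb_conv (t := 1/2) hx (by linarith : dist a q = 1/2 * dist a b) (by linarith)
  linarith

theorem hb_lip (G : Good Y p) {x : Y} (hx : dist p x = 1) (a b : Y) :
    hb p x a ≤ hb p x b + dist a b := by
  refine le_of_tendsto_of_tendsto' (G.hb_tendsto hx a)
    ((G.hb_tendsto hx b).add_const (dist a b)) fun T => ?_
  have := dist_triangle_right (Phi p T x) a b
  linarith

theorem hb_Phi (G : Good Y p) {x : Y} (hx : dist p x = 1) {t : ℝ} (t0 : 0 ≤ t) (y : Y) :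
    hb p x (Phi p t y) = t * hb p x y := by
  rcases t0.eq_or_lt with rfl | t0
  · rw [G.Phi_zero, zero_mul]
    have h1 := G.hb_ge_norm hx p
    have h2 := G.hb_le_norm hx p
    rw [dist_self] at h1 h2
    linarith
  refine tendsto_nhds_unique (G.hb_tendsto hx _) ?_
  have := ((G.hb_tendsto hx y).comp (tendsto_id.atTop_div_const t0)).const_mul t
  refine this.congr' ?_
  filter_upwards [eventually_ge_atTop 0] with T hT
  simp only [Function.comp, id]
  have h2 : Phi p T x = Phi p t (Phi p (T / t) x) := by
    rw [G.Phi_Phi t0.le (by positivity)]; congr 1; field_simp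
  rw [h2, G.Phi_dil t0.le]
  field_simp

theorem iso_norm {g : Y ≃ᵢ Y} (gp : g p = p) (a : Y) : dist p (g a) = dist p a := by
  calc dist p (g a) = dist (g p) (g a) := by rw [gp]
    _ = _ := g.dist_eq _ _

theorem hb_iso (G : Good Y p) (g : Y ≃ᵢ Y) (gp : g p = p) (x y : Y) :
    hb p (g x) (g y) = hb p x y := by
  unfold hb
  congr 1
  ext T
  rw [← G.Phi_iso (NNReal.coe_nonneg T) g gp]
  rw [g.dist_eq]

theorem hb_symm (G : Good Y p) {x y : Y} (hx : dist p x = 1) (hy : dist p y = 1) :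
    hb p x y = hb p y x := by
  obtain ⟨g, gp, g1, g2⟩ := G.iso2 x y y x (by rw [hx, hy]) (by rw [hx, hy]) (dist_comm _ _)
  have := G.hb_iso g gp x y
  rw [g1, g2] at this
  exact this.symm

theorem hb_self (G : Good Y p) {x : Y} (hx : dist p x = 1) : hb p x x = -1 := by
  apply le_antisymm
  · have := G.hb_le_dist hx x
    rw [dist_self] at this; linarith
  · have := G.hb_ge_norm hx x
    rw [hx] at this; linarith

theorem hb_anti_ge (G : Good Y p) {x z : Y} (hx : dist p x = 1) (hz : dist p z = 1)
    (h : dist x z = 2) (y : Y) : 0 ≤ hb p x y + hb p z y := by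
  refine ge_of_tendsto ((G.hb_tendsto hx y).add (G.hb_tendsto hz y)) ?_
  filter_upwards [eventually_ge_atTop 0] with T hT
  have := dist_triangle_right (Phi p T x) (Phi p T z) y
  rw [G.Phi_dil hT, h] at this
  linarith

theorem dist_two_of_hb (G : Good Y p) {x z : Y} (hx : dist p x = 1) (hz : dist p z = 1)
    (h : hb p x z = 1) : dist x z = 2 := by
  have := G.hb_le_dist hx z
  have := dist_triangle_left x z p
  linarith

theorem hb_of_dist_two (G : Good Y p) {x z : Y} (hx : dist p x = 1) (hz : dist p z = 1)
    (h : dist x z = 2) : hb p x z = 1 := by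
  have h1 := G.hb_anti_ge hx hz h z
  rw [G.hb_self hz] at h1
  have := G.hb_le_norm hx z
  linarith

theorem hb_lip' (G : Good Y p) {x x' y : Y} (hx : dist p x = 1) (hx' : dist p x' = 1)
    (hy : dist p y = 1) : hb p x y ≤ hb p x' y + dist x x' := by
  rw [G.hb_symm hx hy, G.hb_symm hx' hy]
  exact G.hb_lip hy x x'

theorem hb_abs (G : Good Y p) {x : Y} (hx : dist p x = 1) (a b : Y) :
    |hb p x a - hb p x b| ≤ dist a b := by
  rw [abs_le]
  have h1 := G.hb_lip hx a b
  have h2 := G.hb_lip hx b a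
  rw [dist_comm] at h2
  constructor <;> linarith

theorem hb_abs2 (G : Good Y p) {x y x' y' : Y} (hx : dist p x = 1) (hx' : dist p x' = 1)
    (hy : dist p y = 1) :
    |hb p x y - hb p x' y'| ≤ dist x x' + dist y y' := by
  rw [abs_le]
  have h1 := G.hb_lip' hx hx' hy
  have h2 := G.hb_lip' hx' hx hy
  have h3 := G.hb_lip hx' y y'
  have h4 := G.hb_lip hx' y' y
  rw [dist_comm x' x] at h2
  rw [dist_comm y' y] at h4
  constructor <;> linarith

/-- strict convexity of the unit ball -/
theorem strict (G : Good Y p) {u u' m : Y} (hu : dist p u = 1) (hu' : dist p u' = 1) (hne : u ≠ u')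
    (h0 : dist u m = dist u u' / 2) (h1 : dist m u' = dist u u' / 2) : dist p m < 1 := by
  have hle := G.cvm p h0 h1
  rw [hu, hu'] at hle
  rcases (show dist p m ≤ 1 by linarith).lt_or_eq with h | hm
  · exact h
  exfalso
  obtain ⟨g, gp, g1, g2⟩ := G.iso2 u m m u' (by rw [hu, hm]) (by rw [hm, hu']) (by rw [h0, h1])
  have he : 0 < dist u u' := dist_pos.2 hne
  set e := dist u m with hee
  set a : ℕ → Y := fun k => g^[k] u with ha
  have as : ∀ k, a (k+1) = g (a k) := fun k => Function.iterate_succ_apply' g k u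
  have hn : ∀ k, dist p (a k) = 1 := by
    intro k
    induction k with
    | zero => exact hu
    | succ k ih => rw [as, iso_norm gp, ih]
  have hd1 : ∀ k, dist (a k) (a (k+1)) = e := by
    intro k
    induction k with
    | zero => rw [as]; change dist u (g u) = e; rw [g1]
    | succ k ih => rw [as (k+1), as k, g.dist_eq, ← as k, ih]
  have hd2 : ∀ k, dist (a k) (a (k+2)) = 2 * e := by
    intro k
    induction k with
    | zero => rw [as, as]; change dist u (g (g u)) = _; rw [g1, g2]; linarith
    | succ k ih => rw [as (k+2), as k, g.dist_eq, ih]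
  have hm : ∀ k, dist u (a (k+1)) ≤ (dist u (a k) + dist u (a (k+2))) / 2 := by
    intro k
    apply G.cvm
    · rw [hd1, hd2]; ring
    · rw [hd1, hd2]; ring
  have hg : ∀ k : ℕ, k * e ≤ dist u (a k) ∧ dist u (a k) + e ≤ dist u (a (k+1)) := by
    intro k
    induction k with
    | zero =>
      have := hd1 0
      change dist u (a 1) = e at this
      rw [zero_add, this]
      change (_ ≤ dist u u) ∧ dist u u + e ≤ e
      simp
    | succ k ih =>
      have := hm k
      push_cast
      constructor
      · linarith [ih.1, ih.2]
      · linarith [ih.2]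
  obtain ⟨k, hk⟩ := exists_nat_gt (2 / e)
  have h3 := (hg k).1
  have h4 := dist_triangle_left u (a k) p
  rw [hu, hn] at h4
  rw [div_lt_iff₀ (by linarith)] at hk
  linarith

theorem eq_of_hb (G : Good Y p) {x y : Y} (hx : dist p x = 1) (hy : dist p y = 1)
    (h : hb p x y ≤ -1) : x = y := by
  by_contra hne
  obtain ⟨m, h0, h1⟩ := G.mid x y
  have h2 := G.strict hx hy hne h0 h1
  have h3 := G.hb_mid hx h0 h1
  rw [G.hb_self hx] at h3
  have h4 := G.hb_ge_norm hx m
  linarith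

theorem hb_unif (G : Good Y p) {ε : ℝ} (hε : 0 < ε) : ∃ δ > 0, ∀ x y : Y, dist p x = 1 →
    dist p y = 1 → hb p x y ≤ -1 + δ → dist x y < ε := by
  have := G.proper
  by_contra hcon
  push Not at hcon
  have hex : ∀ n : ℕ, ∃ z : Y × Y, dist p z.1 = 1 ∧ dist p z.2 = 1 ∧
      hb p z.1 z.2 ≤ -1 + 1 / ((n:ℝ) + 1) ∧ ε ≤ dist z.1 z.2 := by
    intro n
    obtain ⟨x, y, h⟩ := hcon (1 / ((n:ℝ) + 1)) (by positivity)
    exact ⟨(x, y), h⟩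
  choose z h1 h2 h3 h4 using hex
  obtain ⟨a, -, φ, hφ, ha⟩ := tendsto_subseq_of_bounded
    (Metric.isBounded_closedBall (x := ((p, p) : Y × Y)) (r := 1)) (x := z) (fun n => by
      rw [Metric.mem_closedBall, dist_comm, Prod.dist_eq]
      simp [h1 n, h2 n])
  have ha1 : Tendsto (fun n => (z (φ n)).1) atTop (𝓝 a.1) := (continuous_fst.tendsto a).comp ha
  have ha2 : Tendsto (fun n => (z (φ n)).2) atTop (𝓝 a.2) := (continuous_snd.tendsto a).comp ha
  have n1 : dist p a.1 = 1 :=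
    tendsto_nhds_unique (tendsto_const_nhds.dist ha1) (by simp only [h1]; exact tendsto_const_nhds)
  have n2 : dist p a.2 = 1 :=
    tendsto_nhds_unique (tendsto_const_nhds.dist ha2) (by simp only [h2]; exact tendsto_const_nhds)
  have d1 : ε ≤ dist a.1 a.2 := ge_of_tendsto' (ha1.dist ha2) (fun n => h4 (φ n))
  have d2 : hb p a.1 a.2 ≤ -1 := by
    have hlim : Tendsto (fun n => -1 + 1 / (((φ n : ℕ) : ℝ) + 1) + (dist a.1 (z (φ n)).1 +
        dist a.2 (z (φ n)).2)) atTop (𝓝 (-1 + 0 + (0 + 0))) := by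
      refine Tendsto.add (tendsto_const_nhds.add
        (tendsto_one_div_add_atTop_nhds_zero_nat.comp hφ.tendsto_atTop)) (Tendsto.add ?_ ?_)
      · have := (tendsto_const_nhds (x := a.1)).dist ha1
        rwa [dist_self] at this
      · have := (tendsto_const_nhds (x := a.2)).dist ha2
        rwa [dist_self] at this
    have := ge_of_tendsto' hlim (b := hb p a.1 a.2) fun n => by
      have q1 := G.hb_abs2 n1 (h1 (φ n)) n2 (y' := (z (φ n)).2)
      have q2 := h3 (φ n)
      have := (abs_le.1 q1).2
      linarith
    linarith
  have := G.eq_of_hb n1 n2 d2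
  rw [this, dist_self] at d1
  linarith

/-- dichotomy: either a star or there are arbitrarily close distinct unit vectors -/
theorem close_pairs (G : Good Y p) {u v : Y} (hu : dist p u = 1) (hv : dist p v = 1) (hne : u ≠ v)
    (h : dist u v < 2) {ε : ℝ} (hε : 0 < ε) :
    ∃ x z, dist p x = 1 ∧ dist p z = 1 ∧ x ≠ z ∧ dist x z < ε := by
  by_contra hcon
  push Not at hcon
  have := G.chain ⟨u, hu⟩ ⟨v, hv⟩ h ε hε
  have h2 : Relation.ReflTransGen (fun a b : {v : Y // dist p v = 1} => a = b) ⟨u, hu⟩ ⟨v, hv⟩ := by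
    refine Relation.ReflTransGen.mono (fun a b hab => ?_) _ _ this
    by_contra hne
    have := hcon a.1 b.1 a.2 b.2 (fun h => hne (Subtype.ext h))
    exact absurd hab (not_lt.2 this)
  have h3 : (⟨u, hu⟩ : {v : Y // dist p v = 1}) = ⟨v, hv⟩ := by
    generalize (⟨u, hu⟩ : {v : Y // dist p v = 1}) = a at h2
    generalize (⟨v, hv⟩ : {v : Y // dist p v = 1}) = b at h2
    induction h2 with
    | refl => rfl
    | tail _ h ih => exact ih.trans h
  exact hne (congrArg Subtype.val h3)

end Good


theorem subsine_disc (c : ℕ → ℝ) (α : ℝ) (hα : 0 < α)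
    (hc : ∀ k, 2 * Real.cos α * c (k + 1) ≤ c k + c (k + 2)) (n : ℕ) :
    (n : ℝ) * α ≤ Real.pi → ∀ k ≤ n,
      Real.sin (n * α) * c k ≤ Real.sin (((n : ℝ) - k) * α) * c 0 + Real.sin (k * α) * c n := by
  have hV : ∀ n : ℕ, (n : ℝ) * α ≤ Real.pi →
      0 ≤ c (n + 1) * Real.sin (n * α) - c n * Real.sin ((n + 1) * α) + c 0 * Real.sin α := by
    intro n
    induction n with
    | zero => intro _; simp
    | succ n ih =>
      intro h
      push_cast at h ⊢
      have ih := ih (by nlinarith)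
      have hs : 0 ≤ Real.sin ((n + 1) * α) := Real.sin_nonneg_of_nonneg_of_le_pi (by positivity) h
      have hh := mul_le_mul_of_nonneg_left (hc n) hs
      have e1 : Real.sin ((n + 1 + 1) * α) = Real.sin ((n+1) * α) * Real.cos α + Real.cos ((n+1) * α) * Real.sin α := by
        rw [← Real.sin_add]; ring_nf
      have e2 : Real.sin (n * α) = Real.sin ((n+1) * α) * Real.cos α - Real.cos ((n+1) * α) * Real.sin α := by
        rw [← Real.sin_sub]; ring_nf
      rw [e1]
      rw [e2] at ih
      nlinarith
  induction n with
  | zero =>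
    intro _ k hk
    have : k = 0 := by omega
    subst this; simp
  | succ n ih =>
    intro h k hk
    push_cast at h
    rcases Nat.lt_or_ge n k with hkn | hkn
    · have : k = n + 1 := by omega
      subst this; simp
    have ih := ih (by nlinarith) k hkn
    have hv := hV n (by nlinarith)
    rcases Nat.eq_zero_or_pos n with rfl | hn
    · have : k = 0 := by omega
      subst this; simp
    have hn1 : (1:ℝ) ≤ n := by exact_mod_cast hn
    have hsn : 0 < Real.sin (n * α) := Real.sin_pos_of_pos_of_lt_pi (by positivity) (by nlinarith)
    have hkn' : (k : ℝ) ≤ n := by exact_mod_cast hkn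
    have hsk : 0 ≤ Real.sin (k * α) :=
      Real.sin_nonneg_of_nonneg_of_le_pi (by positivity) (by nlinarith)
    have hsn1 : 0 ≤ Real.sin ((n + 1) * α) := Real.sin_nonneg_of_nonneg_of_le_pi (by positivity) h
    have h1 := mul_le_mul_of_nonneg_left ih hsn1
    have h2 := mul_nonneg hsk hv
    push_cast
    have id : Real.sin ((n + 1) * α) * Real.sin (((n:ℝ) - k) * α) + Real.sin (k * α) * Real.sin α
        = Real.sin (n * α) * Real.sin (((n:ℝ) + 1 - k) * α) := by
      have e1 : ((n:ℝ) + 1) * α = n * α + α := by ring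
      have e2 : ((n:ℝ) - k) * α = n * α - k * α := by ring
      have e3 : ((n:ℝ) + 1 - k) * α = (n * α - k * α) + α := by ring
      rw [e1, e2, e3, Real.sin_add, Real.sin_add, Real.sin_sub, Real.cos_sub]
      have := Real.sin_sq_add_cos_sq (n * α)
      linear_combination (-Real.sin (k * α) * Real.sin α) * this
    refine le_of_mul_le_mul_left (a := Real.sin (n * α)) ?_ hsn
    linear_combination h1 + h2 + c 0 * id

namespace Good

variable {Y : Type u} [MetricSpace Y] {p : Y}

theorem step (G : Good Y p) {u v : Y} (hu : dist p u = 1) (hv : dist p v = 1) (hne : u ≠ v)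
    (huv : dist u v < 2) {η : ℝ} (hη : 0 < η) (hη1 : η ≤ 1) :
    ∃ (α : ℝ) (w : ℤ → Y), 0 < α ∧ α < η ∧ (∀ k, dist p (w k) = 1) ∧
      (∀ j k, dist (w j) (w k) = dist (w 0) (w (k - j))) ∧ dist (w 0) (w 1) < η ∧
      ∀ y, dist p y = 1 → ∀ k, 2 * Real.cos α * hb p y (w k) ≤ hb p y (w (k - 1)) + hb p y (w (k + 1)) := by
  have hpi := Real.pi_gt_three
  have hcos : Real.cos η < 1 := by
    rw [← Real.cos_zero]
    exact Real.cos_lt_cos_of_nonneg_of_le_pi_div_two le_rfl (by linarith) hη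
  obtain ⟨x, z, hx, hz, hxz, hd⟩ := G.close_pairs hu hv hne huv (ε := min η (1 - Real.cos η))
    (lt_min hη (by linarith))
  have hd1 := hd.trans_le (min_le_left _ _)
  have hd2 := hd.trans_le (min_le_right _ _)
  obtain ⟨m, h0, h1⟩ := G.mid x z
  have hs := G.strict hx hz hxz h0 h1
  have hdm : dist p x ≤ dist p m + dist x m := by
    rw [dist_comm x m]; exact dist_triangle _ _ _
  rw [hx, h0] at hdm
  have hc0 : 0 ≤ Real.cos η := Real.cos_nonneg_of_neg_pi_div_two_le_of_le (by linarith) (by linarith)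
  set μ := dist p m with hμ
  have hxz0 : 0 < dist x z := dist_pos.2 hxz
  have μ0 : 0 < μ := by linarith
  have μc : Real.cos η < μ := by linarith
  obtain ⟨y, hy, hmy⟩ := G.exists_dir (y := m) (by rintro rfl; simp [hμ] at μ0)
  rw [← hμ] at hmy
  obtain ⟨f, fp, f1, f2⟩ := G.iso2 x z m m (by rw [hx, hz]) rfl (by rw [h0, dist_comm z m, h1])
  have fy : f y = y := by
    apply G.Phi_inj μ0
    rw [← G.Phi_iso μ0.le f fp, ← hmy, f2]
  have hxy : dist x y = dist y z := by
    have := f.dist_eq x y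
    rw [f1, fy] at this
    rw [← this, dist_comm]
  obtain ⟨g, gp, g1, g2⟩ := G.iso2 x y y z (by rw [hx, hy]) (by rw [hy, hz]) hxy
  have gkp : ∀ k : ℤ, (g ^ k) p = p := by
    have h1 : ∀ k : ℕ, (g ^ k) p = p := by
      intro k
      induction k with
      | zero => rfl
      | succ k ih => rw [pow_succ, IsometryEquiv.mul_apply, gp, ih]
    intro k
    obtain ⟨n, rfl | rfl⟩ := k.eq_nat_or_neg
    · rw [zpow_natCast]; exact h1 n
    · rw [zpow_neg, zpow_natCast]
      apply (g ^ n).injective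
      rw [← IsometryEquiv.mul_apply, mul_inv_cancel, h1]; rfl
  have hadd : ∀ (j k : ℤ) (q : Y), (g ^ (j + k)) q = (g ^ j) ((g ^ k) q) := by
    intro j k q
    rw [zpow_add, IsometryEquiv.mul_apply]
  have w0 : (g ^ (0:ℤ)) x = x := rfl
  have w1 : (g ^ (1:ℤ)) x = y := by rw [zpow_one, g1]
  have w2 : (g ^ (2:ℤ)) x = z := by
    rw [show (2:ℤ) = 1 + 1 by norm_num, hadd, w1, zpow_one, g2]
  refine ⟨Real.arccos μ, fun k => (g ^ k) x, Real.arccos_pos.2 hs, ?_, fun k => ?_, fun j k => ?_, ?_, ?_⟩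
  · rw [← Real.arccos_cos hη.le (by linarith)]
    exact Real.arccos_lt_arccos (by linarith) μc hs.le
  · rw [iso_norm (gkp k), hx]
  · show dist ((g ^ j) x) ((g ^ k) x) = dist ((g ^ (0:ℤ)) x) ((g ^ (k - j)) x)
    have : k = j + (k - j) := by ring
    rw [w0]
    nth_rewrite 1 [this]
    rw [hadd, (g ^ j).dist_eq]
  · show dist ((g ^ (0:ℤ)) x) ((g ^ (1:ℤ)) x) < η
    rw [w0, w1]
    have t1 := dist_triangle x m y
    have t2 : dist m y = 1 - μ := by
      rw [hmy]
      nth_rewrite 2 [← G.Phi_one y]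
      rw [G.Phi_dist μ0.le zero_le_one, hy, abs_of_nonpos (by linarith)]; ring
    rw [h0, t2] at t1
    linarith
  · intro q hq k
    rw [Real.cos_arccos (by linarith) hs.le]
    show 2 * μ * hb p q ((g ^ k) x) ≤ hb p q ((g ^ (k - 1)) x) + hb p q ((g ^ (k + 1)) x)
    set G' := g ^ (k - 1) with hG'
    have e1 : (g ^ k) x = G' y := by
      rw [← w1, hG', ← hadd]; congr 2; ring
    have e2 : (g ^ (k + 1)) x = G' z := by
      rw [← w2, hG', ← hadd]; congr 2; ring
    rw [e1, e2]
    have := G.hb_mid (q := G' m) (a := G' x) (b := G' z) hq (by rw [G'.dist_eq, G'.dist_eq, h0])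
      (by rw [G'.dist_eq, G'.dist_eq, h1])
    rw [hmy, G.Phi_iso μ0.le G' (gkp _), G.hb_Phi hq μ0.le] at this
    linarith

end Good


/-- great circles in the unit sphere -/
structure Circle' {Y : Type u} [MetricSpace Y] (p : Y) (w : ℝ → Y) : Prop where
  unit : ∀ t, dist p (w t) = 1
  sub : ∀ y, dist p y = 1 → ∀ a t b, a ≤ t → t ≤ b → b - a < Real.pi →
    Real.sin (b - a) * hb p y (w t) ≤ Real.sin (b - t) * hb p y (w a) + Real.sin (t - a) * hb p y (w b)
  inv : ∀ s t, dist (w s) (w t) = dist (w 0) (w (t - s))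

namespace Good

variable {Y : Type u} [MetricSpace Y] {p : Y}

theorem exists_circle (G : Good Y p) {u v : Y} (hu : dist p u = 1) (hv : dist p v = 1) (hne : u ≠ v)
    (huv : dist u v < 2) : ∃ w : ℝ → Y, Circle' p w := by
  have := G.proper
  have hex := fun n : ℕ => G.step hu hv hne huv (η := 1 / ((n : ℝ) + 1)) (by positivity)
    (by rw [div_le_one (by positivity)]; linarith [(Nat.cast_nonneg n : (0:ℝ) ≤ n)])
  choose α w h0 h1 hun hinv hstep hsub using hex
  have hα : Tendsto α atTop (𝓝 0) :=
    squeeze_zero (fun n => (h0 n).le) (fun n => (h1 n).le) tendsto_one_div_add_atTop_nhds_zero_nat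
  set U : Ultrafilter ℕ := hyperfilter ℕ with hU
  have hUle : (U : Filter ℕ) ≤ atTop := Nat.hyperfilter_le_atTop
  have hlim : ∀ t : ℝ, ∃ l : Y, Tendsto (fun n => w n ⌊t / α n⌋) U (𝓝 l) := by
    intro t
    obtain ⟨l, -, hl⟩ := (isCompact_closedBall p 1).ultrafilter_le_nhds
      (U.map (fun n => w n ⌊t / α n⌋)) (by
        rw [le_principal_iff]
        refine Filter.mem_map.2 (Filter.univ_mem' fun n => ?_)
        show w n ⌊t / α n⌋ ∈ Metric.closedBall p 1
        rw [Metric.mem_closedBall, dist_comm, hun])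
    exact ⟨l, hl⟩
  choose W hW using hlim
  have hfl : ∀ t : ℝ, Tendsto (fun n => (⌊t / α n⌋ : ℝ) * α n) U (𝓝 t) := by
    intro t
    have hz := hα.mono_left hUle
    refine tendsto_of_tendsto_of_tendsto_of_le_of_le (g := fun n => t - α n) (h := fun n => t)
      ?_ tendsto_const_nhds (fun n => ?_) (fun n => ?_)
    · have := (tendsto_const_nhds (x := t)).sub hz
      rwa [sub_zero] at this
    · have h := Int.sub_one_lt_floor (t / α n)
      have h2 := mul_le_mul_of_nonneg_right h.le (h0 n).le
      have h3 : (t / α n - 1) * α n = t - α n := by have := (h0 n).ne'; field_simp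
      show t - α n ≤ _
      linarith
    · have h := Int.floor_le (t / α n)
      have h2 := mul_le_mul_of_nonneg_right h (h0 n).le
      have h3 : (t / α n) * α n = t := by have := (h0 n).ne'; field_simp
      show _ ≤ t
      linarith
  have hWu : ∀ t, dist p (W t) = 1 := fun t =>
    tendsto_nhds_unique (tendsto_const_nhds.dist (hW t)) (by simp only [hun]; exact tendsto_const_nhds)
  have hhb : ∀ y, dist p y = 1 → ∀ t, Tendsto (fun n => hb p y (w n ⌊t / α n⌋)) U (𝓝 (hb p y (W t))) := by
    intro y hy t
    rw [tendsto_iff_dist_tendsto_zero]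
    refine squeeze_zero (fun n => dist_nonneg) (fun n => ?_) (tendsto_iff_dist_tendsto_zero.1 (hW t))
    rw [Real.dist_eq]
    exact G.hb_abs hy _ _
  refine ⟨W, hWu, ?_, ?_⟩
  · intro y hy a t b hat htb hab
    have hl : Tendsto (fun n => ((⌊b / α n⌋ : ℝ) - ⌊a / α n⌋) * α n) U (𝓝 (b - a)) := by
      refine ((hfl b).sub (hfl a)).congr fun n => by ring
    have hl2 : Tendsto (fun n => ((⌊b / α n⌋ : ℝ) - ⌊t / α n⌋) * α n) U (𝓝 (b - t)) := by
      refine ((hfl b).sub (hfl t)).congr fun n => by ring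
    have hl3 : Tendsto (fun n => ((⌊t / α n⌋ : ℝ) - ⌊a / α n⌋) * α n) U (𝓝 (t - a)) := by
      refine ((hfl t).sub (hfl a)).congr fun n => by ring
    have hs : ∀ x : ℝ, Tendsto Real.sin (𝓝 x) (𝓝 (Real.sin x)) := fun x => Real.continuous_sin.tendsto x
    refine le_of_tendsto_of_tendsto (((hs _).comp hl).mul (hhb y hy t))
      ((((hs _).comp hl2).mul (hhb y hy a)).add (((hs _).comp hl3).mul (hhb y hy b))) ?_
    filter_upwards [hl.eventually (gt_mem_nhds hab)] with n hn
    have hi1 : ⌊a / α n⌋ ≤ ⌊t / α n⌋ := Int.floor_le_floor (div_le_div_of_nonneg_right hat (h0 n).le)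
    have hi2 : ⌊t / α n⌋ ≤ ⌊b / α n⌋ := Int.floor_le_floor (div_le_div_of_nonneg_right htb (h0 n).le)
    simp only [Function.comp]
    generalize ⌊a / α n⌋ = i at *
    generalize ⌊t / α n⌋ = j at *
    generalize ⌊b / α n⌋ = l at *
    obtain ⟨j, rfl⟩ := Int.le.dest hi1
    obtain ⟨l, rfl⟩ := Int.le.dest (hi1.trans hi2)
    have := subsine_disc (fun k => hb p y (w n (i + k))) (α n) (h0 n) (fun k => by
      have := hsub n y hy (i + (k + 1))
      push_cast
      have e1 : i + ((k:ℤ) + 1) - 1 = i + k := by ring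
      have e2 : i + ((k:ℤ) + 1) + 1 = i + (k + 2) := by ring
      rwa [e1, e2] at this) l (by push_cast at hn; linarith) j (by omega)
    push_cast
    simp only [Nat.cast_zero, add_zero] at this
    have E1 : ((i:ℝ) + l - i) * α n = l * α n := by ring
    have E2 : ((i:ℝ) + l - (i + j)) * α n = (l - j) * α n := by ring
    have E3 : ((i:ℝ) + j - i) * α n = j * α n := by ring
    rw [E1, E2, E3]
    simpa using this
  · intro s t
    refine tendsto_nhds_unique ((hW s).dist (hW t)) ?_
    have hm := (hW 0).dist (hW (t - s))
    have hz : Tendsto (fun n : ℕ => 1 / ((n : ℝ) + 1)) U (𝓝 0) :=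
      tendsto_one_div_add_atTop_nhds_zero_nat.mono_left hUle
    rw [tendsto_iff_dist_tendsto_zero] at hm ⊢
    have hsum := hm.add hz
    rw [add_zero] at hsum
    refine squeeze_zero (fun n => dist_nonneg) (fun n => ?_) hsum
    refine (dist_triangle _ (dist (w n ⌊0 / α n⌋) (w n ⌊(t - s) / α n⌋)) _).trans ?_
    rw [add_comm]
    refine add_le_add le_rfl ?_
    rw [zero_div, Int.floor_zero, hinv n ⌊s / α n⌋, Real.dist_eq]
    have h2 : |dist (w n 0) (w n (⌊t / α n⌋ - ⌊s / α n⌋)) - dist (w n 0) (w n ⌊(t - s) / α n⌋)| ≤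
        dist (w n (⌊t / α n⌋ - ⌊s / α n⌋)) (w n ⌊(t - s) / α n⌋) := by
      rw [dist_comm (w n 0), dist_comm (w n 0)]
      exact abs_dist_sub_le _ _ _
    refine h2.trans ?_
    have e : (t - s) / α n = t / α n - s / α n := by ring
    rw [e, hinv]
    have f1 := Int.floor_le (t / α n)
    have f2 := Int.lt_floor_add_one (t / α n)
    have f3 := Int.floor_le (s / α n)
    have f4 := Int.lt_floor_add_one (s / α n)
    have f5 := Int.floor_le (t / α n - s / α n)
    have f6 := Int.lt_floor_add_one (t / α n - s / α n)
    generalize ⌊t / α n - s / α n⌋ = C at *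
    generalize ⌊t / α n⌋ = A at *
    generalize ⌊s / α n⌋ = B at *
    have g1 : (C : ℝ) < ((A - B + 1 : ℤ) : ℝ) := by push_cast; linarith
    have g2 : ((A - B : ℤ) : ℝ) < ((C + 2 : ℤ) : ℝ) := by push_cast; linarith
    have g1 := Int.cast_lt.1 g1
    have g2 := Int.cast_lt.1 g2
    rcases (show C - (A - B) = 0 ∨ C - (A - B) = -1 by omega) with h | h
    · rw [h, dist_self]; positivity
    · rw [h]
      have := hinv n (-1) 0
      rw [dist_comm, this]
      exact (hstep n).le

/-- the Busemann function along a circle -/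
theorem circle_cos (G : Good Y p) {w : ℝ → Y} (C : Circle' p w) {s t : ℝ} (h : |t - s| ≤ Real.pi) :
    hb p (w s) (w t) = -Real.cos (t - s) := by
  have hpi := Real.pi_pos
  have hsym : ∀ s t, hb p (w s) (w t) = hb p (w 0) (w (t - s)) := by
    intro s t
    obtain ⟨g, gp, g1, g2⟩ := G.iso2 (w s) (w 0) (w t) (w (t - s)) (by rw [C.unit, C.unit])
      (by rw [C.unit, C.unit]) (C.inv s t)
    rw [← g1, ← g2, G.hb_iso g gp]
  have hev : ∀ t, hb p (w 0) (w (-t)) = hb p (w 0) (w t) := by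
    intro t
    have := hsym t 0
    rw [zero_sub] at this
    rw [← this, G.hb_symm (C.unit t) (C.unit 0)]
  have h00 : hb p (w 0) (w 0) = -1 := G.hb_self (C.unit 0)
  have low1 : ∀ t, 0 ≤ t → t < Real.pi / 2 → -Real.cos t ≤ hb p (w 0) (w t) := by
    intro t t0 t1
    rcases t0.eq_or_lt with rfl | t0
    · rw [h00]; simp
    have := C.sub (w 0) (C.unit 0) (-t) 0 t (by linarith) t0.le (by linarith)
    rw [hev, h00, show t - -t = 2 * t by ring, Real.sin_two_mul, sub_zero, zero_sub, neg_neg] at this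
    have hs : 0 < Real.sin t := Real.sin_pos_of_pos_of_lt_pi t0 (by linarith)
    refine le_of_mul_le_mul_left (a := 2 * Real.sin t) ?_ (by positivity)
    linarith
  have low : ∀ t, 0 ≤ t → t < Real.pi → -Real.cos t ≤ hb p (w 0) (w t) := by
    intro t t0 t1
    rcases t0.eq_or_lt with rfl | t0
    · rw [h00]; simp
    have := C.sub (w 0) (C.unit 0) 0 (t / 2) t (by linarith) (by linarith) (by linarith)
    have h2 := low1 (t / 2) (by linarith) (by linarith)
    have hs : 0 ≤ Real.sin t := Real.sin_nonneg_of_nonneg_of_le_pi t0.le t1.le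
    have hs' : 0 < Real.sin (t / 2) := Real.sin_pos_of_pos_of_lt_pi (by linarith) (by linarith)
    rw [h00, sub_zero, sub_zero, show t - t / 2 = t / 2 by ring] at this
    have h3 := mul_le_mul_of_nonneg_left h2 hs
    have e1 : Real.sin t = 2 * Real.sin (t / 2) * Real.cos (t / 2) := by
      rw [← Real.sin_two_mul]; ring_nf
    have e2 : Real.cos t = 2 * Real.cos (t / 2) ^ 2 - 1 := by
      rw [← Real.cos_two_mul]; ring_nf
    refine le_of_mul_le_mul_left (a := Real.sin (t / 2)) ?_ hs'
    rw [e1] at h3 this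
    rw [e2]
    nlinarith
  have up : ∀ t, 0 ≤ t → t < Real.pi → hb p (w 0) (w t) ≤ -Real.cos t := by
    intro t t0 t1
    have hev : ∀ᶠ s in 𝓝[<] Real.pi, hb p (w 0) (w t) ≤ Real.sin (t - s / 2) / Real.sin (s / 2) := by
      filter_upwards [Ioo_mem_nhdsLT t1] with s hs
      have := C.sub (w 0) (C.unit 0) 0 t s t0 hs.1.le (by linarith [hs.2])
      have hle := G.hb_le_norm (C.unit 0) (w s)
      rw [C.unit] at hle
      have hst : 0 ≤ Real.sin t := Real.sin_nonneg_of_nonneg_of_le_pi t0 t1.le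
      rw [h00, sub_zero, sub_zero] at this
      have hss : 0 < Real.sin (s / 2) := Real.sin_pos_of_pos_of_lt_pi (by linarith [hs.1]) (by linarith [hs.2])
      have hcs : 0 < Real.cos (s / 2) := Real.cos_pos_of_mem_Ioo ⟨by linarith [hs.1], by linarith [hs.2]⟩
      rw [le_div_iff₀ hss]
      have e1 : Real.sin s = 2 * Real.sin (s / 2) * Real.cos (s / 2) := by
        rw [← Real.sin_two_mul]; ring_nf
      have e2 : Real.sin t - Real.sin (s - t) = 2 * Real.cos (s / 2) * Real.sin (t - s / 2) := by
        have a1 : t = s / 2 + (t - s / 2) := by ring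
        have a2 : s - t = s / 2 - (t - s / 2) := by ring
        have b1 : Real.sin t = _ := (congrArg Real.sin a1).trans (Real.sin_add _ _)
        have b2 : Real.sin (s - t) = _ := (congrArg Real.sin a2).trans (Real.sin_sub _ _)
        rw [b1, b2]
        linear_combination
      refine le_of_mul_le_mul_left (a := 2 * Real.cos (s / 2)) ?_ (by positivity)
      rw [e1] at this
      nlinarith [mul_le_mul_of_nonneg_left hle hst]
    have hl : Tendsto (fun s : ℝ => Real.sin (t - s / 2) / Real.sin (s / 2)) (𝓝[<] Real.pi)
        (𝓝 (Real.sin (t - Real.pi / 2) / Real.sin (Real.pi / 2))) := by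
      have hc : ContinuousAt (fun s : ℝ => Real.sin (t - s / 2) / Real.sin (s / 2)) Real.pi := by
        refine ContinuousAt.div (by fun_prop) (by fun_prop) ?_
        rw [Real.sin_pi_div_two]; norm_num
      exact hc.tendsto.mono_left nhdsWithin_le_nhds
    have := ge_of_tendsto hl hev
    rwa [Real.sin_pi_div_two, div_one, Real.sin_sub_pi_div_two] at this
  have hlt : ∀ t, 0 ≤ t → t < Real.pi → hb p (w 0) (w t) = -Real.cos t := fun t h0 h1 =>
    le_antisymm (up t h0 h1) (low t h0 h1)
  have hpi1 : hb p (w 0) (w Real.pi) = 1 := by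
    apply le_antisymm
    · have := G.hb_le_norm (C.unit 0) (w Real.pi)
      rwa [C.unit] at this
    have hl : Tendsto (fun s : ℝ => -Real.cos s - dist (w s) (w Real.pi)) (𝓝[<] Real.pi) (𝓝 (1 - 0)) := by
      refine Tendsto.sub ?_ ?_
      · have : Tendsto (fun s : ℝ => -Real.cos s) (𝓝 Real.pi) (𝓝 (-Real.cos Real.pi)) :=
          (Real.continuous_cos.neg).tendsto _
        rw [Real.cos_pi, neg_neg] at this
        exact this.mono_left nhdsWithin_le_nhds
      · rw [Metric.tendsto_nhds]
        intro ε hε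
        obtain ⟨δ, hδ, hd⟩ := G.hb_unif hε
        have hc : Tendsto (fun s : ℝ => -Real.cos (Real.pi - s)) (𝓝[<] Real.pi) (𝓝 (-1)) := by
          have : Tendsto (fun s : ℝ => -Real.cos (Real.pi - s)) (𝓝 Real.pi)
              (𝓝 (-Real.cos (Real.pi - Real.pi))) := Continuous.tendsto (by fun_prop) _
          rw [sub_self, Real.cos_zero] at this
          exact this.mono_left nhdsWithin_le_nhds
        filter_upwards [hc.eventually (gt_mem_nhds (show (-1:ℝ) < -1 + δ by linarith)),
          Ioo_mem_nhdsLT hpi] with s hs1 hs2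
        rw [Real.dist_eq, sub_zero, abs_of_nonneg dist_nonneg]
        apply hd _ _ (C.unit _) (C.unit _)
        rw [hsym, hlt _ (by linarith [hs2.2]) (by linarith [hs2.1])]
        exact hs1.le
    rw [sub_zero] at hl
    refine le_of_tendsto hl ?_
    filter_upwards [Ioo_mem_nhdsLT hpi] with s hs
    have := G.hb_lip (C.unit 0) (w s) (w Real.pi)
    rw [hlt s hs.1.le hs.2] at this
    linarith
  have hle : ∀ t, 0 ≤ t → t ≤ Real.pi → hb p (w 0) (w t) = -Real.cos t := by
    intro t h0 h1
    rcases h1.lt_or_eq with h1 | rfl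
    · exact hlt t h0 h1
    · rw [hpi1]; simp
  rw [hsym]
  rcases le_total 0 (t - s) with h3 | h3
  · rw [abs_of_nonneg h3] at h
    exact hle _ h3 h
  · rw [abs_of_nonpos h3] at h
    have := hle (-(t - s)) (by linarith) h
    rwa [hev, Real.cos_neg] at this

theorem circle_cont (G : Good Y p) {w : ℝ → Y} (C : Circle' p w) : Continuous w := by
  rw [continuous_iff_continuousAt]
  intro s
  rw [ContinuousAt, Metric.tendsto_nhds]
  intro ε hε
  obtain ⟨δ, hδ, hd⟩ := G.hb_unif hε
  have hc : Tendsto (fun t : ℝ => -Real.cos (s - t)) (𝓝 s) (𝓝 (-1)) := by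
    have : Tendsto (fun t : ℝ => -Real.cos (s - t)) (𝓝 s)
        (𝓝 (-Real.cos (s - s))) := Continuous.tendsto (by fun_prop) _
    rwa [sub_self, Real.cos_zero] at this
  filter_upwards [hc.eventually (gt_mem_nhds (show (-1:ℝ) < -1 + δ by linarith)),
    Metric.ball_mem_nhds s Real.pi_pos] with t h1 h2
  apply hd _ _ (C.unit _) (C.unit _)
  rw [G.circle_cos C]
  · exact h1.le
  · rw [Metric.mem_ball, Real.dist_eq, abs_sub_comm] at h2
    exact h2.le

end Good

namespace Circle'

variable {Y : Type u} [MetricSpace Y] {p : Y} {w : ℝ → Y}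

theorem shift (C : Circle' p w) (c : ℝ) : Circle' p (fun t => w (c + t)) where
  unit t := C.unit _
  sub y hy a t b h1 h2 h3 := by
    have := C.sub y hy (c + a) (c + t) (c + b) (by linarith) (by linarith) (by linarith)
    rwa [add_sub_add_left_eq_sub, add_sub_add_left_eq_sub, add_sub_add_left_eq_sub] at this
  inv s t := by
    rw [C.inv, C.inv (c + 0)]
    congr 2; ring

theorem rev (C : Circle' p w) : Circle' p (fun t => w (-t)) where
  unit t := C.unit _
  sub y hy a t b h1 h2 h3 := by
    have := C.sub y hy (-b) (-t) (-a) (by linarith) (by linarith) (by linarith)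
    rw [show -a - -b = b - a by ring, show -a - -t = t - a by ring, show -t - -b = b - t by ring] at this
    linarith
  inv s t := by
    rw [C.inv (-s) (-t), neg_zero]
    congr 2; ring

theorem map (G : Good Y p) (C : Circle' p w) (g : Y ≃ᵢ Y) (gp : g p = p) :
    Circle' p (fun t => g (w t)) where
  unit t := by rw [Good.iso_norm gp, C.unit]
  sub y hy a t b h1 h2 h3 := by
    obtain ⟨y', rfl⟩ := g.surjective y
    rw [Good.iso_norm gp] at hy
    have := C.sub y' hy a t b h1 h2 h3
    rwa [G.hb_iso g gp, G.hb_iso g gp, G.hb_iso g gp]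
  inv s t := by rw [g.dist_eq, g.dist_eq, C.inv]

end Circle'


namespace Good

variable {Y : Type u} [MetricSpace Y] {p : Y} {w : ℝ → Y}

theorem on_circle (G : Good Y p) (C : Circle' p w) {x y : Y} (hx : dist p x = 1) (hy : dist p y = 1) :
    ∃ g : Y ≃ᵢ Y, g p = p ∧ g (w 0) = x ∧ ∃ θ, 0 ≤ θ ∧ θ ≤ Real.pi ∧ g (w θ) = y := by
  have hc : ContinuousOn (fun θ => dist (w 0) (w θ)) (Set.Icc 0 Real.pi) :=
    (continuous_const.dist (G.circle_cont C)).continuousOn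
  have h2 : dist (w 0) (w Real.pi) = 2 := by
    apply G.dist_two_of_hb (C.unit _) (C.unit _)
    rw [G.circle_cos C (by rw [sub_zero, abs_of_pos Real.pi_pos])]; simp
  have hle := dist_triangle_left x y p
  rw [hx, hy] at hle
  obtain ⟨θ, hθ, he⟩ := intermediate_value_Icc Real.pi_pos.le hc (show dist x y ∈ _ from
    ⟨by simp, by simp only [h2]; linarith⟩)
  obtain ⟨g, gp, g1, g2⟩ := G.iso2 (w 0) x (w θ) y (by rw [C.unit, hx]) (by rw [C.unit, hy]) he
  exact ⟨g, gp, g1, θ, hθ.1, hθ.2, g2⟩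

theorem dist_of_hb (G : Good Y p) (C : Circle' p w) {x y x' y' : Y} (hx : dist p x = 1)
    (hy : dist p y = 1) (hx' : dist p x' = 1) (hy' : dist p y' = 1) (h : hb p x y = hb p x' y') :
    dist x y = dist x' y' := by
  obtain ⟨g, gp, rfl, θ, h0, h1, rfl⟩ := G.on_circle C hx hy
  obtain ⟨g', gp', rfl, θ', h0', h1', rfl⟩ := G.on_circle C hx' hy'
  rw [G.hb_iso g gp, G.hb_iso g' gp', G.circle_cos C (by rwa [sub_zero, abs_of_nonneg h0]),
    G.circle_cos C (by rwa [sub_zero, abs_of_nonneg h0']), sub_zero, sub_zero, neg_inj] at h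
  have := Real.injOn_cos ⟨h0, h1⟩ ⟨h0', h1'⟩ h
  rw [this, g.dist_eq, g'.dist_eq]

theorem arc (G : Good Y p) (C : Circle' p w) (k : Y ≃ᵢ Y) (kp : k p = p) {a t b : ℝ} (h1 : a ≤ t)
    (h2 : t ≤ b) (hab : a < b) (h3 : b - a < Real.pi) (ka : k (w a) = w a) (kb : k (w b) = w b) :
    k (w t) = w t := by
  have hC := C.map G k kp
  have := hC.sub (w t) (C.unit t) a t b h1 h2 h3
  simp only [ka, kb] at this
  rw [G.circle_cos C (by rw [abs_le]; constructor <;> linarith),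
    G.circle_cos C (by rw [abs_le]; constructor <;> linarith)] at this
  have hs : 0 < Real.sin (b - a) := Real.sin_pos_of_pos_of_lt_pi (by linarith) h3
  have e : Real.sin (b - a) = Real.sin (b - t) * Real.cos (t - a) + Real.cos (b - t) * Real.sin (t - a) := by
    rw [← Real.sin_add]; ring_nf
  have e2 : Real.cos (a - t) = Real.cos (t - a) := by rw [← Real.cos_neg]; ring_nf
  rw [e2] at this
  refine (G.eq_of_hb (C.unit t) (hC.unit t) ?_).symm
  refine le_of_mul_le_mul_left (a := Real.sin (b - a)) ?_ hs
  linarith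

theorem agree (G : Good Y p) (C : Circle' p w) {y y' : Y} (hy : dist p y = 1) (hy' : dist p y' = 1)
    {a t b : ℝ} (h1 : a ≤ t) (h2 : t ≤ b) (hab : a < b) (h3 : b - a < Real.pi)
    (ha : hb p (w a) y = hb p (w a) y') (hb' : hb p (w b) y = hb p (w b) y') :
    hb p (w t) y = hb p (w t) y' := by
  obtain ⟨g, gp, g1, g2, g3⟩ := G.iso3 (w a) (w a) (w b) (w b) y y' rfl rfl (by rw [hy, hy']) rfl
    (G.dist_of_hb C (C.unit _) hy (C.unit _) hy' ha) (G.dist_of_hb C (C.unit _) hy (C.unit _) hy' hb')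
  have := G.arc C g gp h1 h2 hab h3 g1 g2
  rw [← g3]
  nth_rewrite 2 [← this]
  rw [G.hb_iso g gp]

theorem circle_hb_cont (G : Good Y p) (C : Circle' p w) {y : Y} (hy : dist p y = 1) :
    Continuous (fun t => hb p (w t) y) := by
  have : (fun t => hb p (w t) y) = (fun z => hb p y z) ∘ w := by
    ext t; exact G.hb_symm (C.unit t) hy
  rw [this]
  refine Continuous.comp ?_ (G.circle_cont C)
  refine LipschitzWith.continuous (K := 1) (LipschitzWith.of_dist_le_mul fun a b => ?_)
  rw [Real.dist_eq, NNReal.coe_one, one_mul]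
  exact G.hb_abs hy a b

theorem cright (G : Good Y p) (C : Circle' p w) {y : Y} (hy : dist p y = 1)
    (h1 : hb p (w 0) y = 1) (h2 : ∀ η > 0, ∃ θ, 0 < θ ∧ θ < η ∧ hb p (w θ) y ≠ 1) : y = w Real.pi := by
  have hpi := Real.pi_pos
  have hle1 : ∀ t z, dist p z = 1 → hb p (w t) z ≤ 1 := fun t z hz => by
    have := G.hb_le_norm (C.unit t) z
    rwa [hz] at this
  refine (G.eq_of_hb (C.unit _) hy ?_).symm
  refine le_of_forall_pos_le_add fun ε hε => ?_
  have hw : ∀ᶠ t in 𝓝 Real.pi, dist (w t) (w Real.pi) < ε / 2 :=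
    Metric.tendsto_nhds.1 ((G.circle_cont C).tendsto Real.pi) (ε / 2) (by positivity)
  have hcs : ∀ᶠ t in 𝓝 Real.pi, Real.cos t < -1 + ε / 2 := by
    have := Real.continuous_cos.tendsto Real.pi
    rw [Real.cos_pi] at this
    exact this.eventually (gt_mem_nhds (by linarith))
  obtain ⟨η, hη, hball⟩ := Metric.eventually_nhds_iff.1 (hw.and hcs)
  obtain ⟨θ, t0, t1, hθ⟩ := h2 (min η Real.pi) (lt_min hη hpi)
  have t2 := t1.trans_le (min_le_left _ _)
  have t3 := t1.trans_le (min_le_right _ _)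
  have hθ : hb p (w θ) y < 1 := lt_of_le_of_ne (hle1 _ _ hy) hθ
  have hu' := C.unit (θ + Real.pi)
  set φ := fun t => hb p (w t) y - hb p (w t) (w (θ + Real.pi)) with hφ
  have hc : Continuous φ := (G.circle_hb_cont C hy).sub (G.circle_hb_cont C hu')
  have v1 : 0 ≤ φ 0 := by
    simp only [hφ, h1]; linarith [hle1 0 _ hu']
  have v2 : φ θ < 0 := by
    simp only [hφ]
    rw [G.circle_cos C (by rw [add_sub_cancel_left, abs_of_pos hpi]), add_sub_cancel_left]
    rw [Real.cos_pi]; linarith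
  have v3 : 0 ≤ φ (θ + Real.pi) := by
    simp only [hφ]
    rw [G.hb_self hu']
    have := G.hb_ge_norm hu' y
    linarith
  obtain ⟨tb, htb, eb⟩ := intermediate_value_Icc' t0.le hc.continuousOn (show (0:ℝ) ∈ _ from ⟨v2.le, v1⟩)
  obtain ⟨ta, hta, ea⟩ := intermediate_value_Icc (show θ ≤ θ + Real.pi by linarith) hc.continuousOn
    (show (0:ℝ) ∈ _ from ⟨v2.le, v3⟩)
  have hne1 : tb ≠ θ := by rintro rfl; linarith
  have hne2 : ta ≠ θ := by rintro rfl; linarith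
  have l1 : tb < θ := lt_of_le_of_ne htb.2 hne1
  have l2 : θ < ta := lt_of_le_of_ne hta.1 hne2.symm
  have hge : Real.pi ≤ ta := by
    by_contra hcon
    push Not at hcon
    have := G.agree C hy hu' l1.le l2.le (l1.trans l2) (by linarith [htb.1]) (sub_eq_zero.1 eb) (sub_eq_zero.1 ea)
    have : φ θ = 0 := sub_eq_zero.2 this
    linarith
  have e2 : hb p (w ta) y = -Real.cos (θ + Real.pi - ta) := by
    rw [sub_eq_zero.1 ea]
    exact G.circle_cos C (by rw [abs_le]; constructor <;> linarith [hta.2])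
  have e3 : -Real.cos (θ + Real.pi - ta) = Real.cos (ta - θ) := by
    rw [← Real.cos_pi_sub]
    congr 1; ring
  have q1 := (hball (y := ta) (by rw [Real.dist_eq, abs_lt]; constructor <;> linarith [hta.2])).1
  have q2 := (hball (y := ta - θ) (by rw [Real.dist_eq, abs_lt]; constructor <;> linarith [hta.2])).2
  have q3 := G.hb_lip' (C.unit Real.pi) (C.unit ta) hy
  rw [dist_comm] at q3
  linarith

theorem cr2 (G : Good Y p) (C : Circle' p w) {y : Y} (hy : dist p y = 1) {b0 θ : ℝ} (hb0 : b0 ≤ θ)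
    (h1 : hb p (w b0) y = 1) (h2 : hb p (w θ) y ≠ 1) : ∃ b, b0 ≤ b ∧ b < θ ∧ y = w (b + Real.pi) := by
  set I := Set.Icc b0 θ ∩ {t | hb p (w t) y = 1} with hI
  have hIc : IsCompact I := isCompact_Icc.inter_right
    (isClosed_eq (G.circle_hb_cont C hy) continuous_const)
  have hIn : I.Nonempty := ⟨b0, ⟨le_rfl, hb0⟩, h1⟩
  have hbI := hIc.sSup_mem hIn
  have hlt : ∀ t, sSup I < t → t ≤ θ → hb p (w t) y ≠ 1 := fun t ht1 ht2 h => by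
    have := le_csSup hIc.bddAbove (show t ∈ I from ⟨⟨hbI.1.1.trans ht1.le, ht2⟩, h⟩)
    linarith
  set b := sSup I
  have hbne : b ≠ θ := by
    intro h; rw [← h] at h2; exact h2 hbI.2
  have hbθ : b < θ := lt_of_le_of_ne hbI.1.2 hbne
  refine ⟨b, hbI.1.1, hbθ, ?_⟩
  refine G.cright (C.shift b) hy ?_ ?_
  · rw [add_zero]; exact hbI.2
  · intro η hη
    refine ⟨min (η / 2) (θ - b), lt_min (by linarith) (by linarith), lt_of_le_of_lt (min_le_left _ _) (by linarith), ?_⟩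
    have h3 : 0 < min (η / 2) (θ - b) := lt_min (by linarith) (by linarith)
    have h4 := min_le_right (η / 2) (θ - b)
    exact hlt _ (by linarith) (by linarith)

theorem cl2 (G : Good Y p) (C : Circle' p w) {y : Y} (hy : dist p y = 1) {b0 θ : ℝ} (hb0 : θ ≤ b0)
    (h1 : hb p (w b0) y = 1) (h2 : hb p (w θ) y ≠ 1) : ∃ b, θ < b ∧ b ≤ b0 ∧ y = w (b - Real.pi) := by
  obtain ⟨b, e1, e2, e3⟩ := G.cr2 C.rev hy (b0 := -b0) (θ := -θ) (by linarith) (by rwa [neg_neg])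
    (by rwa [neg_neg])
  refine ⟨-b, by linarith, by linarith, ?_⟩
  rw [e3]; congr 1; ring

theorem per0 (G : Good Y p) (C : Circle' p w) : w (2 * Real.pi) = w 0 := by
  have hpi := Real.pi_gt_three
  have h0pi : hb p (w 0) (w Real.pi) = 1 := by
    rw [G.circle_cos C (by rw [sub_zero, abs_of_pos Real.pi_pos])]; simp
  by_contra hne
  have hA : ¬ ∀ η > 0, ∃ θ, 0 < θ ∧ θ < η ∧ hb p (w (Real.pi + θ)) (w 0) ≠ 1 := by
    intro h
    have := G.cright (C.shift Real.pi) (C.unit 0)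
      (by rw [add_zero, G.hb_symm (C.unit _) (C.unit _), h0pi]) h
    apply hne
    rw [this]; congr 1; ring
  push Not at hA
  obtain ⟨η, hη, hA⟩ := hA
  have hA : ∀ θ, 0 ≤ θ → θ < η → hb p (w 0) (w (Real.pi + θ)) = 1 := by
    intro θ h0 h1
    rcases h0.eq_or_lt with rfl | h0
    · rw [add_zero, h0pi]
    · rw [G.hb_symm (C.unit _) (C.unit _)]; exact hA θ h0 h1
  set ε := min η 1 / 3 with hε
  have m0 : 0 < min η 1 := lt_min hη one_pos
  have m1 := min_le_left η 1
  have m2 := min_le_right η 1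
  have ε0 : 0 < ε := by positivity
  obtain ⟨k, kp, k1, k2⟩ := G.iso2 (w 0) (w 0) (w Real.pi) (w (Real.pi + ε)) rfl
    (by rw [C.unit, C.unit]) (by
      rw [G.dist_two_of_hb (C.unit _) (C.unit _) h0pi,
        G.dist_two_of_hb (C.unit _) (C.unit _) (hA ε ε0.le (by linarith))])
  have hC := C.map G k kp
  have key : ∀ s, 0 ≤ s → s < η → |Real.pi + s - (Real.pi + ε)| = ε → w (Real.pi + s) = k (w (ε + Real.pi)) := by
    intro s s0 s1 hs
    have q : hb p (k (w Real.pi)) (w (Real.pi + s)) = -Real.cos ε := by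
      rw [k2, G.circle_cos C (by rw [hs]; linarith), ← Real.cos_abs, hs]
    have hcs : Real.cos ε ≠ -1 := by
      have := Real.cos_pos_of_mem_Ioo (x := ε) ⟨by linarith, by linarith⟩
      linarith
    obtain ⟨b, b0, b1, hb'⟩ := G.cr2 hC (C.unit (Real.pi + s)) (b0 := 0) (θ := Real.pi) (by linarith)
      (by rw [k1]; exact hA s s0 s1) (by
        rw [q]; intro h; apply hcs; linarith)
    have q2 : hb p (k (w Real.pi)) (w (Real.pi + s)) = -Real.cos b := by
      rw [hb', G.hb_iso k kp, G.circle_cos C (by rw [add_sub_cancel_right, abs_of_nonneg b0]; exact b1.le)]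
      congr 2; ring
    have : b = ε := Real.injOn_cos ⟨b0, b1.le⟩ ⟨ε0.le, by linarith⟩ (by linarith)
    rw [hb', this]
  have k3 := key 0 le_rfl hη (by rw [show Real.pi + 0 - (Real.pi + ε) = -ε by ring, abs_neg, abs_of_pos ε0])
  have k4 := key (2 * ε) (by linarith) (by linarith)
    (by rw [show Real.pi + 2 * ε - (Real.pi + ε) = ε by ring, abs_of_pos ε0])
  have k5 : hb p (w (Real.pi + 0)) (w (Real.pi + 2 * ε)) = -1 := by
    rw [k4, ← k3]; exact G.hb_self (C.unit _)
  rw [G.circle_cos C (by rw [show Real.pi + 2 * ε - (Real.pi + 0) = 2 * ε by ring, abs_of_pos (by linarith)]; linarith)] at k5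
  have : Real.cos (2 * ε) < Real.cos 0 :=
    Real.cos_lt_cos_of_nonneg_of_le_pi le_rfl (by linarith) (by linarith)
  rw [show Real.pi + 2 * ε - (Real.pi + 0) = 2 * ε by ring] at k5
  rw [Real.cos_zero] at this
  linarith

theorem per (G : Good Y p) (C : Circle' p w) : Function.Periodic w (2 * Real.pi) := by
  intro s
  have := G.per0 (C.shift s)
  rwa [add_zero] at this

theorem circle_cos' (G : Good Y p) (C : Circle' p w) (s t : ℝ) :
    hb p (w s) (w t) = -Real.cos (t - s) := by
  have hpi := Real.pi_pos
  set n := round ((t - s) / (2 * Real.pi))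
  have h := abs_sub_round ((t - s) / (2 * Real.pi))
  have h1 : w t = w (t - n * (2 * Real.pi)) := ((G.per C).sub_int_mul_eq n).symm
  have h2 : Real.cos (t - n * (2 * Real.pi) - s) = Real.cos (t - s) := by
    rw [show t - n * (2 * Real.pi) - s = t - s - n * (2 * Real.pi) by ring]
    exact Real.cos_sub_int_mul_two_pi _ n
  rw [h1, ← h2]
  apply G.circle_cos C
  have e : t - n * (2 * Real.pi) - s = ((t - s) / (2 * Real.pi) - n) * (2 * Real.pi) := by
    field_simp
    ring
  rw [e, abs_mul, abs_of_pos (show 0 < 2 * Real.pi by positivity)]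
  have := mul_le_mul_of_nonneg_right h (show 0 ≤ 2 * Real.pi by positivity)
  linarith

theorem anti_unique (G : Good Y p) (C : Circle' p w) {z : Y} (hz : dist p z = 1)
    (h : hb p (w 0) z = 1) : z = w Real.pi := by
  have hpi := Real.pi_pos
  by_cases hall : ∀ θ, 0 ≤ θ → θ ≤ Real.pi → hb p (w θ) z = 1
  · exfalso
    obtain ⟨k, kp, k1, k2⟩ := G.iso2 (w 0) (w 0) (w Real.pi) z rfl
      (by rw [C.unit, hz]) (by
        rw [G.dist_two_of_hb (C.unit _) hz h, G.dist_two_of_hb (C.unit _) (C.unit _)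
          (by rw [G.circle_cos' C]; simp)])
    have hC := C.map G k kp
    obtain ⟨b, b0, b1, hb'⟩ := G.cl2 hC (C.unit (Real.pi / 2)) (b0 := Real.pi) (θ := 0) hpi.le
      (by rw [k2, G.hb_symm hz (C.unit _)]; exact hall _ (by linarith) (by linarith))
      (by rw [k1, G.circle_cos' C, sub_zero, Real.cos_pi_div_two]; simp)
    have q1 : hb p (k (w 0)) (w (Real.pi / 2)) = 0 := by
      rw [k1, G.circle_cos' C, sub_zero, Real.cos_pi_div_two]; simp
    have q2 : hb p (k (w Real.pi)) (w (Real.pi / 2)) = 1 := by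
      rw [k2, G.hb_symm hz (C.unit _)]; exact hall _ (by linarith) (by linarith)
    rw [hb', G.hb_iso k kp, G.circle_cos' C, sub_zero, Real.cos_sub_pi] at q1
    rw [hb', G.hb_iso k kp, G.circle_cos' C, Real.cos_sub_pi, Real.cos_sub_pi] at q2
    linarith
  · push Not at hall
    obtain ⟨θ, t0, t1, hθ⟩ := hall
    obtain ⟨b, b0, b1, hb'⟩ := G.cr2 C hz t0 h hθ
    rw [hb', G.circle_cos' C, sub_zero, Real.cos_add_pi, neg_neg] at h
    have : b = 0 := Real.injOn_cos ⟨b0, by linarith⟩ ⟨le_rfl, hpi.le⟩ (by rw [h, Real.cos_zero])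
    rw [hb', this, zero_add]

theorem hb_p (G : Good Y p) {x : Y} (hx : dist p x = 1) : hb p x p = 0 := by
  have h1 := G.hb_ge_norm hx p
  have h2 := G.hb_le_norm hx p
  rw [dist_self] at h1 h2
  linarith

theorem antipode (G : Good Y p) (C : Circle' p w) {x : Y} (hx : dist p x = 1) :
    ∃ z, dist p z = 1 ∧ ∀ y, hb p z y = -hb p x y := by
  obtain ⟨g, gp, g1, -⟩ := G.on_circle C hx hx
  obtain ⟨v, Cv, hv⟩ : ∃ v : ℝ → Y, Circle' p v ∧ v 0 = x := ⟨_, C.map G g gp, g1⟩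
  subst hv
  refine ⟨v Real.pi, Cv.unit _, ?_⟩
  have h1 : ∀ y, dist p y = 1 → hb p (v Real.pi) y = -hb p (v 0) y := by
    intro y hy
    obtain ⟨k, kp, k1, θ, t0, t1, hk⟩ := G.on_circle Cv (Cv.unit 0) hy
    have kz : k (v Real.pi) = v Real.pi := by
      apply G.anti_unique Cv (by rw [iso_norm kp, Cv.unit])
      nth_rewrite 1 [← k1]
      rw [G.hb_iso k kp, G.circle_cos' Cv]; simp
    have e1 : hb p (v Real.pi) y = hb p (v Real.pi) (v θ) := by
      nth_rewrite 1 [← kz]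
      rw [← hk, G.hb_iso k kp]
    have e2 : hb p (v 0) y = hb p (v 0) (v θ) := by
      nth_rewrite 1 [← k1]
      rw [← hk, G.hb_iso k kp]
    rw [e1, e2, G.circle_cos' Cv, G.circle_cos' Cv, Real.cos_sub_pi, sub_zero]
  intro y
  rcases eq_or_ne y p with rfl | hy
  · rw [G.hb_p (Cv.unit _), G.hb_p (Cv.unit _), neg_zero]
  obtain ⟨q, hq, e⟩ := G.exists_dir hy
  rw [e, G.hb_Phi (Cv.unit _) dist_nonneg, G.hb_Phi (Cv.unit _) dist_nonneg, h1 q hq]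
  ring

end Good


namespace Good

variable {Y : Type u} [MetricSpace Y] {p : Y}

theorem isGeodesicSpace_of (h : ∀ x y : Y, ∃ q : ℝ → Y, q 0 = x ∧ q 1 = y ∧
    ∀ s ∈ Set.Icc (0:ℝ) 1, ∀ t ∈ Set.Icc (0:ℝ) 1, dist (q s) (q t) = |s - t| * dist x y) :
    IsGeodesicSpace Y := by
  intro x y
  obtain ⟨q, q0, q1, hq⟩ := h x y
  rcases eq_or_ne x y with rfl | hxy
  · refine ⟨_, fun _ => x, ?_, rfl, rfl, rfl⟩
    intro a ha b hb
    rw [dist_self] at ha hb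
    have h1 : a = 0 := le_antisymm ha.2 ha.1
    have h2 : b = 0 := le_antisymm hb.2 hb.1
    subst h1; subst h2; simp
  · have hd : 0 < dist x y := dist_pos.2 hxy
    refine ⟨_, fun a => q (a / dist x y), ?_, rfl, ?_, ?_⟩
    · intro a ha b hb
      rw [hq _ ⟨div_nonneg ha.1 hd.le, (div_le_one hd).2 ha.2⟩ _ ⟨div_nonneg hb.1 hd.le, (div_le_one hd).2 hb.2⟩,
        ← sub_div, abs_div, abs_of_pos hd]
      field_simp
    · simp [q0]
    · simp [div_self hd.ne', q1]

/-- Every direction has an antipodal direction. -/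
def Anti (p : Y) : Prop := ∀ x : Y, dist p x = 1 → ∃ z, dist p z = 1 ∧ ∀ y, hb p z y = -hb p x y

theorem hb_aff (G : Good Y p) (AP : Anti p) {x a b q : Y} {t : ℝ} (hx : dist p x = 1)
    (h0 : dist a q = t * dist a b) (h1 : dist q b = (1 - t) * dist a b) :
    hb p x q = (1 - t) * hb p x a + t * hb p x b := by
  obtain ⟨z, hz, e⟩ := AP x hx
  have h2 := G.hb_conv hx h0 h1
  have h3 := G.hb_conv hz h0 h1
  rw [e, e, e] at h3
  linarith

theorem hneg (G : Good Y p) (AP : Anti p) (y : Y) : ∃ y', ∀ x, dist p x = 1 → hb p x y' = -hb p x y := by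
  rcases eq_or_ne y p with rfl | hy
  · exact ⟨y, fun x hx => by rw [G.hb_p hx, neg_zero]⟩
  obtain ⟨v, hv, e⟩ := G.exists_dir hy
  obtain ⟨z, hz, e'⟩ := AP v hv
  refine ⟨Phi p (dist p y) z, fun x hx => ?_⟩
  rw [G.hb_Phi hx dist_nonneg, G.hb_symm hx hz, e', G.hb_symm hv hx]
  conv_rhs => rw [e, G.hb_Phi hx dist_nonneg]
  ring

theorem hmax (G : Good Y p) (AP : Anti p) {e : Y} (he : dist p e = 1) (y : Y) :
    ∃ x, dist p x = 1 ∧ hb p x y = dist p y := by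
  rcases eq_or_ne y p with rfl | hy
  · exact ⟨e, he, by rw [G.hb_p he, dist_self]⟩
  obtain ⟨v, hv, e⟩ := G.exists_dir hy
  obtain ⟨z, hz, e'⟩ := AP v hv
  refine ⟨z, hz, ?_⟩
  rw [e']
  nth_rewrite 1 [e]
  rw [G.hb_Phi hv dist_nonneg, G.hb_self hv]; ring

theorem hinj_le (G : Good Y p) {y y' : Y} (h : ∀ x, dist p x = 1 → hb p x y = hb p x y') :
    dist p y ≤ dist p y' := by
  rcases eq_or_ne y p with rfl | hy
  · rw [dist_self]; exact dist_nonneg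
  obtain ⟨v, hv, e⟩ := G.exists_dir hy
  have h1 := h v hv
  have h2 := G.hb_ge_norm hv y'
  have h3 : hb p v y = dist p y * -1 := by
    nth_rewrite 1 [e]
    rw [G.hb_Phi hv dist_nonneg, G.hb_self hv]
  linarith

theorem hinj (G : Good Y p) {y y' : Y} (h : ∀ x, dist p x = 1 → hb p x y = hb p x y') : y = y' := by
  have hn : dist p y = dist p y' := le_antisymm (G.hinj_le h) (G.hinj_le fun x hx => (h x hx).symm)
  rcases eq_or_ne y p with rfl | hy
  · rw [dist_self] at hn; exact dist_eq_zero.1 hn.symm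
  have hy' : y' ≠ p := by
    rintro rfl; rw [dist_self] at hn; exact hy (dist_eq_zero.1 hn).symm
  obtain ⟨v, hv, e⟩ := G.exists_dir hy
  obtain ⟨v', hv', e'⟩ := G.exists_dir hy'
  have h1 := h v hv
  have pos : 0 < dist p y := dist_pos.2 hy.symm
  rw [e, e', G.hb_Phi hv dist_nonneg, G.hb_Phi hv dist_nonneg, G.hb_self hv, ← hn] at h1
  have h2 : hb p v v' = -1 := by
    have := mul_left_cancel₀ pos.ne' h1
    exact this.symm
  have h3 := G.eq_of_hb hv hv' h2.le
  rw [e, e', h3, hn]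

theorem hcomb (G : Good Y p) (AP : Anti p) (a b : Y) {s t : ℝ} (s0 : 0 ≤ s) (t0 : 0 ≤ t) :
    ∃ q, ∀ x, dist p x = 1 → hb p x q = s * hb p x a + t * hb p x b := by
  obtain ⟨m, m1, m2⟩ := G.mid (Phi p s a) (Phi p t b)
  refine ⟨Phi p 2 m, fun x hx => ?_⟩
  rw [G.hb_Phi hx two_pos.le, G.hb_aff AP (t := 1/2) hx (m1.trans (by ring)) (m2.trans (by ring)),
    G.hb_Phi hx s0, G.hb_Phi hx t0]
  ring

theorem hseq (G : Good Y p) (AP : Anti p) (y y' : Y) (n : ℕ) : ∃ u, dist y' u = 2 ^ n * dist y' y ∧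
    ∀ x, dist p x = 1 → hb p x u = 2 ^ n * (hb p x y - hb p x y') + hb p x y' := by
  induction n with
  | zero => exact ⟨y, by simp, fun x _ => by ring⟩
  | succ n ih =>
    obtain ⟨u, hu, h⟩ := ih
    obtain ⟨z, hz⟩ := G.hneg AP y'
    obtain ⟨u', hu'⟩ := G.hcomb AP u z (s := 2) (t := 1) (by norm_num) (by norm_num)
    have key : ∀ x, dist p x = 1 → hb p x u' = 2 * hb p x u - hb p x y' := fun x hx => by
      rw [hu' x hx, hz x hx]; ring
    refine ⟨u', ?_, fun x hx => by rw [key x hx, h x hx]; ring⟩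
    obtain ⟨m, m1, m2⟩ := G.mid y' u'
    have : m = u := G.hinj fun x hx => by
      rw [G.hb_aff AP (t := 1/2) hx (m1.trans (by ring)) (m2.trans (by ring)), key x hx]
      ring
    subst this
    have : dist y' u' = 2 * dist y' m := by rw [m1]; ring
    rw [this, hu]; ring

theorem hsup (G : Good Y p) (AP : Anti p) {e : Y} (he : dist p e = 1) (y y' : Y) {ε : ℝ} (hε : 0 < ε) :
    ∃ x, dist p x = 1 ∧ dist y y' - ε ≤ hb p x y - hb p x y' := by
  obtain ⟨n, hn⟩ := pow_unbounded_of_one_lt (2 * dist p y' / ε) (one_lt_two : (1:ℝ) < 2)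
  obtain ⟨u, hu, h⟩ := G.hseq AP y y' n
  obtain ⟨x, hx, e⟩ := G.hmax AP he u
  refine ⟨x, hx, ?_⟩
  have h1 := h x hx
  rw [e] at h1
  have h2 := G.hb_le_norm hx y'
  have h3 := dist_triangle_left y' u p
  rw [hu] at h3
  rw [div_lt_iff₀ hε] at hn
  have h4 : (2:ℝ) ^ n * (dist y' y - ε) ≤ 2 ^ n * (hb p x y - hb p x y') := by linarith
  have := le_of_mul_le_mul_left h4 (by positivity)
  rwa [dist_comm y y']

theorem flat_geod (G : Good Y p) (AP : Anti p) {e : Y} (he : dist p e = 1) : IsGeodesicSpace Y := by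
  apply isGeodesicSpace_of
  intro a b
  have : ∀ t : ℝ, ∃ q, t ∈ Set.Icc (0:ℝ) 1 →
      ∀ x, dist p x = 1 → hb p x q = (1 - t) * hb p x a + t * hb p x b := by
    intro t
    by_cases ht : t ∈ Set.Icc (0:ℝ) 1
    · obtain ⟨q, hq⟩ := G.hcomb AP a b (s := 1 - t) (t := t) (by linarith [ht.2]) ht.1
      exact ⟨q, fun _ => hq⟩
    · exact ⟨a, fun h => absurd h ht⟩
  choose q hq using this
  refine ⟨q, G.hinj fun x hx => by rw [hq 0 (by simp) x hx]; ring,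
    G.hinj fun x hx => by rw [hq 1 (by simp) x hx]; ring, ?_⟩
  intro s hs t ht
  have key : ∀ x, dist p x = 1 → hb p x (q s) - hb p x (q t) = (s - t) * (hb p x b - hb p x a) := by
    intro x hx
    rw [hq s hs x hx, hq t ht x hx]; ring
  apply le_antisymm
  · apply le_of_forall_pos_le_add
    intro ε hε
    obtain ⟨x, hx, h⟩ := G.hsup AP he (q s) (q t) hε
    rw [key x hx] at h
    have h1 := le_abs_self ((s - t) * (hb p x b - hb p x a))
    rw [abs_mul] at h1
    have h2 : |hb p x b - hb p x a| ≤ dist a b := by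
      rw [abs_le]
      have e1 := G.hb_lip hx a b
      have e2 := G.hb_lip hx b a
      rw [dist_comm b a] at e2
      constructor <;> linarith
    have := mul_le_mul_of_nonneg_left h2 (abs_nonneg (s - t))
    linarith
  · apply le_of_forall_pos_le_add
    intro ε hε
    obtain ⟨x, hx, h⟩ := G.hsup AP he b a hε
    have h2 : |hb p x (q s) - hb p x (q t)| ≤ dist (q s) (q t) := by
      rw [abs_le]
      have e1 := G.hb_lip hx (q s) (q t)
      have e2 := G.hb_lip hx (q t) (q s)
      rw [dist_comm (q t)] at e2
      constructor <;> linarith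
    rw [key x hx, abs_mul] at h2
    have h3 := mul_le_mul_of_nonneg_left (le_abs_self (hb p x b - hb p x a)) (abs_nonneg (s - t))
    have h4 := mul_le_mul_of_nonneg_left h (abs_nonneg (s - t))
    have h5 : |s - t| ≤ 1 := by rw [abs_le]; constructor <;> linarith [hs.1, hs.2, ht.1, ht.2]
    rw [dist_comm b a] at h4
    nlinarith

theorem affgeo {γ : ℝ → Y} {a b : ℝ} (h : IsAffineGeodesic γ a b) {s t α β : ℝ}
    (hs : s ∈ Set.Icc a b) (ht : t ∈ Set.Icc a b) (h0 : 0 ≤ α) (h1 : 0 ≤ β) (hab : α + β = 1) :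
    dist (γ s) (γ (α * s + β * t)) = β * dist (γ s) (γ t) ∧
    dist (γ (α * s + β * t)) (γ t) = (1 - β) * dist (γ s) (γ t) := by
  obtain ⟨lam, l0, h⟩ := h
  have hm : α * s + β * t ∈ Set.Icc a b := by
    have := convex_Icc a b hs ht h0 h1 hab
    simpa using this
  obtain rfl : α = 1 - β := by linarith
  rw [h _ hs _ hm, h _ hm _ ht, h _ hs _ ht, show s - ((1 - β) * s + β * t) = β * (s - t) by ring,
    show (1 - β) * s + β * t - t = (1 - β) * (s - t) by ring, abs_mul, abs_mul, abs_of_nonneg h0,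
    abs_of_nonneg h1]
  constructor <;> ring

theorem flat_bus (G : Good Y p) (AP : Anti p) {e : Y} (he : dist p e = 1) : BusemannConvex Y := by
  intro a b a' b' γ γ' hγ hγ'
  refine ⟨(convex_Icc a b).prod (convex_Icc a' b'), ?_⟩
  rintro ⟨s, s'⟩ ⟨hs, hs'⟩ ⟨t, t'⟩ ⟨ht, ht'⟩ α β h0 h1 hab
  simp only [Prod.smul_mk, Prod.mk_add_mk, smul_eq_mul] at *
  apply le_of_forall_pos_le_add
  intro ε hε
  obtain ⟨x, hx, h⟩ := G.hsup AP he (γ (α * s + β * t)) (γ' (α * s' + β * t')) hε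
  obtain ⟨e1, e2⟩ := affgeo hγ hs ht h0 h1 hab
  obtain ⟨e3, e4⟩ := affgeo hγ' hs' ht' h0 h1 hab
  rw [G.hb_aff AP hx e1 e2, G.hb_aff AP hx e3 e4] at h
  have q1 := mul_le_mul_of_nonneg_left (G.hb_lip hx (γ s) (γ' s')) h0
  have q2 := mul_le_mul_of_nonneg_left (G.hb_lip hx (γ t) (γ' t')) h1
  obtain rfl : α = 1 - β := by linarith
  linarith

/-! ### Star case -/

theorem ultra4 {xy zw xz yw xw yz : ℝ} (h1 : min xz yz ≤ xy) (h2 : min xw yw ≤ xy)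
    (h3 : min xz xw ≤ zw) (h4 : min yz yw ≤ zw) : min (xz + yw) (xw + yz) ≤ xy + zw := by
  simp only [min_le_iff] at *
  rcases le_total xz yz with a | a <;> rcases le_total xw yw with b | b <;>
  rcases le_total xz xw with c | c <;> rcases le_total yz yw with d | d <;>
  rcases h1 with h1 | h1 <;> rcases h2 with h2 | h2 <;> rcases h3 with h3 | h3 <;>
  rcases h4 with h4 | h4 <;> first | (left; linarith) | (right; linarith)

theorem hyp_T (H : ∀ x y z w : Y, dist x y + dist z w ≤ max (dist x z + dist y w) (dist x w + dist y z))
    {a b c q r : Y} {β : ℝ} (b0 : 0 ≤ β) (b1 : β ≤ 1) (hq : dist a q = β * dist a b)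
    (hq' : dist q b = (1 - β) * dist a b) (hr : dist a r = β * dist a c)
    (hr' : dist r c = (1 - β) * dist a c) : dist q r ≤ β * dist b c := by
  have h4 := H q r a c
  have h6 := H q c a b
  have t2 := dist_triangle a c b
  have t1 := dist_triangle a b c
  have t3 := dist_triangle b a c
  rw [dist_comm q a, dist_comm r a] at h4
  rw [dist_comm q a, dist_comm c a, dist_comm c b] at h6
  rw [dist_comm c b] at t2
  rw [dist_comm b a] at t3
  have m1 := mul_le_mul_of_nonneg_left t1 b0
  have m2 := mul_le_mul_of_nonneg_left t2 b0
  have m3 := mul_le_mul_of_nonneg_left t3 (sub_nonneg.2 b1)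
  rcases le_max_iff.1 h4 with h4 | h4
  · linarith
  · rcases le_max_iff.1 h6 with h6 | h6 <;> linarith

theorem bus_of_hyp (G : Good Y p)
    (H : ∀ x y z w : Y, dist x y + dist z w ≤ max (dist x z + dist y w) (dist x w + dist y z)) :
    BusemannConvex Y := by
  intro a b a' b' γ γ' hγ hγ'
  refine ⟨(convex_Icc a b).prod (convex_Icc a' b'), ?_⟩
  rintro ⟨s, s'⟩ ⟨hs, hs'⟩ ⟨t, t'⟩ ⟨ht, ht'⟩ α β h0 h1 hab
  simp only [Prod.smul_mk, Prod.mk_add_mk, smul_eq_mul] at *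
  obtain ⟨e1, e2⟩ := affgeo hγ hs ht h0 h1 hab
  obtain ⟨e3, e4⟩ := affgeo hγ' hs' ht' h0 h1 hab
  have hb1 : β ≤ 1 := by linarith
  obtain ⟨r, r1, r2⟩ := G.exists_between (γ s) (γ' t') β h1 hb1
  have k1 := hyp_T H h1 hb1 e1 e2 r1 r2
  have k2 := hyp_T H (β := 1 - β) (a := γ' t') (b := γ s) (c := γ' s') (q := r)
    (r := γ' (α * s' + β * t')) (by linarith) (by linarith)
    (by rw [dist_comm, r2, dist_comm (γ s)]) (by rw [dist_comm, r1, dist_comm (γ s)]; ring)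
    (by rw [dist_comm, e4, dist_comm (γ' s')]) (by rw [dist_comm, e3, dist_comm (γ' s')]; ring)
  obtain rfl : α = 1 - β := by linarith
  have := dist_triangle (γ ((1 - β) * s + β * t)) r (γ' ((1 - β) * s' + β * t'))
  linarith

theorem star (G : Good Y p) (hS : ∀ u v : Y, dist p u = 1 → dist p v = 1 → u ≠ v → 2 ≤ dist u v) :
    IsGeodesicSpace Y ∧ BusemannConvex Y := by
  by_cases he : ∃ e : Y, dist p e = 1
  swap
  · have hp : ∀ y : Y, y = p := by
      intro y
      by_contra hy
      obtain ⟨v, hv, -⟩ := G.exists_dir hy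
      exact he ⟨v, hv⟩
    constructor
    · apply isGeodesicSpace_of
      intro x y
      refine ⟨fun _ => p, (hp x).symm, (hp y).symm, ?_⟩
      intro s _ t _
      rw [hp x, hp y]; simp
    · apply G.bus_of_hyp
      intro x y z w
      rw [hp x, hp y, hp z, hp w]; simp
  obtain ⟨e, he⟩ := he
  have hd : ∀ y : Y, ∃ v, dist p v = 1 ∧ y = Phi p (dist p y) v := by
    intro y
    rcases eq_or_ne y p with rfl | hy
    · exact ⟨e, he, by rw [dist_self, G.Phi_zero]⟩
    · exact G.exists_dir hy
  have hP : ∀ u v : Y, dist p u = 1 → dist p v = 1 → u ≠ v → ∀ s t : ℝ, 0 ≤ s → 0 ≤ t →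
      dist (Phi p s u) (Phi p t v) = s + t := by
    intro u v hu hv huv s t s0 t0
    have h2 : dist u v = 2 := by
      refine le_antisymm ?_ (hS u v hu hv huv)
      have := dist_triangle_left u v p
      linarith
    have h3 := G.hb_of_dist_two hu hv h2
    have h4 := G.hb_le hu (Phi p t v) s0
    rw [G.hb_Phi hu t0, h3] at h4
    have h5 := dist_triangle_left (Phi p s u) (Phi p t v) p
    rw [G.Phi_norm s0, G.Phi_norm t0, hu, hv] at h5
    linarith
  choose dir hdir1 hdir using hd
  have dsame : ∀ x y : Y, dir x = dir y → dist x y = |dist p x - dist p y| := by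
    intro x y h
    have := G.Phi_dist (s := dist p x) (t := dist p y) dist_nonneg dist_nonneg (dir x)
    nth_rewrite 2 [h] at this
    rwa [← hdir, ← hdir, hdir1, mul_one] at this
  have ddiff : ∀ x y : Y, dir x ≠ dir y → dist x y = dist p x + dist p y := by
    intro x y h
    have := hP _ _ (hdir1 x) (hdir1 y) h (dist p x) (dist p y) dist_nonneg dist_nonneg
    rwa [← hdir, ← hdir] at this
  constructor
  · apply isGeodesicSpace_of
    intro x y
    by_cases h : dir x = dir y
    · refine ⟨fun t => Phi p ((1 - t) * dist p x + t * dist p y) (dir x), ?_, ?_, ?_⟩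
      · simp only [sub_zero, one_mul, zero_mul, add_zero]; exact (hdir x).symm
      · simp only [sub_self, one_mul, zero_mul, zero_add]; rw [h]; exact (hdir y).symm
      · intro s hs t ht
        have a1 : 0 ≤ 1 - s := by linarith [hs.2]
        have a2 : 0 ≤ 1 - t := by linarith [ht.2]
        have a3 := hs.1
        have a4 := ht.1
        rw [G.Phi_dist (by positivity) (by positivity), hdir1, mul_one, dsame x y h, ← abs_mul,
          ← abs_neg]
        congr 1; ring
    · set c : ℝ → Y := fun s => if 0 ≤ s then Phi p s (dir x) else Phi p (-s) (dir y) with hc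
      have hcd : ∀ s t, dist (c s) (c t) = |s - t| := by
        intro s t
        simp only [hc]
        split_ifs with h1 h2 h2
        · rw [G.Phi_dist h1 h2, hdir1, mul_one]
        · rw [hP _ _ (hdir1 x) (hdir1 y) h _ _ h1 (by linarith), abs_of_nonneg (by linarith)]; ring
        · rw [dist_comm, hP _ _ (hdir1 x) (hdir1 y) h _ _ h2 (by linarith), abs_of_nonpos (by linarith)]; ring
        · rw [G.Phi_dist (by linarith) (by linarith), hdir1, mul_one, ← abs_neg]
          congr 1; ring
      refine ⟨fun t => c ((1 - t) * dist p x - t * dist p y), ?_, ?_, ?_⟩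
      · simp only [sub_zero, one_mul, zero_mul, hc, if_pos (dist_nonneg)]; exact (hdir x).symm
      · simp only [sub_self, one_mul, zero_mul, zero_sub, hc]
        split_ifs with h1
        · have h2 : dist p y = 0 := le_antisymm (by linarith) dist_nonneg
          rw [h2, neg_zero, G.Phi_zero]; exact dist_eq_zero.1 h2
        · rw [neg_neg]; exact (hdir y).symm
      · intro s hs t ht
        rw [hcd, ddiff x y h, ← abs_of_nonneg (add_nonneg (dist_nonneg (x := p) (y := x)) (dist_nonneg (x := p) (y := y))),
          ← abs_mul, ← abs_neg]
        congr 1; ring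
  · apply G.bus_of_hyp
    have ult : ∀ x y z : Y, min (dist p x + dist p y - dist x y) (dist p y + dist p z - dist y z) ≤
        dist p x + dist p z - dist x z := by
      intro x y z
      have t1 := dist_triangle_left x z p
      by_cases h1 : dir x = dir y
      · by_cases h2 : dir y = dir z
        · rw [dsame x y h1, dsame y z h2, dsame x z (h1.trans h2)]
          simp only [min_le_iff]
          rcases abs_cases (dist p x - dist p y) with ⟨a, _⟩ | ⟨a, _⟩ <;>
          rcases abs_cases (dist p y - dist p z) with ⟨b, _⟩ | ⟨b, _⟩ <;>
          rcases abs_cases (dist p x - dist p z) with ⟨c, _⟩ | ⟨c, _⟩ <;>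
          rw [a, b, c] <;> first | (left; linarith) | (right; linarith)
        · apply min_le_of_right_le
          rw [ddiff y z h2]; linarith
      · apply min_le_of_left_le
        rw [ddiff x y h1]; linarith
    intro x y z w
    have u1 := ult x z y
    have u2 := ult x w y
    have u3 := ult z x w
    have u4 := ult z y w
    rw [dist_comm z y] at u1
    rw [dist_comm w y] at u2
    rw [dist_comm z x] at u3
    rw [dist_comm z y] at u4
    have := ultra4 (xy := dist p x + dist p y - dist x y) (zw := dist p z + dist p w - dist z w)
      (xz := dist p x + dist p z - dist x z) (yw := dist p y + dist p w - dist y w)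
      (xw := dist p x + dist p w - dist x w) (yz := dist p y + dist p z - dist y z)
      (by convert u1 using 2; ring) (by convert u2 using 2; ring) (by convert u3 using 2; ring)
      (by convert u4 using 2; ring)
    rcases min_le_iff.1 this with h | h
    · apply le_max_of_le_left; linarith
    · apply le_max_of_le_right; linarith

theorem main (G : Good Y p) : IsGeodesicSpace Y ∧ BusemannConvex Y := by
  by_cases h : ∀ u v : Y, dist p u = 1 → dist p v = 1 → u ≠ v → 2 ≤ dist u v
  · exact G.star h
  · push Not at h
    obtain ⟨u, v, hu, hv, hne, hlt⟩ := h
    obtain ⟨w, C⟩ := G.exists_circle hu hv hne hlt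
    have AP : Anti p := fun x hx => G.antipode C hx
    exact ⟨G.flat_geod AP hu, G.flat_bus AP hu⟩

end Good


namespace PT

variable {X : Type u} [MetricSpace X] {p : X}

/-- Every pretangent space is separable and tangent. -/
def HST (p : X) : Prop :=
  ∀ (r : ℕ → ℝ) (F : Set (ℕ → X)) (Ω : Type u) [MetricSpace Ω]
      (π : (ℕ → X) → Ω), IsPretangentSpace p r F π →
      TopologicalSpace.SeparableSpace Ω ∧ IsTangentFamily p r F

theorem exists_maximal {r : ℕ → ℝ} {F0 : Set (ℕ → X)} (h : SelfStable r F0)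
    (hp : (fun _ => p) ∈ F0) : ∃ F, F0 ⊆ F ∧ MaximalSelfStable p r F := by
  obtain ⟨F, hF, hm⟩ := zorn_subset_nonempty {F : Set (ℕ → X) | SelfStable r F} (by
    intro c hc hch hne
    refine ⟨⋃₀ c, ?_, fun s hs => Set.subset_sUnion_of_mem hs⟩
    rintro x ⟨s, hs, hx⟩ y ⟨t, ht, hy⟩
    rcases hch.total hs ht with hst | hst
    · exact hc ht x (hst hx) y hy
    · exact hc hs x hx y (hst hy)) F0 h
  refine ⟨F, hF, hm.prop, hF hp, ?_⟩
  intro G hG hFG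
  exact Set.Subset.antisymm (hm.le_of_ge hG hFG) hFG

/-- A type synonym for a family of sequences. -/
def Fam (F : Set (ℕ → X)) : Type u := {x // x ∈ F}

/-- The limit pseudometric on a self-stable family. -/
noncomputable def pseudo {r : ℕ → ℝ} (hr : ∀ n, 0 < r n) (F : Set (ℕ → X)) (h : SelfStable r F) :
    PseudoMetricSpace (Fam F) where
  dist x y := (h x.1 x.2 y.1 y.2).choose
  dist_self x := by
    refine tendsto_nhds_unique (h x.1 x.2 x.1 x.2).choose_spec ?_
    simp
  dist_comm x y := by
    refine tendsto_nhds_unique (h x.1 x.2 y.1 y.2).choose_spec ?_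
    simpa only [dist_comm] using (h y.1 y.2 x.1 x.2).choose_spec
  dist_triangle x y z := by
    refine le_of_tendsto_of_tendsto' (h x.1 x.2 z.1 z.2).choose_spec
      ((h x.1 x.2 y.1 y.2).choose_spec.add (h y.1 y.2 z.1 z.2).choose_spec) fun n => ?_
    rw [← add_div]
    exact div_le_div_of_nonneg_right (dist_triangle _ _ _) (hr n).le

theorem realize {r : ℕ → ℝ} (hr : IsNormalizingSeq r) {F : Set (ℕ → X)}
    (h : MaximalSelfStable p r F) :
    ∃ (Ω : Type u) (_ : MetricSpace Ω) (π : (ℕ → X) → Ω), IsPretangentSpace p r F π := by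
  letI := pseudo hr.1 F h.1
  classical
  refine ⟨SeparationQuotient (Fam F), inferInstance,
    fun x => if hx : x ∈ F then SeparationQuotient.mk (⟨x, hx⟩ : Fam F) else SeparationQuotient.mk (⟨_, h.2.1⟩ : Fam F),
    hr, h, ?_, ?_⟩
  · intro ω
    obtain ⟨⟨x, hx⟩, rfl⟩ := SeparationQuotient.surjective_mk ω
    exact ⟨x, hx, by simp [hx]⟩
  · intro x hx y hy
    simp only [hx, hy, dif_pos, SeparationQuotient.dist_mk]
    exact (h.1 x hx y hy).choose_spec

theorem HST.tangent (H : HST p) {r : ℕ → ℝ} (hr : IsNormalizingSeq r) {F : Set (ℕ → X)}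
    (h : MaximalSelfStable p r F) : IsTangentFamily p r F := by
  obtain ⟨Ω, _, π, hπ⟩ := realize hr h
  exact (H r F Ω π hπ).2

variable {r : ℕ → ℝ} {F : Set (ℕ → X)} {Ω : Type u} [MetricSpace Ω] {π : (ℕ → X) → Ω}

/-- Points of a pretangent space with a countable dense lifted family. -/
theorem dense_lift (H : HST p) (P : IsPretangentSpace p r F π) :
    ∃ w : ℕ → ℕ → X, (∀ i, w i ∈ F) ∧ ∀ ω : Ω, ∀ ε > 0, ∃ i, dist (π (w i)) ω < ε := by
  have := (H r F Ω π P).1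
  have : Nonempty Ω := ⟨π fun _ => p⟩
  choose l hl hl' using P.2.2.1
  refine ⟨fun i => l (TopologicalSpace.denseSeq Ω i), fun i => hl _, ?_⟩
  intro ω ε hε
  obtain ⟨_, hi, ⟨i, rfl⟩⟩ := Metric.dense_iff.1 (TopologicalSpace.denseRange_denseSeq Ω) ω ε hε
  exact ⟨i, by rw [hl']; exact hi⟩

theorem bdd (P : IsPretangentSpace p r F π) {x : ℕ → X} (hx : x ∈ F) :
    ∃ B, ∀ n, dist (x n) p ≤ B * r n := by
  obtain ⟨B, hB⟩ := (P.2.2.2 x hx _ P.2.1.2.1).bddAbove_range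
  refine ⟨B, fun n => ?_⟩
  rw [← div_le_iff₀ (P.1.1 n)]
  exact hB ⟨n, rfl⟩

theorem stab (H : HST p) (P : IsPretangentSpace p r F π) {y : ℕ → X} {C : ℝ}
    (hy : ∀ n, dist (y n) p ≤ C * r n) {φ : ℕ → ℕ} (hφ : StrictMono φ) :
    ∃ ψ : ℕ → ℕ, StrictMono ψ ∧ ∀ x ∈ F,
      MutuallyStable (r ∘ φ ∘ ψ) (y ∘ φ ∘ ψ) (x ∘ φ ∘ ψ) := by
  obtain ⟨w, hw, hd⟩ := dense_lift H P
  choose B hB using fun i => bdd P (hw i)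
  have hr := P.1.1
  have hK : IsCompact (Set.pi Set.univ fun i => Set.Icc (0:ℝ) (C + B i)) :=
    isCompact_univ_pi fun i => isCompact_Icc
  obtain ⟨L, -, ψ, hψ, hL⟩ := hK.tendsto_subseq
    (x := fun n i => dist (y (φ n)) (w i (φ n)) / r (φ n)) (by
      intro n i _
      refine ⟨div_nonneg dist_nonneg (hr _).le, ?_⟩
      rw [div_le_iff₀ (hr _)]
      have := dist_triangle_right (y (φ n)) (w i (φ n)) p
      linarith [hy (φ n), hB i (φ n)])
  rw [tendsto_pi_nhds] at hL
  refine ⟨ψ, hψ, fun x hx => ?_⟩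
  have hθ : Tendsto (φ ∘ ψ) atTop atTop := (hφ.comp hψ).tendsto_atTop
  apply cauchySeq_tendsto_of_complete
  rw [Metric.cauchySeq_iff]
  intro ε hε
  obtain ⟨i, hi⟩ := hd (π x) (ε / 5) (by positivity)
  have h1 : ∀ᶠ k in atTop, dist (w i (φ (ψ k))) (x (φ (ψ k))) / r (φ (ψ k)) < ε / 5 :=
    hθ.eventually ((P.2.2.2 _ (hw i) x hx).eventually (gt_mem_nhds hi))
  have h2 := (Metric.tendsto_nhds.1 (hL i)) (ε / 5) (by positivity)
  obtain ⟨N, hN⟩ := eventually_atTop.1 (h1.and h2)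
  have key : ∀ n ≥ N, |dist (y (φ (ψ n))) (x (φ (ψ n))) / r (φ (ψ n)) - L i| < 2 * (ε / 5) := by
    intro n hn
    obtain ⟨a1, a2⟩ := hN n hn
    simp only [Function.comp, Real.dist_eq] at a2
    have hrn := hr (φ (ψ n))
    have : |dist (y (φ (ψ n))) (x (φ (ψ n))) / r (φ (ψ n)) -
        dist (y (φ (ψ n))) (w i (φ (ψ n))) / r (φ (ψ n))| ≤
        dist (w i (φ (ψ n))) (x (φ (ψ n))) / r (φ (ψ n)) := by
      rw [← sub_div, abs_div, abs_of_pos hrn]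
      apply div_le_div_of_nonneg_right _ hrn.le
      rw [dist_comm (y (φ (ψ n))), dist_comm (y (φ (ψ n))), dist_comm (w i (φ (ψ n))) (x _)]
      exact abs_dist_sub_le _ _ _
    calc _ ≤ _ := abs_sub_le _ (dist (y (φ (ψ n))) (w i (φ (ψ n))) / r (φ (ψ n))) _
      _ < _ := by linarith
  refine ⟨N, fun m hm n hn => ?_⟩
  have k1 := abs_lt.1 (key m hm)
  have k2 := abs_lt.1 (key n hn)
  simp only [Function.comp, Real.dist_eq]
  rw [abs_lt]
  constructor <;> linarith [k1.1, k1.2, k2.1, k2.2]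

theorem UL (H : HST p) (P : IsPretangentSpace p r F π) (U : Ultrafilter ℕ) (hU : (U : Filter ℕ) ≤ atTop)
    {y : ℕ → X} {C : ℝ} (hy : ∀ n, dist (y n) p ≤ C * r n) :
    ∃ x ∈ F, Tendsto (fun n => dist (y n) (x n) / r n) U (𝓝 0) := by
  by_contra hcon
  push Not at hcon
  have hr := P.1.1
  have h1 : ∀ x ∈ F, ∃ ε > 0, ∀ᶠ n in U, ε ≤ dist (y n) (x n) / r n := by
    intro x hx
    have := hcon x hx
    rw [Metric.tendsto_nhds] at this
    push Not at this
    obtain ⟨ε, hε, h⟩ := this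
    refine ⟨ε, hε, ?_⟩
    filter_upwards [h] with n hn
    rwa [Real.dist_eq, sub_zero, abs_of_nonneg (div_nonneg dist_nonneg (hr n).le)] at hn
  choose l hl hl' using P.2.2.1
  choose ε hε hεU using fun ω => h1 (l ω) (hl ω)
  have := (H r F Ω π P).1
  have : SecondCountableTopology Ω := UniformSpace.secondCountable_of_separable Ω
  obtain ⟨s, hs, hsU⟩ := TopologicalSpace.countable_cover_nhds
    (f := fun ω : Ω => Metric.ball ω (ε ω / 2)) fun ω => Metric.ball_mem_nhds _ (half_pos (hε ω))
  have hsne : s.Nonempty := by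
    have : π (fun _ => p) ∈ ⋃ x ∈ s, Metric.ball x (ε x / 2) := by rw [hsU]; trivial
    simp only [Set.mem_iUnion] at this
    obtain ⟨x, hx, -⟩ := this
    exact ⟨x, hx⟩
  obtain ⟨f, rfl⟩ := hs.exists_eq_range hsne
  obtain ⟨φ, hφ, hφA⟩ := extraction_forall_of_frequently
    (P := fun k n => ∀ i ≤ k, ε (f i) ≤ dist (y n) (l (f i) n) / r n) (by
      intro k
      have : ∀ᶠ n in (U : Filter ℕ), ∀ i ≤ k, ε (f i) ≤ dist (y n) (l (f i) n) / r n := by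
        have := (Set.finite_Iic k).eventually_all (l := (U : Filter ℕ))
          (p := fun i n => ε (f i) ≤ dist (y n) (l (f i) n) / r n)
        exact this.2 fun i _ => hεU (f i)
      exact this.frequently.filter_mono hU)
  obtain ⟨ψ, hψ, hst⟩ := stab H P hy hφ
  have hθ : StrictMono (φ ∘ ψ) := hφ.comp hψ
  have hs0 : SelfStable (r ∘ φ ∘ ψ) (insert (y ∘ φ ∘ ψ) ((fun x => x ∘ φ ∘ ψ) '' F)) := by
    rintro a (rfl | ⟨x, hx, rfl⟩) b (rfl | ⟨x', hx', rfl⟩)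
    · exact ⟨0, by simp⟩
    · exact hst x' hx'
    · obtain ⟨L, hL⟩ := hst x hx
      exact ⟨L, by simpa only [dist_comm] using hL⟩
    · exact ⟨_, (P.2.2.2 x hx x' hx').comp hθ.tendsto_atTop⟩
  obtain ⟨F', hF', hm⟩ := exists_maximal (p := p) hs0 (Or.inr ⟨_, P.2.1.2.1, rfl⟩)
  obtain ⟨x, hx, hlim⟩ := (H r F Ω π P).2 _ hθ F' hm
    (fun x hx => hF' (Or.inr ⟨x, hx, rfl⟩)) _ (hF' (Or.inl rfl))
  have : π x ∈ ⋃ z ∈ Set.range f, Metric.ball z (ε z / 2) := by rw [hsU]; trivial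
  simp only [Set.mem_iUnion] at this
  obtain ⟨_, ⟨i, rfl⟩, hi⟩ := this
  rw [Metric.mem_ball] at hi
  have h3 := hlim.add ((P.2.2.2 x hx _ (hl (f i))).comp hθ.tendsto_atTop)
  have h4 : ε (f i) ≤ 0 + dist (π x) (π (l (f i))) := by
    refine ge_of_tendsto h3 ?_
    filter_upwards [eventually_ge_atTop i] with k hk
    have := hφA (ψ k) i (hk.trans (hψ.id_le k))
    refine this.trans ?_
    simp only [Function.comp]
    rw [← add_div]
    apply div_le_div_of_nonneg_right _ (hr _).le
    exact dist_triangle_left _ _ _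
  rw [hl'] at h4
  linarith [hε (f i)]

end PT


namespace PT

variable {X : Type u} [MetricSpace X] {p : X}
variable {r : ℕ → ℝ} {F : Set (ℕ → X)} {Ω : Type u} [MetricSpace Ω] {π : (ℕ → X) → Ω}

theorem to_p (hr : IsNormalizingSeq r) {x : ℕ → X} {B : ℝ} (h : ∀ n, dist (x n) p ≤ B * r n) :
    Tendsto x atTop (𝓝 p) := by
  rw [tendsto_iff_dist_tendsto_zero]
  refine squeeze_zero (fun _ => dist_nonneg) h ?_
  simpa using hr.2.const_mul B

theorem A3_ge (p w x y z : X) {c : ℝ} (h : c ≤ A3 p w x y z) :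
    c * delta4 p w x y z ^ 2 ≤ dist x w * dist y z + dist x z * dist y w - dist x y * dist w z := by
  unfold A3 at h
  split_ifs at h with h1
  · obtain ⟨rfl, rfl, rfl, rfl⟩ := h1
    simp [delta4]
  · have hd : 0 < delta4 p w x y z := by
      by_contra hn
      push Not at hn
      unfold delta4 at hn
      simp only [max_le_iff, dist_le_zero] at hn
      exact h1 ⟨hn.1, hn.2.1, hn.2.2.1, hn.2.2.2⟩
    rwa [le_div_iff₀ (by positivity)] at h

theorem A3_bdd (p w x y z : X) : -4 ≤ A3 p w x y z := by
  unfold A3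
  split_ifs with h1
  · norm_num
  · have hd : 0 < delta4 p w x y z := by
      by_contra hn
      push Not at hn
      unfold delta4 at hn
      simp only [max_le_iff, dist_le_zero] at hn
      exact h1 ⟨hn.1, hn.2.1, hn.2.2.1, hn.2.2.2⟩
    rw [le_div_iff₀ (by positivity)]
    have hw : dist w p ≤ delta4 p w x y z := by simp [delta4]
    have hx : dist x p ≤ delta4 p w x y z := by simp [delta4]
    have hy : dist y p ≤ delta4 p w x y z := by simp [delta4]
    have hz : dist z p ≤ delta4 p w x y z := by simp [delta4]
    have a1 := dist_triangle_right x y p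
    have a2 := dist_triangle_right w z p
    have a3 : dist x y * dist w z ≤ (2 * delta4 p w x y z) * (2 * delta4 p w x y z) :=
      mul_le_mul (by linarith) (by linarith) dist_nonneg (by positivity)
    have a4 : 0 ≤ dist x w * dist y z + dist x z * dist y w := by positivity
    linarith

theorem ptol (hA3 : 0 ≤ liminf (fun q : X × X × X × X => A3 p q.1 q.2.1 q.2.2.1 q.2.2.2)
        (𝓝 (p, p, p, p))) (P : IsPretangentSpace p r F π) : Ptolemaic Ω := by
  intro x y u v
  have hr := P.1.1
  obtain ⟨x, hx, rfl⟩ := P.2.2.1 x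
  obtain ⟨y, hy, rfl⟩ := P.2.2.1 y
  obtain ⟨u, hu, rfl⟩ := P.2.2.1 u
  obtain ⟨v, hv, rfl⟩ := P.2.2.1 v
  obtain ⟨Bx, hBx⟩ := bdd P hx
  obtain ⟨By, hBy⟩ := bdd P hy
  obtain ⟨Bu, hBu⟩ := bdd P hu
  obtain ⟨Bv, hBv⟩ := bdd P hv
  set C := max Bx (max By (max Bu Bv)) with hC
  have c1 : Bx ≤ C := by simp [hC]
  have c2 : By ≤ C := by simp [hC]
  have c3 : Bu ≤ C := by simp [hC]
  have c4 : Bv ≤ C := by simp [hC]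
  have hlim : Tendsto (fun n => (u n, x n, y n, v n)) atTop (𝓝 (p, p, p, p)) :=
    (to_p P.1 hBu).prodMk_nhds ((to_p P.1 hBx).prodMk_nhds ((to_p P.1 hBy).prodMk_nhds (to_p P.1 hBv)))
  have lim := (((P.2.2.2 x hx u hu).mul (P.2.2.2 y hy v hv)).add
    ((P.2.2.2 x hx v hv).mul (P.2.2.2 y hy u hu))).sub
    ((P.2.2.2 x hx y hy).mul (P.2.2.2 u hu v hv))
  have key : ∀ ε > 0, -ε * C ^ 2 ≤ dist (π x) (π u) * dist (π y) (π v) + dist (π x) (π v) * dist (π y) (π u)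
      - dist (π x) (π y) * dist (π u) (π v) := by
    intro ε hε
    have h1 : ∀ᶠ q in 𝓝 (p, p, p, p), -ε < A3 p q.1 q.2.1 q.2.2.1 q.2.2.2 :=
      eventually_lt_of_lt_liminf (lt_of_lt_of_le (by linarith) hA3)
        ⟨-4, eventually_map.2 (Eventually.of_forall fun q => A3_bdd _ _ _ _ _)⟩
    refine ge_of_tendsto lim ?_
    filter_upwards [hlim.eventually h1] with n hn
    have h2 := A3_ge p (u n) (x n) (y n) (v n) hn.le
    have hrn := hr n
    have h3 : delta4 p (u n) (x n) (y n) (v n) ≤ C * r n := by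
      simp only [delta4, max_le_iff]
      refine ⟨(hBu n).trans ?_, (hBx n).trans ?_, (hBy n).trans ?_, (hBv n).trans ?_⟩ <;>
      gcongr
    have h0 : 0 ≤ delta4 p (u n) (x n) (y n) (v n) := le_trans dist_nonneg (le_max_left _ _)
    have h4 : delta4 p (u n) (x n) (y n) (v n) ^ 2 ≤ (C * r n) ^ 2 := pow_le_pow_left₀ h0 h3 2
    have e : dist (x n) (u n) / r n * (dist (y n) (v n) / r n) +
        dist (x n) (v n) / r n * (dist (y n) (u n) / r n) -
        dist (x n) (y n) / r n * (dist (u n) (v n) / r n) =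
        (dist (x n) (u n) * dist (y n) (v n) + dist (x n) (v n) * dist (y n) (u n)
          - dist (x n) (y n) * dist (u n) (v n)) / r n ^ 2 := by
      field_simp
    rw [e, le_div_iff₀ (by positivity)]
    nlinarith
  by_contra hcon
  push Not at hcon
  set N := dist (π x) (π u) * dist (π y) (π v) + dist (π x) (π v) * dist (π y) (π u)
      - dist (π x) (π y) * dist (π u) (π v)
  have hN : N < 0 := by simp only [N]; linarith
  have hC1 : 0 < C ^ 2 + 1 := by positivity
  have := key (-N / (2 * (C ^ 2 + 1))) (div_pos (by linarith) (by positivity))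
  have e : -(-N / (2 * (C ^ 2 + 1))) * C ^ 2 = N * (C ^ 2 / (2 * (C ^ 2 + 1))) := by ring
  rw [e] at this
  have h5 : C ^ 2 / (2 * (C ^ 2 + 1)) < 1 := by
    rw [div_lt_one (by positivity)]; nlinarith [sq_nonneg C]
  nlinarith

theorem midQuot_lt {w x y z : X} {ε : ℝ} (hw : w = x ∨ w = y)
    (h : midQuot p w x y z < (ε : EReal)) :
    |dist w z - dist x y / 2| ≤ ε * max (dist x p) (dist y p) := by
  unfold midQuot at h
  split_ifs at h with h1 h2
  · obtain ⟨rfl, rfl⟩ := h1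
    subst h2
    rcases hw with rfl | rfl <;> simp
  · exact absurd h (by simp)
  · rw [EReal.coe_lt_coe_iff] at h
    have : 0 < max (dist x p) (dist y p) := by
      by_contra hn
      push Not at hn
      simp only [max_le_iff, dist_le_zero] at hn
      exact h1 hn
    rw [div_lt_iff₀ this] at h
    exact h.le

theorem mid (H : HST p) (hB : MidpointConvexAt p) (P : IsPretangentSpace p r F π) (a b : Ω) :
    ∃ m, dist a m = dist a b / 2 ∧ dist m b = dist a b / 2 := by
  have hr := P.1.1
  obtain ⟨x, hx, rfl⟩ := P.2.2.1 a
  obtain ⟨y, hy, rfl⟩ := P.2.2.1 b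
  obtain ⟨Bx, hBx⟩ := bdd P hx
  obtain ⟨By, hBy⟩ := bdd P hy
  obtain ⟨z, hz1, hz2⟩ := hB x y (to_p P.1 hBx) (to_p P.1 hBy)
  set C := max Bx By with hC
  have c1 : Bx ≤ C := by simp [hC]
  have c2 : By ≤ C := by simp [hC]
  have hCx : ∀ n, dist (x n) p ≤ C * r n := fun n => (hBx n).trans (by have := hr n; gcongr)
  have hCy : ∀ n, dist (y n) p ≤ C * r n := fun n => (hBy n).trans (by have := hr n; gcongr)
  have C0 : 0 ≤ C := by
    have := (dist_nonneg).trans (hCx 0)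
    exact nonneg_of_mul_nonneg_left this (hr 0)
  have e1 : ∀ ε > 0, ∀ᶠ n in atTop, |dist (x n) (z n) - dist (x n) (y n) / 2| ≤ ε * (C * r n) ∧
      |dist (y n) (z n) - dist (x n) (y n) / 2| ≤ ε * (C * r n) := by
    intro ε hε
    have hε' : (0 : EReal) < (ε : EReal) := by exact_mod_cast hε
    filter_upwards [hz1.eventually (gt_mem_nhds hε'), hz2.eventually (gt_mem_nhds hε')] with n h1 h2
    have hm : max (dist (x n) p) (dist (y n) p) ≤ C * r n := max_le (hCx n) (hCy n)
    exact ⟨(midQuot_lt (Or.inl rfl) h1).trans (by gcongr), (midQuot_lt (Or.inr rfl) h2).trans (by gcongr)⟩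
  classical
  set z' : ℕ → X := fun n => if dist (z n) p ≤ 4 * C * r n then z n else p with hz'
  have hz'b : ∀ n, dist (z' n) p ≤ 4 * C * r n := by
    intro n
    simp only [hz']
    split_ifs with h
    · exact h
    · rw [dist_self]; have := hr n; positivity
  have hz'e : ∀ᶠ n in atTop, z' n = z n := by
    filter_upwards [e1 1 one_pos] with n hn
    simp only [hz']
    rw [if_pos]
    have h1 := (abs_le.1 hn.1).2
    have h2 := dist_triangle_left (z n) p (x n)
    have h3 := dist_triangle_right (x n) (y n) p
    linarith [hCx n, hCy n, dist_nonneg.trans (hCx n)]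
  have hU := Nat.hyperfilter_le_atTop
  obtain ⟨m, hm, hlim⟩ := UL H P (hyperfilter ℕ) hU hz'b
  have fin : ∀ w ∈ F, (∀ ε > 0, ∀ᶠ n in atTop, |dist (w n) (z n) - dist (x n) (y n) / 2| ≤ ε * (C * r n)) →
      dist (π w) (π m) = dist (π x) (π y) / 2 := by
    intro w hw h
    have key : ∀ ε > 0, |dist (π w) (π m) - dist (π x) (π y) / 2| ≤ 0 + ε * C := by
      intro ε hε
      refine le_of_tendsto_of_tendsto
        ((((P.2.2.2 w hw m hm).sub ((P.2.2.2 x hx y hy).div_const 2)).abs).mono_left hU)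
        (hlim.add_const (ε * C)) ?_
      filter_upwards [hU (h ε hε), hU hz'e] with n h1 h2
      have hrn := hr n
      rw [h2]
      have h3 : |dist (w n) (m n) - dist (x n) (y n) / 2| ≤ dist (z n) (m n) + ε * (C * r n) := by
        have q1 := abs_le.1 h1
        have q2 := dist_triangle (w n) (z n) (m n)
        have q3 := dist_triangle_right (w n) (z n) (m n)
        rw [abs_le]; constructor <;> linarith [q1.1, q1.2]
      have e : dist (w n) (m n) / r n - dist (x n) (y n) / r n / 2 =
          (dist (w n) (m n) - dist (x n) (y n) / 2) / r n := by ring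
      rw [e, abs_div, abs_of_pos hrn, div_le_iff₀ hrn]
      calc _ ≤ _ := h3
        _ = _ := by field_simp
    have : |dist (π w) (π m) - dist (π x) (π y) / 2| ≤ 0 := by
      apply le_of_forall_pos_le_add
      intro ε hε
      have := key (ε / (C + 1)) (by positivity)
      have h2 : ε / (C + 1) * C ≤ ε := by
        rw [div_mul_eq_mul_div, div_le_iff₀ (by positivity)]; nlinarith
      linarith
    have := abs_nonpos_iff.1 this
    linarith
  refine ⟨π m, fin x hx fun ε hε => (e1 ε hε).mono fun n h => h.1, ?_⟩
  rw [dist_comm]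
  exact fin y hy fun ε hε => (e1 ε hε).mono fun n h => h.2

theorem proper (H : HST p) (P : IsPretangentSpace p r F π) : ProperSpace Ω := by
  have hr := P.1.1
  have hU := Nat.hyperfilter_le_atTop
  refine ⟨fun c R0 => ?_⟩
  apply IsSeqCompact.isCompact
  intro ω hω
  set R := R0 + dist c (π fun _ => p) with hR
  have hωR : ∀ k, dist (ω k) (π fun _ => p) ≤ R := fun k => by
    have := dist_triangle (ω k) c (π fun _ => p)
    have h2 := Metric.mem_closedBall.1 (hω k)
    linarith
  have R0 : 0 ≤ R := dist_nonneg.trans (hωR 0)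
  choose x hx hxω using fun k => P.2.2.1 (ω k)
  obtain ⟨w, hw, hd⟩ := dense_lift H P
  let Q : ℕ → ℕ → Prop := fun n k => dist (x k n) p / r n ≤ R + 1 ∧
    ∀ j ≤ k, |dist (x k n) (w j n) / r n - dist (ω k) (π (w j))| ≤ 1 / ((k : ℝ) + 1)
  have hQ : ∀ k, ∀ᶠ n in atTop, Q n k := by
    intro k
    have h1 := (P.2.2.2 _ (hx k) _ P.2.1.2.1).eventually (gt_mem_nhds
      (show dist (π (x k)) (π fun _ => p) < R + 1 by rw [hxω]; linarith [hωR k]))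
    have h2 : ∀ᶠ n in atTop, ∀ j ≤ k, |dist (x k n) (w j n) / r n - dist (ω k) (π (w j))| ≤ 1 / ((k : ℝ) + 1) := by
      refine ((Set.finite_Iic k).eventually_all (l := (atTop : Filter ℕ)) (p := fun j n =>
        |dist (x k n) (w j n) / r n - dist (ω k) (π (w j))| ≤ 1 / ((k : ℝ) + 1))).2 fun j _ => ?_
      have h3 := Metric.tendsto_nhds.1 (P.2.2.2 _ (hx k) _ (hw j)) (1 / ((k : ℝ) + 1)) (by positivity)
      filter_upwards [h3] with n hn
      rw [Real.dist_eq, hxω] at hn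
      exact hn.le
    filter_upwards [h1, h2] with n a b using ⟨a.le, b⟩
  classical
  set κ : ℕ → ℕ := fun n => Nat.findGreatest (Q n) n with hκ
  have hκ1 : ∀ K, ∀ᶠ n in atTop, K ≤ κ n ∧ Q n (κ n) := by
    intro K
    filter_upwards [hQ K, eventually_ge_atTop K] with n h1 h2
    exact ⟨Nat.le_findGreatest h2 h1, Nat.findGreatest_spec h2 h1⟩
  set z : ℕ → X := fun n => if dist (x (κ n) n) p ≤ (R + 1) * r n then x (κ n) n else p with hz
  have hzb : ∀ n, dist (z n) p ≤ (R + 1) * r n := by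
    intro n
    simp only [hz]
    split_ifs with h
    · exact h
    · rw [dist_self]; have := hr n; positivity
  obtain ⟨q, hq, hlim⟩ := UL H P (hyperfilter ℕ) hU hzb
  have hcl : MapClusterPt (π q) atTop ω := by
    rw [Metric.nhds_basis_ball.mapClusterPt_iff_frequently]
    intro ε hε
    rw [frequently_atTop]
    intro N
    obtain ⟨j, hj⟩ := hd (π q) (ε / 4) (by positivity)
    obtain ⟨K, hK⟩ := exists_nat_one_div_lt (show 0 < ε / 4 by positivity)
    have h1 := ((P.2.2.2 _ hq _ (hw j)).eventually (gt_mem_nhds (by rwa [dist_comm] : dist (π q) (π (w j)) < ε / 4))).filter_mono hU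
    have h2 := hlim.eventually (gt_mem_nhds (show 0 < ε / 4 by positivity))
    have h3 := (hκ1 (max N (max j K))).filter_mono hU
    obtain ⟨n, ⟨a1, a2⟩, a3, a4⟩ := ((h1.and h2).and h3).exists
    simp only [max_le_iff] at a3
    refine ⟨κ n, a3.1, ?_⟩
    rw [Metric.mem_ball]
    have hrn := hr n
    have b1 : z n = x (κ n) n := by
      simp only [hz]; rw [if_pos]; exact (div_le_iff₀ hrn).1 a4.1
    have b2 := (abs_le.1 (a4.2 j a3.2.1)).1
    have b3 : 1 / ((κ n : ℝ) + 1) ≤ 1 / ((K : ℝ) + 1) := by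
      have : (K : ℝ) ≤ κ n := by exact_mod_cast a3.2.2
      gcongr
    have b4 : dist (x (κ n) n) (w j n) / r n ≤ dist (z n) (q n) / r n + dist (q n) (w j n) / r n := by
      rw [← add_div, b1]
      exact div_le_div_of_nonneg_right (dist_triangle _ _ _) hrn.le
    have b5 := dist_triangle (ω (κ n)) (π (w j)) (π q)
    linarith
  obtain ⟨ψ, hψ, hψl⟩ := hcl.tendsto_subseq
  exact ⟨π q, Metric.isClosed_closedBall.mem_of_tendsto hψl (Eventually.of_forall fun n => hω _), ψ, hψ, hψl⟩

end PT


namespace PT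

variable {X : Type u} [MetricSpace X] {p : X}
variable {r : ℕ → ℝ} {F : Set (ℕ → X)} {Ω : Type u} [MetricSpace Ω] {π : (ℕ → X) → Ω}

theorem transfer (H : HST p) (P : IsPretangentSpace p r F π) {r' : ℕ → ℝ} {F' : Set (ℕ → X)}
    {Ω' : Type u} [MetricSpace Ω'] {π' : (ℕ → X) → Ω'} (P' : IsPretangentSpace p r' F' π')
    {θ : ℕ → ℕ} (hθ : StrictMono θ) {c : ℝ} (hc : 0 < c) (hrr : ∀ n, r' (θ n) = c * r n) :
    ∃ T : Ω' → Ω, Function.Surjective T ∧ (∀ a b, dist (T a) (T b) = c * dist a b) ∧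
      ∀ x ∈ F', ∀ y ∈ F, (∀ n, x (θ n) = y n) → T (π' x) = π y := by
  have hr := P.1.1
  have hr' := P'.1.1
  have hU := Nat.hyperfilter_le_atTop
  let Rel : (ℕ → X) → (ℕ → X) → Prop := fun x y =>
    Tendsto (fun n => dist (x (θ n)) (y n) / r n) (hyperfilter ℕ) (𝓝 0)
  have r1 : ∀ x ∈ F', ∃ y ∈ F, Rel x y := by
    intro x hx
    obtain ⟨B, hB⟩ := bdd P' hx
    exact UL H P (hyperfilter ℕ) hU (y := x ∘ θ) (C := B * c) (fun n => by
      have := hB (θ n); rw [hrr, ← mul_assoc] at this; exact this)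
  have r2 : ∀ x ∈ F', ∀ y ∈ F, ∀ x' ∈ F', ∀ y' ∈ F, Rel x y → Rel x' y' →
      dist (π y) (π y') = c * dist (π' x) (π' x') := by
    intro x hx y hy x' hx' y' hy' h h'
    have l1 := (((P'.2.2.2 x hx x' hx').comp hθ.tendsto_atTop).const_mul c).mono_left hU
    have l2 := (P.2.2.2 y hy y' hy').mono_left hU
    have l3 := (l2.sub l1).abs
    have l4 : |dist (π y) (π y') - c * dist (π' x) (π' x')| ≤ 0 + 0 := by
      refine le_of_tendsto_of_tendsto l3 (h.add h') (Eventually.of_forall fun n => ?_)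
      simp only [Function.comp]
      have hrn := hr n
      rw [hrr, show c * (dist (x (θ n)) (x' (θ n)) / (c * r n)) = dist (x (θ n)) (x' (θ n)) / r n by
        field_simp, ← sub_div, ← add_div, abs_div, abs_of_pos hrn]
      apply div_le_div_of_nonneg_right _ hrn.le
      have q1 := dist_triangle4 (x (θ n)) (y n) (y' n) (x' (θ n))
      have q2 := dist_triangle4 (y n) (x (θ n)) (x' (θ n)) (y' n)
      rw [dist_comm (y' n) (x' (θ n))] at q1
      rw [dist_comm (y n) (x (θ n))] at q2
      rw [abs_le]; constructor <;> linarith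
    rw [add_zero] at l4
    have := abs_nonpos_iff.1 l4
    linarith
  have r3 : ∀ y ∈ F, ∃ x ∈ F', Rel x y := by
    intro y hy
    obtain ⟨B, hB⟩ := bdd P hy
    have B0 : 0 ≤ B := nonneg_of_mul_nonneg_left (dist_nonneg.trans (hB 0)) (hr 0)
    classical
    set z : ℕ → X := fun m => if h : ∃ n, θ n = m then y h.choose else p with hz
    have hzθ : ∀ n, z (θ n) = y n := by
      intro n
      have h : ∃ k, θ k = θ n := ⟨n, rfl⟩
      simp only [hz]
      rw [dif_pos h, hθ.injective h.choose_spec]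
    have hzb : ∀ m, dist (z m) p ≤ B / c * r' m := by
      intro m
      by_cases h : ∃ n, θ n = m
      · obtain ⟨n, rfl⟩ := h
        rw [hzθ, hrr, show B / c * (c * r n) = B * r n by field_simp]
        exact hB n
      · simp only [hz]
        rw [dif_neg h, dist_self]
        have := hr' m
        positivity
    obtain ⟨x, hx, hlim⟩ := UL H P' ((hyperfilter ℕ).map θ)
      ((hθ.tendsto_atTop.mono_left hU)) hzb
    refine ⟨x, hx, ?_⟩
    have h2 : Tendsto (fun n => dist (z (θ n)) (x (θ n)) / r' (θ n)) (hyperfilter ℕ) (𝓝 0) := hlim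
    have h3 := h2.const_mul c
    rw [mul_zero] at h3
    refine h3.congr fun n => ?_
    have hrn := hr n
    rw [hzθ, hrr, dist_comm]
    field_simp
  choose l hl hl' using P'.2.2.1
  choose Yf hYF hYR using fun ω : Ω' => r1 (l ω) (hl ω)
  have hT : ∀ x ∈ F', ∀ y ∈ F, Rel x y → π (Yf (π' x)) = π y := by
    intro x hx y hy h
    have := r2 _ (hl (π' x)) _ (hYF (π' x)) x hx y hy (hYR _) h
    rw [hl', dist_self, mul_zero] at this
    exact dist_eq_zero.1 this
  refine ⟨fun ω => π (Yf ω), ?_, ?_, ?_⟩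
  · intro ω
    obtain ⟨y, hy, rfl⟩ := P.2.2.1 ω
    obtain ⟨x, hx, h⟩ := r3 y hy
    exact ⟨π' x, hT x hx y hy h⟩
  · intro a b
    rw [r2 _ (hl a) _ (hYF a) _ (hl b) _ (hYF b) (hYR a) (hYR b), hl', hl']
  · intro x hx y hy h
    apply hT x hx y hy
    simp only [Rel, h, dist_self, zero_div]
    exact tendsto_const_nhds

theorem even_odd {f : ℕ → ℝ} {L : ℝ} (h0 : Tendsto (fun n => f (2 * n)) atTop (𝓝 L))
    (h1 : Tendsto (fun n => f (2 * n + 1)) atTop (𝓝 L)) : Tendsto f atTop (𝓝 L) := by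
  intro s hs
  obtain ⟨N, hN⟩ := eventually_atTop.1 ((h0.eventually_mem hs).and (h1.eventually_mem hs))
  rw [mem_map, mem_atTop_sets]
  refine ⟨2 * N + 1, fun n hn => ?_⟩
  rcases Nat.even_or_odd' n with ⟨k, rfl | rfl⟩
  · exact (hN k (by omega)).1
  · exact (hN k (by omega)).2

/-- Interleaving of two sequences. -/
def ilv {A : Type*} (a b : ℕ → A) (n : ℕ) : A := if n % 2 = 0 then a (n / 2) else b (n / 2)

theorem ilv_even {A : Type*} (a b : ℕ → A) (n : ℕ) : ilv a b (2 * n) = a n := by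
  simp [ilv]

theorem ilv_odd {A : Type*} (a b : ℕ → A) (n : ℕ) : ilv a b (2 * n + 1) = b n := by
  have h1 : (2 * n + 1) % 2 = 1 := by omega
  have h2 : (2 * n + 1) / 2 = n := by omega
  simp [ilv, h1, h2]

theorem uh (H : HST p) (P : IsPretangentSpace p r F π) (R : Set (Ω × Ω)) (lam : ℝ) (hlam : 0 < lam)
    (hp : (π (fun _ => p), π (fun _ => p)) ∈ R)
    (hR : ∀ z ∈ R, ∀ z' ∈ R, dist z.2 z'.2 = lam * dist z.1 z'.1) :
    ∃ g : Ω → Ω, Function.Surjective g ∧ (∀ a b, dist (g a) (g b) = lam * dist a b) ∧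
      ∀ z ∈ R, g z.1 = z.2 := by
  have hr := P.1.1
  have : ∀ ω : Ω, ∃ x ∈ F, π x = ω ∧ (ω = π (fun _ => p) → x = fun _ => p) := by
    intro ω
    by_cases h : ω = π (fun _ => p)
    · exact ⟨_, P.2.1.2.1, h.symm, fun _ => rfl⟩
    · obtain ⟨x, hx, e⟩ := P.2.2.1 ω
      exact ⟨x, hx, e, fun h' => absurd h' h⟩
  choose l hl hl' hlp using this
  set r' : ℕ → ℝ := ilv (fun n => lam * r n) r with hr'
  have hn : IsNormalizingSeq r' := by
    constructor
    · intro n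
      simp only [hr', ilv]
      split_ifs
      · exact mul_pos hlam (hr _)
      · exact hr _
    · apply even_odd
      · simp only [hr', ilv_even]
        simpa using P.1.2.const_mul lam
      · simp only [hr', ilv_odd]
        exact P.1.2
  set b : Ω × Ω → ℕ → X := fun z => ilv (l z.2) (l z.1) with hb
  have hs : SelfStable r' (b '' R) := by
    rintro _ ⟨z, hz, rfl⟩ _ ⟨z', hz', rfl⟩
    refine ⟨dist z.1 z'.1, even_odd ?_ ?_⟩
    · simp only [hr', hb, ilv_even]
      have h1 := (P.2.2.2 _ (hl z.2) _ (hl z'.2)).div_const lam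
      rw [hl', hl', hR z hz z' hz', mul_div_cancel_left₀ _ hlam.ne'] at h1
      refine h1.congr fun n => ?_
      rw [div_div, mul_comm]
    · simp only [hr', hb, ilv_odd]
      have h1 := P.2.2.2 _ (hl z.1) _ (hl z'.1)
      rwa [hl', hl'] at h1
  have hbp : (fun _ => p) ∈ b '' R := by
    refine ⟨_, hp, ?_⟩
    funext n
    simp only [hb, hlp _ rfl, ilv, ite_self]
  obtain ⟨F', hF', hm⟩ := exists_maximal hs hbp
  obtain ⟨Ω', _, π', P'⟩ := realize hn hm
  obtain ⟨Te, Te1, Te2, Te3⟩ := transfer H P P' (θ := fun n => 2 * n)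
    (fun a b h => by simp only; omega) hlam (fun n => by simp only [hr', ilv_even])
  obtain ⟨To, To1, To2, To3⟩ := transfer H P P' (θ := fun n => 2 * n + 1)
    (fun a b h => by simp only; omega) one_pos (fun n => by simp only [hr', ilv_odd, one_mul])
  have Toi : Function.Injective To := fun a b h => by
    have := To2 a b
    rw [h, dist_self, one_mul] at this
    exact dist_eq_zero.1 this.symm
  set S := Function.surjInv To1
  have hS : ∀ a, To (S a) = a := Function.surjInv_eq To1
  have hS' : ∀ u, S (To u) = u := fun u => Toi (hS _)
  refine ⟨fun a => Te (S a), ?_, ?_, ?_⟩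
  · intro ω
    obtain ⟨u, rfl⟩ := Te1 ω
    exact ⟨To u, by simp only [hS']⟩
  · intro a b
    have := To2 (S a) (S b)
    rw [hS, hS, one_mul] at this
    rw [Te2, this]
  · intro z hz
    have hbz : b z ∈ F' := hF' ⟨z, hz, rfl⟩
    have e1 := To3 (b z) hbz (l z.1) (hl _) (fun n => by simp only [hb, ilv_odd])
    have e2 := Te3 (b z) hbz (l z.2) (hl _) (fun n => by simp only [hb, ilv_even])
    rw [hl'] at e1 e2
    simp only
    rw [← e1, hS', e2]

theorem good (H : HST p) (hA3 : 0 ≤ liminf (fun q : X × X × X × X => A3 p q.1 q.2.1 q.2.2.1 q.2.2.2)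
        (𝓝 (p, p, p, p))) (hB : BusemannConvexAt p) (P : IsPretangentSpace p r F π) :
    Good Ω (π fun _ => p) where
  proper := proper H P
  mid := mid H hB.1 P
  ptol := ptol hA3 P
  uh := fun R lam h0 hp hR => uh H P R lam h0 hp hR

end PT


/-- if every pretangent space is separable and tangent,
`liminf_{w,x,y,z → p} A₃ ≥ 0` and `X` is Busemann convex at `p`, then every
pretangent space is a Ptolemaic, Busemann convex geodesic metric space
(hence CAT(0)). -/
theorem pretangent_CAT0_of_liminf_A3_and_busemannConvexAt
    {X : Type u} [MetricSpace X] (p : X)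
    (hst : ∀ (r : ℕ → ℝ) (F : Set (ℕ → X)) (Ω : Type u) [MetricSpace Ω]
      (π : (ℕ → X) → Ω), IsPretangentSpace p r F π →
      TopologicalSpace.SeparableSpace Ω ∧ IsTangentFamily p r F)
    (hA3 : 0 ≤ liminf (fun q : X × X × X × X => A3 p q.1 q.2.1 q.2.2.1 q.2.2.2)
        (𝓝 (p, p, p, p)))
    (hB : BusemannConvexAt p) :
    ∀ (r : ℕ → ℝ) (F : Set (ℕ → X)) (Ω : Type u) [MetricSpace Ω]
      (π : (ℕ → X) → Ω), IsPretangentSpace p r F π →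
      Ptolemaic Ω ∧ IsGeodesicSpace Ω ∧ BusemannConvex Ω := by
  intro r F Ω _ π P
  have H : PT.HST p := hst
  have G := PT.good H hA3 hB P
  exact ⟨PT.ptol hA3 P, G.main⟩
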